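/- There exists a unique family (φ_m)_{m ∈ ℕ^d, |m| ≥ 2} of ℂ^d-valued polynomials in x of degree at most S with the following property: setting φ(x,u) = Σ_{|m| ≥ 2} φ_m(x) u^m (a formal power series in u), the corrected system du/dx = A(x) u + Q(x)^{−1} [f(x,u) − φ(x,u)] is formally linearizable by a change of variable u = w + h(x,w) = w + Σ_{|m| ≥ 2} h_m(x) w^m with each coefficient h_m analytic on D; that is, there exist ℂ^d-valued functions h_m analytic on D such that the conjugacy identity ∂_x h + (d_w h)(A(x) w) = A(x) h + Q(x)^{−1}[ f(x, w + h(x,w)) − φ(x, w + h(x,w)) ] holds order by order (in each homogeneous degree of the formal power-series variable w). -/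

import Mathlib

open Matrix Set Filter Topology Asymptotics

/-- A matrix is nonlinearly nonresonant if its eigenvalues `λ₁, …, λ_d` (with
multiplicity) satisfy `k + m·λ − λᵢ ≠ 0` for all `k ∈ ℕ`, `m ∈ ℕᵈ` with `|m| ≥ 2`,
`1 ≤ i ≤ d`. -/
def NonlinearlyNonresonant (d : ℕ) (M : Matrix (Fin d) (Fin d) ℂ) : Prop :=
  ∃ lam : Fin d → ℂ,
    M.charpoly = ∏ i, (Polynomial.X - Polynomial.C (lam i)) ∧
    ∀ (k : ℕ) (m : Fin d → ℕ) (i : Fin d), 2 ≤ ∑ j, m j →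
      (k : ℂ) + (∑ j, (m j : ℂ) * lam j) - lam i ≠ 0

/-- The truncation to total degree `≤ n` of the formal series
`Σ_{|m| ≥ 2} H_m(x) w^m` : `Σ_{2 ≤ |m| ≤ n} H_m(x) w^m`. -/
noncomputable def truncSeries (d n : ℕ) (H : (Fin d → ℕ) → ℂ → Fin d → ℂ)
    (x : ℂ) (w : Fin d → ℂ) : Fin d → ℂ :=
  ∑ m ∈ (Finset.Iic (fun _ => n : Fin d → ℕ)).filter
      (fun m => 2 ≤ ∑ i, m i ∧ ∑ i, m i ≤ n),
    (∏ i, w i ^ m i) • H m x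

/-- Constancy of the index along a connected family of injective operators. -/
theorem index_const {X Y F : Type*} [NormedAddCommGroup X] [NormedSpace ℂ X] [CompleteSpace X]
    [NormedAddCommGroup Y] [NormedSpace ℂ Y] [CompleteSpace Y]
    [NormedAddCommGroup F] [NormedSpace ℂ F] [FiniteDimensional ℂ F]
    (T : ℂ → X →L[ℂ] Y) (hT : Continuous T) (ι : F →L[ℂ] Y) (G : Set ℂ) (hG : IsPreconnected G)
    (hinj : ∀ z ∈ G, ∀ x, T z x = 0 → x = 0)
    (hs : ∀ z ∈ G, ∀ y, ∃ x φ, T z x + ι φ = y) (z0 : ℂ) (hz0 : z0 ∈ G)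
    (h0 : ∀ x φ, T z0 x + ι φ = 0 → φ = 0) :
    ∀ z ∈ G, ∀ x φ, T z x + ι φ = 0 → φ = 0 := by
  have : CompleteSpace F := FiniteDimensional.complete ℂ F
  have key : ∀ z ∈ G, ∃ F1 : Submodule ℂ F,
      ((∀ x φ, T z x + ι φ = 0 → φ = 0) → F1 = ⊤) ∧
      (F1 = ⊤ → (∀ x φ, T z x + ι φ = 0 → φ = 0)) ∧
      ∀ᶠ z' in 𝓝 z, Function.Bijective ((T z').coprod (ι.comp F1.subtypeL)) := by
    intro z hz
    let F0 : Submodule ℂ F := (LinearMap.range (T z).toLinearMap).comap ι.toLinearMap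
    obtain ⟨F1, hF1⟩ := F0.exists_isCompl
    have hF0 : (∀ x φ, T z x + ι φ = 0 → φ = 0) ↔ F0 = ⊥ := by
      rw [Submodule.eq_bot_iff]
      constructor
      · rintro h φ ⟨x, hx⟩
        refine h (-x) φ ?_
        have : T z x = ι φ := hx
        simp [this]
      · intro h x φ hx
        refine h φ ⟨-x, ?_⟩
        have : T z (-x) = ι φ := by
          rw [map_neg]; exact neg_eq_of_add_eq_zero_right hx
        exact this
    refine ⟨F1, fun h => ?_, fun h => ?_, ?_⟩
    · have := hF0.1 h
      rw [this] at hF1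
      exact eq_top_of_bot_isCompl hF1
    · rw [hF0]
      rw [h] at hF1
      exact eq_bot_of_isCompl_top hF1
    · have hbij : Function.Bijective ((T z).coprod (ι.comp F1.subtypeL)) := by
        constructor
        · rw [injective_iff_map_eq_zero]
          rintro ⟨x, φ⟩ h
          have h' : T z x + ι φ = 0 := h
          have hφ : (φ : F) ∈ F0 := by
            refine ⟨-x, ?_⟩
            have : T z (-x) = ι φ := by
              rw [map_neg]; exact neg_eq_of_add_eq_zero_right h'
            exact this
          have : (φ : F) = 0 := by
            have := hF1.disjoint.le_bot (⟨hφ, φ.2⟩ : (φ : F) ∈ F0 ⊓ F1)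
            simpa using this
          have hφ0 : φ = 0 := Subtype.ext this
          rw [this] at h'
          rw [hφ0, hinj z hz x (by simpa using h')]
          rfl
        · intro y
          obtain ⟨x, φ, h⟩ := hs z hz y
          have : φ ∈ F0 ⊔ F1 := by rw [hF1.sup_eq_top]; trivial
          obtain ⟨a, ⟨x', hx'⟩, b, hb, hab⟩ := Submodule.mem_sup.1 this
          have hx'' : T z x' = ι a := hx'
          refine ⟨(x + x', ⟨b, hb⟩), ?_⟩
          have : T z (x + x') + ι b = y := by
            rw [map_add, hx'', ← h, ← hab, map_add]; abel
          simpa using this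
      have hcont : Continuous fun z' => (T z').coprod (ι.comp F1.subtypeL) := by
        have : (fun z' => (T z').coprod (ι.comp F1.subtypeL)) =
          fun z' => (T z').comp (ContinuousLinearMap.fst ℂ X F1) +
            (ι.comp F1.subtypeL).comp (ContinuousLinearMap.snd ℂ X F1) := by
          ext <;> simp
        rw [this]
        fun_prop
      let e := ContinuousLinearEquiv.ofBijective ((T z).coprod (ι.comp F1.subtypeL))
        (LinearMap.ker_eq_bot.2 hbij.1) (LinearMap.range_eq_top.2 hbij.2)
      have he : (e : (X × F1) →L[ℂ] Y) = (T z).coprod (ι.comp F1.subtypeL) :=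
        ContinuousLinearEquiv.coe_ofBijective _ _ _
      have hn := ContinuousLinearEquiv.nhds e
      rw [he] at hn
      filter_upwards [hcont.continuousAt.eventually hn] with z' hz'
      obtain ⟨e', he'⟩ := hz'
      rw [← he']
      exact e'.bijective
  let U : Set ℂ := {z | ∀ᶠ z' in 𝓝 z, z' ∈ G → ∀ x φ, T z' x + ι φ = 0 → φ = 0}
  let W : Set ℂ := {z | ∀ᶠ z' in 𝓝 z, z' ∈ G → ¬ ∀ x φ, T z' x + ι φ = 0 → φ = 0}
  have hU : IsOpen U := isOpen_iff_eventually.2 fun z hz => eventually_eventually_nhds.2 hz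
  have hW : IsOpen W := isOpen_iff_eventually.2 fun z hz => eventually_eventually_nhds.2 hz
  have hUW : ∀ z ∈ G, ((∀ x φ, T z x + ι φ = 0 → φ = 0) → z ∈ U) ∧
      ((¬ ∀ x φ, T z x + ι φ = 0 → φ = 0) → z ∈ W) := by
    intro z hz
    obtain ⟨F1, h1, h2, h3⟩ := key z hz
    constructor
    · intro h
      have ht := h1 h
      filter_upwards [h3] with z' hz' _ x φ hx
      have := (injective_iff_map_eq_zero _).1 hz'.1 (x, ⟨φ, by rw [ht]; trivial⟩) (by simpa using hx)
      have := congrArg (fun q : X × F1 => (q.2 : F)) this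
      simpa using this
    · intro h
      have ht : F1 ≠ ⊤ := fun h' => h (h2 h')
      filter_upwards [h3] with z' hz' _ hcon
      obtain ⟨φ, -, hφ⟩ := SetLike.exists_of_lt (lt_top_iff_ne_top.2 ht)
      obtain ⟨⟨x, φ1⟩, hx⟩ := hz'.2 (ι φ)
      have hx' : T z' x + ι φ1 = ι φ := by simpa using hx
      have := hcon x (φ1 - φ) (by rw [map_sub, ← hx']; abel)
      apply hφ
      rw [← sub_eq_zero.1 this]
      exact φ1.2
  by_contra hne
  push Not at hne
  obtain ⟨z, hz, x, φ, hx, hφ⟩ := hne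
  have hzW : z ∈ W := (hUW z hz).2 fun h => hφ (h x φ hx)
  have hzU : z0 ∈ U := (hUW z0 hz0).1 h0
  obtain ⟨z1, hz1, hz1U, hz1W⟩ := hG U W hU hW (fun z' hz' => by
    by_cases h : ∀ x φ, T z' x + ι φ = 0 → φ = 0
    · exact Or.inl ((hUW z' hz').1 h)
    · exact Or.inr ((hUW z' hz').2 h)) ⟨z0, hz0, hzU⟩ ⟨z, hz, hzW⟩
  exact (hz1W.self_of_nhds hz1) (hz1U.self_of_nhds hz1)

section Estimates

variable {V : Type*} [NormedAddCommGroup V] [NormedSpace ℂ V]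

theorem sing_ball_base (p : ℂ) (r : ℝ) (hr : 0 < r) (q : ℂ → ℂ) (C : ℂ → V →L[ℂ] V)
    (c0 a m : ℝ) (hm : a < m * c0) (hm0 : 0 ≤ m)
    (hq : ∀ x ∈ Metric.closedBall p r, c0 ≤ ‖q x‖)
    (hC : ∀ x ∈ Metric.closedBall p r, ‖C x‖ ≤ a) (k : ℂ → V) (hk : Differentiable ℂ k) (M : ℝ)
    (hM : ∀ x ∈ Metric.closedBall p r,
      ‖((x - p) * q x) • deriv k x + (C x (k x) + ((m : ℂ) * q x) • k x)‖ ≤ M) :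
    ∀ x ∈ Metric.closedBall p r, ‖k x‖ ≤ (m * c0 - a)⁻¹ * M := by
  obtain ⟨x0, hx0, hmax⟩ := (isCompact_closedBall p r).exists_isMaxOn
    ⟨p, Metric.mem_closedBall_self hr.le⟩ (f := fun x => ‖k x‖) hk.continuous.norm.continuousOn
  suffices hs : m * ‖q x0‖ * ‖k x0‖ ≤ a * ‖k x0‖ + M by
    have h1 : (m * c0 - a) * ‖k x0‖ ≤ M := by
      have : m * c0 * ‖k x0‖ ≤ m * ‖q x0‖ * ‖k x0‖ := by gcongr; exact hq x0 hx0
      linarith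
    intro x hx
    refine (hmax hx : ‖k x‖ ≤ ‖k x0‖).trans ?_
    rw [inv_mul_eq_div, le_div_iff₀ (by linarith)]
    linarith
  set w : V := -((x0 - p) • deriv k x0) with hw
  have hder : HasDerivAt (fun e : ℝ => k (x0 - (e : ℂ) * (x0 - p))) w 0 := by
    have h1 : HasDerivAt (fun e : ℝ => x0 - (e : ℂ) * (x0 - p)) (-(x0 - p)) (0 : ℝ) := by
      simpa using (((hasDerivAt_id (0 : ℝ)).ofReal_comp).mul_const (x0 - p)).const_sub x0
    have h2 : HasDerivAt k (deriv k x0) (x0 - ((0 : ℝ) : ℂ) * (x0 - p)) := by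
      simpa using (hk x0).hasDerivAt
    have h3 := HasDerivAt.scomp (0 : ℝ) h2 h1
    rw [hw, ← neg_smul]
    exact h3
  apply le_of_forall_pos_le_add
  intro η hη
  have hlit := (hasDerivAt_iff_isLittleO.1 hder)
  obtain ⟨η', hη', hη'2⟩ : ∃ η' > 0, ‖q x0‖ * η' ≤ η := by
    refine ⟨η / (‖q x0‖ + 1), by positivity, ?_⟩
    rw [← mul_div_assoc, div_le_iff₀ (by positivity)]
    nlinarith [norm_nonneg (q x0)]
  have hev := hlit.def hη'
  have hev2 : ∀ᶠ e : ℝ in 𝓝[>] (0 : ℝ), ‖k (x0 - (e : ℂ) * (x0 - p)) - k x0 - e • w‖ ≤ η' * e ∧ 0 < e ∧ e < 1 := by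
    have h3 : ∀ᶠ e in 𝓝[>] (0 : ℝ), e ∈ Ioo (0 : ℝ) 1 := Ioo_mem_nhdsGT one_pos
    filter_upwards [hev.filter_mono nhdsWithin_le_nhds, h3] with e he h3
    refine ⟨?_, h3⟩
    simpa [abs_of_pos h3.1] using he
  obtain ⟨e, he, he0, he1⟩ := hev2.exists
  have hin : x0 - (e : ℂ) * (x0 - p) ∈ Metric.closedBall p r := by
    rw [Metric.mem_closedBall, dist_eq_norm] at hx0 ⊢
    have : x0 - (e : ℂ) * (x0 - p) - p = ((1 - e : ℝ) : ℂ) * (x0 - p) := by push_cast; ring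
    rw [this, norm_mul, Complex.norm_real, Real.norm_eq_abs, abs_of_pos (by linarith)]
    nlinarith [norm_nonneg (x0 - p)]
  have hle := hmax hin
  have hle : ‖k (x0 - (e : ℂ) * (x0 - p))‖ ≤ ‖k x0‖ := hle
  have h1 : ‖k x0 + e • w‖ ≤ ‖k x0‖ + η' * e := by
    calc ‖k x0 + e • w‖ = ‖k (x0 - (e : ℂ) * (x0 - p)) - (k (x0 - (e : ℂ) * (x0 - p)) - k x0 - e • w)‖ := by
          congr 1; abel
      _ ≤ _ := norm_sub_le _ _
      _ ≤ _ := add_le_add hle he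
  set g := ((x0 - p) * q x0) • deriv k x0 + (C x0 (k x0) + ((m : ℂ) * q x0) • k x0) with hg
  have h2 : q x0 • (k x0 + e • w) = ((1 + e * m : ℝ) : ℂ) • q x0 • k x0 + (e : ℂ) • (C x0 (k x0) - g) := by
    rw [hg, hw, ← Complex.coe_smul e]
    module
  have h3 : ‖((1 + e * m : ℝ) : ℂ) • q x0 • k x0‖ = (1 + e * m) * (‖q x0‖ * ‖k x0‖) := by
    rw [norm_smul, norm_smul, Complex.norm_real, Real.norm_eq_abs, abs_of_nonneg (by positivity)]
  have h4 : ‖(e : ℂ) • (C x0 (k x0) - g)‖ ≤ e * (a * ‖k x0‖ + M) := by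
    rw [norm_smul, Complex.norm_real, Real.norm_eq_abs, abs_of_pos he0]
    gcongr
    refine (norm_sub_le _ _).trans (add_le_add ?_ (hM x0 hx0))
    exact ((C x0).le_opNorm _).trans (by gcongr; exact hC x0 hx0)
  have h5 : (1 + e * m) * (‖q x0‖ * ‖k x0‖) ≤ ‖q x0‖ * (‖k x0‖ + η' * e) + e * (a * ‖k x0‖ + M) := by
    rw [← h3]
    calc _ = ‖q x0 • (k x0 + e • w) - (e : ℂ) • (C x0 (k x0) - g)‖ := by rw [h2]; congr 1; abel
      _ ≤ _ := norm_sub_le _ _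
      _ ≤ _ := add_le_add (by rw [norm_smul]; gcongr) h4
  have h6 : e * (m * ‖q x0‖ * ‖k x0‖) ≤ e * (a * ‖k x0‖ + M + η) := by
    nlinarith [mul_le_mul_of_nonneg_left hη'2 he0.le]
  exact le_of_mul_le_mul_left h6 he0

theorem sing_ball_step [CompleteSpace V] (p : ℂ) (r : ℝ) (hr : 0 < r) (q : ℂ → ℂ) (C : ℂ → V →L[ℂ] V)
    (hq : Differentiable ℂ q) (hC : Differentiable ℂ C) (c1 : ℝ) (hc1 : 0 ≤ c1)
    (hCp : ∀ v, ‖v‖ ≤ c1 * ‖C p v‖)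
    (hest : ∃ c : ℝ, 0 ≤ c ∧ ∀ k : ℂ → V, Differentiable ℂ k → ∀ M : ℝ,
      (∀ x ∈ Metric.closedBall p r, ‖((x - p) * q x) • deriv k x + (C x (k x) + q x • k x)‖ ≤ M) →
      ∀ x ∈ Metric.closedBall p r, ‖k x‖ ≤ c * M) :
    ∃ c : ℝ, 0 ≤ c ∧ ∀ k : ℂ → V, Differentiable ℂ k → ∀ M : ℝ,
      (∀ x ∈ Metric.closedBall p r, ‖((x - p) * q x) • deriv k x + C x (k x)‖ ≤ M) →
      ∀ x ∈ Metric.closedBall p r, ‖k x‖ ≤ c * M := by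
  obtain ⟨c, hc, hest⟩ := hest
  obtain ⟨a, ha⟩ := (isCompact_closedBall p r).exists_bound_of_continuousOn hC.continuous.continuousOn
  have ha0 : 0 ≤ a := (norm_nonneg _).trans (ha p (Metric.mem_closedBall_self hr.le))
  refine ⟨c1 + r * (c * ((1 + a * c1) / r)), by positivity, ?_⟩
  intro h hh M hM
  have hpb : p ∈ Metric.closedBall p r := Metric.mem_closedBall_self hr.le
  have hM0 : 0 ≤ M := (norm_nonneg _).trans (hM p hpb)
  set k := dslope h p with hk
  have hkd : Differentiable ℂ k := by
    rw [← differentiableOn_univ] at hh ⊢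
    exact (Complex.differentiableOn_dslope univ_mem).2 hh
  have hhk : ∀ x, h x = h p + (x - p) • k x := fun x => by
    rw [hk, sub_smul_dslope]; abel
  have hderiv : ∀ x, deriv h x = k x + (x - p) • deriv k x := by
    intro x
    have h1 : HasDerivAt (fun x => h p + (x - p) • k x) ((x - p) • deriv k x + (1 : ℂ) • k x) x :=
      (((hasDerivAt_id x).sub_const p).smul (hkd x).hasDerivAt).const_add (h p)
    have h2 : h = fun x => h p + (x - p) • k x := funext hhk
    rw [h2, h1.deriv, one_smul, add_comm]
  set F : ℂ → V := fun x => ((x - p) * q x) • deriv k x + (C x (k x) + q x • k x) with hF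
  have hFT : ∀ x, (x - p) • F x = ((x - p) * q x) • deriv h x + C x (h x) - C x (h p) := by
    intro x
    rw [hderiv, hhk x, map_add, map_smul, hF]
    module
  have hFd : Differentiable ℂ F := by
    have hdk : Differentiable ℂ (deriv k) := by
      intro x
      exact (hkd.analyticAt x).deriv.differentiableAt
    have : Differentiable ℂ fun x => C x (k x) := hC.clm_apply hkd
    fun_prop
  have hhp : ‖h p‖ ≤ c1 * M := by
    refine (hCp _).trans ?_
    gcongr
    simpa using hM p hpb
  have hbd : ∀ x ∈ Metric.closedBall p r, ‖F x‖ ≤ (1 + a * c1) / r * M := by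
    intro x hx
    rw [← closure_ball p hr.ne'] at hx
    refine Complex.norm_le_of_forall_mem_frontier_norm_le Metric.isBounded_ball
      hFd.diffContOnCl ?_ hx
    intro y hy
    rw [frontier_ball p hr.ne', mem_sphere_iff_norm] at hy
    have hyb : y ∈ Metric.closedBall p r := by
      rw [Metric.mem_closedBall, dist_eq_norm, hy]
    have h1 : r * ‖F y‖ ≤ M + a * (c1 * M) := by
      rw [← hy, ← norm_smul, hFT]
      refine (norm_sub_le _ _).trans (add_le_add (hM y hyb) ?_)
      exact ((C y).le_opNorm _).trans (mul_le_mul (ha y hyb) hhp (norm_nonneg _) ha0)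
    rw [div_mul_eq_mul_div, le_div_iff₀ hr]
    linarith
  intro x hx
  have hkx := hest k hkd _ hbd x hx
  rw [hhk x]
  have hxr : ‖x - p‖ ≤ r := by rwa [Metric.mem_closedBall, dist_eq_norm] at hx
  calc ‖h p + (x - p) • k x‖ ≤ ‖h p‖ + ‖x - p‖ * ‖k x‖ := (norm_add_le _ _).trans_eq (by rw [norm_smul])
    _ ≤ c1 * M + r * (c * ((1 + a * c1) / r * M)) := by gcongr
    _ = _ := by ring

/-- A priori estimate on a ball around a Fuchsian singularity. -/
theorem sing_ball [CompleteSpace V] (p : ℂ) (r : ℝ) (hr : 0 < r) (q : ℂ → ℂ) (C : ℂ → V →L[ℂ] V)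
    (hq : Differentiable ℂ q) (hC : Differentiable ℂ C)
    (hq0 : ∀ x ∈ Metric.closedBall p r, q x ≠ 0)
    (hCp : ∀ m : ℕ, ∃ c1 : ℝ, 0 ≤ c1 ∧ ∀ v, ‖v‖ ≤ c1 * ‖C p v + ((m : ℂ) * q p) • v‖) :
    ∃ c : ℝ, 0 ≤ c ∧ ∀ k : ℂ → V, Differentiable ℂ k → ∀ M : ℝ,
      (∀ x ∈ Metric.closedBall p r, ‖((x - p) * q x) • deriv k x + C x (k x)‖ ≤ M) →
      ∀ x ∈ Metric.closedBall p r, ‖k x‖ ≤ c * M := by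
  obtain ⟨a, ha⟩ := (isCompact_closedBall p r).exists_bound_of_continuousOn hC.continuous.continuousOn
  obtain ⟨x1, hx1, hmin⟩ := (isCompact_closedBall p r).exists_isMinOn
    ⟨p, Metric.mem_closedBall_self hr.le⟩ (f := fun x => ‖q x‖) hq.continuous.norm.continuousOn
  have hc0 : 0 < ‖q x1‖ := norm_pos_iff.2 (hq0 x1 hx1)
  obtain ⟨m, hm⟩ := exists_nat_gt (a / ‖q x1‖)
  rw [div_lt_iff₀ hc0] at hm
  have main : ∀ n : ℕ, n ≤ m → ∃ c : ℝ, 0 ≤ c ∧ ∀ k : ℂ → V, Differentiable ℂ k → ∀ M : ℝ,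
      (∀ x ∈ Metric.closedBall p r,
        ‖((x - p) * q x) • deriv k x + (C x (k x) + (((m - n : ℕ) : ℂ) * q x) • k x)‖ ≤ M) →
      ∀ x ∈ Metric.closedBall p r, ‖k x‖ ≤ c * M := by
    intro n
    induction n with
    | zero =>
      intro _
      refine ⟨(m * ‖q x1‖ - a)⁻¹, by rw [inv_nonneg]; linarith, fun k hk M hM => ?_⟩
      exact sing_ball_base p r hr q C ‖q x1‖ a m hm (by positivity) (fun x hx => hmin hx) ha k hk M
        (by simpa using hM)
    | succ n ih =>
      intro hn
      obtain ⟨c, hc, hest⟩ := ih (by omega)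
      obtain ⟨c1, hc1, hc1'⟩ := hCp (m - (n + 1))
      have := sing_ball_step p r hr q
        (fun x => C x + (((m - (n + 1) : ℕ) : ℂ) * q x) • ContinuousLinearMap.id ℂ V) hq
        (by
          refine hC.add ?_
          exact ((hq.const_mul _).smul_const _)) c1 hc1 (by simpa using hc1')
        ⟨c, hc, fun k hk M hM => hest k hk M (fun x hx => by
          have h := hM x hx
          have e : ((m - n : ℕ) : ℂ) = ((m - (n + 1) : ℕ) : ℂ) + 1 := by
            have : m - n = m - (n + 1) + 1 := by omega
            rw [this]; push_cast; ring
          rw [e]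
          refine le_of_eq_of_le (congrArg _ ?_) h
          simp
          module)⟩
      simpa using this
  obtain ⟨c, hc, h⟩ := main m le_rfl
  exact ⟨c, hc, by simpa using h⟩

/-- A priori estimate on a ball without singularities. -/
theorem reg_ball (x0 : ℂ) (r : ℝ) (Q : ℂ → ℂ) (C : ℂ → V →L[ℂ] V)
    (hQ : Continuous Q) (hC : Continuous C) (hQ0 : ∀ x ∈ Metric.closedBall x0 r, Q x ≠ 0)
    (y : ℂ) (hy : y ∈ Metric.closedBall x0 r) :
    ∃ c : ℝ, 0 ≤ c ∧ ∀ k : ℂ → V, Differentiable ℂ k → ∀ M : ℝ, ‖k y‖ ≤ M →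
      (∀ x ∈ Metric.closedBall x0 r, ‖Q x • deriv k x + C x (k x)‖ ≤ M) →
      ∀ x ∈ Metric.closedBall x0 r, ‖k x‖ ≤ c * M := by
  obtain ⟨a, ha⟩ := (isCompact_closedBall x0 r).exists_bound_of_continuousOn hC.continuousOn
  have ha0 : 0 ≤ a := (norm_nonneg _).trans (ha y hy)
  obtain ⟨x1, hx1, hmin⟩ := (isCompact_closedBall x0 r).exists_isMinOn
    ⟨y, hy⟩ (f := fun x => ‖Q x‖) hQ.norm.continuousOn
  have hc0 : 0 < ‖Q x1‖ := norm_pos_iff.2 (hQ0 x1 hx1)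
  set c0 := ‖Q x1‖ with hc0'
  have hr0 : 0 ≤ r := (dist_nonneg).trans hy
  set L : ℝ := 2 * r + 1 with hL
  set K : ℝ := L * a / c0 + 1 with hK
  have hKpos : 0 < K := by positivity
  refine ⟨gronwallBound 1 K (L / c0) 1, ?_, ?_⟩
  · rw [gronwallBound_of_K_ne_0 hKpos.ne']
    have : 1 ≤ Real.exp (K * 1) := Real.one_le_exp (by positivity)
    have : 0 ≤ Real.exp (K * 1) - 1 := by linarith
    positivity
  intro k hk M hyM hM x hx
  have hM0 : 0 ≤ M := (norm_nonneg _).trans hyM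
  let γ : ℝ → ℂ := fun t => y + (t : ℂ) * (x - y)
  have hγ : ∀ t ∈ Icc (0 : ℝ) 1, γ t ∈ Metric.closedBall x0 r := by
    intro t ht
    have := (convex_closedBall x0 r).add_smul_sub_mem hy hx ht
    simpa [γ] using this
  have hγd : ∀ t : ℝ, HasDerivAt (fun t : ℝ => k (γ t)) ((x - y) • deriv k (γ t)) t := by
    intro t
    have h1 : HasDerivAt (fun e : ℝ => y + (e : ℂ) * (x - y)) (x - y) t := by
      simpa using (((hasDerivAt_id t).ofReal_comp).mul_const (x - y)).const_add y
    exact HasDerivAt.scomp t ((hk (y + (t : ℂ) * (x - y))).hasDerivAt) h1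
  have hbound : ∀ t ∈ Ico (0 : ℝ) 1, ‖(x - y) • deriv k (γ t)‖ ≤ K * ‖k (γ t)‖ + L / c0 * M := by
    intro t ht
    have hin := hγ t ⟨ht.1, ht.2.le⟩
    have h1 : ‖Q (γ t)‖ * ‖deriv k (γ t)‖ ≤ M + a * ‖k (γ t)‖ := by
      rw [← norm_smul]
      calc ‖Q (γ t) • deriv k (γ t)‖ = ‖(Q (γ t) • deriv k (γ t) + C (γ t) (k (γ t))) - C (γ t) (k (γ t))‖ := by
            congr 1; abel
        _ ≤ _ := norm_sub_le _ _
        _ ≤ _ := add_le_add (hM _ hin) (((C (γ t)).le_opNorm _).trans (by gcongr; exact ha _ hin))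
    have h2 : c0 * ‖deriv k (γ t)‖ ≤ M + a * ‖k (γ t)‖ := by
      refine le_trans ?_ h1
      gcongr
      exact hmin hin
    have h3 : ‖x - y‖ ≤ L := by
      rw [← dist_eq_norm]
      have := dist_triangle_right x y x0
      have h4 : dist x x0 ≤ r := hx
      have h5 : dist y x0 ≤ r := hy
      linarith
    rw [norm_smul]
    have h4 : ‖deriv k (γ t)‖ ≤ (M + a * ‖k (γ t)‖) / c0 := by
      rw [le_div_iff₀ hc0]; linarith
    calc ‖x - y‖ * ‖deriv k (γ t)‖ ≤ L * ((M + a * ‖k (γ t)‖) / c0) := by gcongr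
      _ = (L * a / c0) * ‖k (γ t)‖ + L / c0 * M := by field_simp; ring
      _ ≤ _ := by
        have := norm_nonneg (k (γ t))
        rw [hK]; linarith
  have hg := norm_le_gronwallBound_of_norm_deriv_right_le (f := fun t => k (γ t))
    (f' := fun t => (x - y) • deriv k (γ t)) (δ := M) (K := K) (ε := L / c0 * M) (a := 0) (b := 1)
    (fun t _ => (hγd t).continuousAt.continuousWithinAt)
    (fun t _ => (hγd t).hasDerivWithinAt) (by simpa [γ] using hyM) hbound 1 (by simp)
  have e1 : γ 1 = x := by simp [γ]
  rw [e1] at hg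
  refine hg.trans_eq ?_
  rw [gronwallBound_of_K_ne_0 hKpos.ne', gronwallBound_of_K_ne_0 hKpos.ne']
  simp
  ring

end Estimates

/-- Exhaustion by chains of balls. -/
theorem exists_compact_of_chain (D : Set ℂ) (hDc : IsPreconnected D)
    (p0 : ℂ) (hp0 : p0 ∈ D) (Pr : Set ℂ → Prop)
    (hunion : ∀ K K', Pr K → Pr K' → Pr (K ∪ K'))
    (hloc : ∀ x ∈ D, ∃ r > 0, ∀ K, Pr K → (K ∩ Metric.closedBall x r).Nonempty →
      Pr (K ∪ Metric.closedBall x r))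
    (h0 : ∃ K0, p0 ∈ K0 ∧ Pr K0) :
    ∀ K, IsCompact K → K ⊆ D → ∃ K', K ⊆ K' ∧ Pr K' := by
  choose! r hr hloc using hloc
  let U : Set ℂ := ⋃ x ∈ {x ∈ D | ∃ K, Pr K ∧ x ∈ K}, Metric.ball x (r x)
  let W : Set ℂ := ⋃ x ∈ {x ∈ D | ¬ ∃ K, Pr K ∧ x ∈ K}, Metric.ball x (r x)
  have hall : ∀ x ∈ D, ∃ K, Pr K ∧ x ∈ K := by
    by_contra hne
    push Not at hne
    obtain ⟨x1, hx1, hx1'⟩ := hne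
    have hU : IsOpen U := isOpen_biUnion fun x _ => Metric.isOpen_ball
    have hW : IsOpen W := isOpen_biUnion fun x _ => Metric.isOpen_ball
    obtain ⟨K0, hpK0, hK0⟩ := h0
    obtain ⟨y, hyD, hyU, hyW⟩ := hDc U W hU hW (fun x hx => by
      by_cases h : ∃ K, Pr K ∧ x ∈ K
      · exact Or.inl (mem_biUnion (show x ∈ {x ∈ D | ∃ K, Pr K ∧ x ∈ K} from ⟨hx, h⟩)
          (Metric.mem_ball_self (hr x hx)))
      · exact Or.inr (mem_biUnion (show x ∈ {x ∈ D | ¬ ∃ K, Pr K ∧ x ∈ K} from ⟨hx, h⟩)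
          (Metric.mem_ball_self (hr x hx))))
      ⟨p0, hp0, mem_biUnion (show p0 ∈ {x ∈ D | ∃ K, Pr K ∧ x ∈ K} from ⟨hp0, K0, hK0, hpK0⟩)
          (Metric.mem_ball_self (hr p0 hp0))⟩
      ⟨x1, hx1, mem_biUnion (show x1 ∈ {x ∈ D | ¬ ∃ K, Pr K ∧ x ∈ K} from
          ⟨hx1, fun ⟨K, hK, hxK⟩ => hx1' K hK hxK⟩) (Metric.mem_ball_self (hr x1 hx1))⟩
    simp only [U, W, mem_iUnion, exists_prop] at hyU hyW
    obtain ⟨x, ⟨hxD, K, hK, hxK⟩, hyx⟩ := hyU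
    obtain ⟨x', ⟨hxD', hn⟩, hyx'⟩ := hyW
    have h1 := hloc x hxD K hK ⟨x, hxK, Metric.mem_closedBall_self (hr x hxD).le⟩
    have h2 := hloc x' hxD' _ h1 ⟨y, Or.inr (Metric.ball_subset_closedBall hyx),
      Metric.ball_subset_closedBall hyx'⟩
    exact hn ⟨_, h2, Or.inr (Metric.mem_closedBall_self (hr x' hxD').le)⟩
  intro K hK hKD
  obtain ⟨K0, hpK0, hK0⟩ := h0
  refine hK.induction_on (p := fun K => ∃ K', K ⊆ K' ∧ Pr K') ⟨K0, by simp, hK0⟩ ?_ ?_ ?_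
  · rintro s t hst ⟨K', h1, h2⟩
    exact ⟨K', hst.trans h1, h2⟩
  · rintro s t ⟨K1, h1, h2⟩ ⟨K2, h3, h4⟩
    exact ⟨K1 ∪ K2, union_subset_union h1 h3, hunion _ _ h2 h4⟩
  · intro x hx
    obtain ⟨K1, hK1, hxK1⟩ := hall x (hKD hx)
    refine ⟨Metric.ball x (r x), mem_nhdsWithin_of_mem_nhds (Metric.ball_mem_nhds x (hr x (hKD hx))), _,
      ?_, hloc x (hKD hx) K1 hK1 ⟨x, hxK1, Metric.mem_closedBall_self (hr x (hKD hx)).le⟩⟩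
    exact Metric.ball_subset_closedBall.trans subset_union_right

section Dbar
open MeasureTheory

/-- `∂₁ χ + c ∂₂ χ`; twice the Cauchy-Riemann operators for `c = ± I`. -/
noncomputable def crOp (c : ℂ) (χ : ℂ → ℂ) (z : ℂ) : ℂ :=
  fderiv ℝ χ z 1 + c * fderiv ℝ χ z Complex.I

theorem crOp_tsupport (c : ℂ) (χ : ℂ → ℂ) : tsupport (crOp c χ) ⊆ tsupport χ := by
  refine closure_minimal ?_ (isClosed_tsupport χ)
  intro z hz
  by_contra h
  apply hz
  have : fderiv ℝ χ z = 0 := by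
    have := (notMem_tsupport_iff_eventuallyEq.1 h).fderiv_eq (𝕜 := ℝ)
    rw [this]; simp
  simp [crOp, this]

theorem crOp_eq_zero_of_eventually_const {c a : ℂ} {χ : ℂ → ℂ} {z : ℂ} (h : ∀ᶠ s in 𝓝 z, χ s = a) :
    crOp c χ z = 0 := by
  have : fderiv ℝ χ z = 0 := by
    have h2 : χ =ᶠ[𝓝 z] fun _ => a := h
    rw [h2.fderiv_eq (𝕜 := ℝ)]; simp
  simp [crOp, this]

theorem crOp_contDiff (c : ℂ) {χ : ℂ → ℂ} (h : ContDiff ℝ (⊤ : ℕ∞) χ) :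
    ContDiff ℝ (⊤ : ℕ∞) (crOp c χ) := by
  have h1 : ContDiff ℝ (⊤ : ℕ∞) (fderiv ℝ χ) := h.fderiv_right (by simp)
  unfold crOp
  exact (h1.clm_apply contDiff_const).add (contDiff_const.mul (h1.clm_apply contDiff_const))

theorem integrable_mul_of_tsupport {U : Set ℂ} (hU : IsOpen U) {χ G : ℂ → ℂ} (hχ : Continuous χ)
    (hc : HasCompactSupport χ) (hs : tsupport χ ⊆ U) (hG : ContinuousOn G U) :
    Integrable (fun z => G z * χ z) := by
  refine Continuous.integrable_of_hasCompactSupport ?_ (hc.mul_left)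
  refine continuous_of_tsupport fun x hx => ?_
  have hx' : x ∈ tsupport χ := closure_mono (Function.support_mul_subset_right G χ) hx
  exact (hG.continuousAt (hU.mem_nhds (hs hx'))).mul hχ.continuousAt

theorem integral_fderiv_aux {U : Set ℂ} (hU : IsOpen U) {χ G : ℂ → ℂ} (hχ : ContDiff ℝ (⊤ : ℕ∞) χ)
    (hc : HasCompactSupport χ) (hs : tsupport χ ⊆ U) (hG : DifferentiableOn ℂ G U) (v : ℂ) :
    ∫ z, G z * fderiv ℝ χ z v = - (v * ∫ z, deriv G z * χ z) := by
  have hGf : ∀ z ∈ U, fderiv ℝ G z v = v * deriv G z := by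
    intro z hz
    have h1 : HasFDerivAt G (fderiv ℂ G z) z := (hG.differentiableAt (hU.mem_nhds hz)).hasFDerivAt
    have h2 := h1.restrictScalars ℝ
    rw [h2.fderiv, ContinuousLinearMap.coe_restrictScalars', fderiv_eq_smul_deriv, smul_eq_mul]
  have heq : ∀ z, fderiv ℝ G z v * χ z = v * (deriv G z * χ z) := by
    intro z
    by_cases hz : z ∈ U
    · rw [hGf z hz]; ring
    · rw [image_eq_zero_of_notMem_tsupport (fun h => hz (hs h))]; simp
  have hdG : ContinuousOn (deriv G) U := (hG.deriv hU).continuousOn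
  have i1 := integrable_mul_of_tsupport hU hχ.continuous hc hs hdG
  have hvc : HasCompactSupport (fun z => fderiv ℝ χ z v) := hc.fderiv_apply (𝕜 := ℝ) v
  have hvs : tsupport (fun z => fderiv ℝ χ z v) ⊆ U := (tsupport_fderiv_apply_subset ℝ v).trans hs
  have hvcont : Continuous (fun z => fderiv ℝ χ z v) :=
    (hχ.continuous_fderiv (by simp)).clm_apply continuous_const
  rw [integral_mul_fderiv_eq_neg_fderiv_mul_of_integrable]
  · simp_rw [heq]
    rw [integral_const_mul]
  · simp_rw [heq]; exact i1.const_mul v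
  · exact integrable_mul_of_tsupport hU hvcont hvc hvs hG.continuousOn
  · exact integrable_mul_of_tsupport hU hχ.continuous hc hs hG.continuousOn
  · intro x hx
    exact (hG.differentiableAt (hU.mem_nhds (hs hx))).restrictScalars ℝ
  · intro x _
    exact hχ.differentiable (by simp) x

theorem integral_crOp {U : Set ℂ} (hU : IsOpen U) {χ G : ℂ → ℂ} (hχ : ContDiff ℝ (⊤ : ℕ∞) χ)
    (hc : HasCompactSupport χ) (hs : tsupport χ ⊆ U) (hG : DifferentiableOn ℂ G U) (c : ℂ) :
    ∫ z, G z * crOp c χ z = - ((1 + c * Complex.I) * ∫ z, deriv G z * χ z) := by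
  have hi : ∀ v, Integrable (fun z => G z * fderiv ℝ χ z v) := fun v =>
    integrable_mul_of_tsupport hU ((hχ.continuous_fderiv (by simp)).clm_apply continuous_const)
      (hc.fderiv_apply (𝕜 := ℝ) v) ((tsupport_fderiv_apply_subset ℝ v).trans hs) hG.continuousOn
  have e : ∀ z, G z * crOp c χ z = G z * fderiv ℝ χ z 1 + c * (G z * fderiv ℝ χ z Complex.I) := by
    intro z; unfold crOp; ring
  simp_rw [e]
  rw [integral_add (hi 1) ((hi _).const_mul c), integral_const_mul, integral_fderiv_aux hU hχ hc hs hG,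
    integral_fderiv_aux hU hχ hc hs hG]
  ring

theorem crOp_comm {χ : ℂ → ℂ} (hχ : ContDiff ℝ (⊤ : ℕ∞) χ) (c c' : ℂ) (z : ℂ) :
    crOp c (crOp c' χ) z = crOp c' (crOp c χ) z := by
  have h1 : ContDiff ℝ (⊤ : ℕ∞) (fderiv ℝ χ) := hχ.fderiv_right (by simp)
  have hd : DifferentiableAt ℝ (fderiv ℝ χ) z := h1.differentiable (by simp) z
  have key : ∀ (c v : ℂ), fderiv ℝ (crOp c χ) z v =
      fderiv ℝ (fderiv ℝ χ) z v 1 + c * fderiv ℝ (fderiv ℝ χ) z v Complex.I := by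
    intro c v
    have a1 : HasFDerivAt (fun z => fderiv ℝ χ z 1) ((ContinuousLinearMap.apply ℝ ℂ (1:ℂ)).comp (fderiv ℝ (fderiv ℝ χ) z)) z :=
      (ContinuousLinearMap.apply ℝ ℂ (1:ℂ)).hasFDerivAt.comp z hd.hasFDerivAt
    have a2 : HasFDerivAt (fun z => fderiv ℝ χ z Complex.I) ((ContinuousLinearMap.apply ℝ ℂ Complex.I).comp (fderiv ℝ (fderiv ℝ χ) z)) z :=
      (ContinuousLinearMap.apply ℝ ℂ Complex.I).hasFDerivAt.comp z hd.hasFDerivAt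
    have a3 : HasFDerivAt (crOp c χ) _ z := a1.add (a2.const_mul c)
    rw [a3.fderiv]
    simp
  have hsym : IsSymmSndFDerivAt ℝ χ z := hχ.contDiffAt.isSymmSndFDerivAt (by
    simp only [minSmoothness_of_isRCLikeNormedField]; exact WithTop.coe_le_coe.2 le_top)
  rw [crOp, crOp, key, key, key, key, hsym.eq 1 Complex.I]
  ring

theorem crOp_sub {χ χ' : ℂ → ℂ} (hχ : ContDiff ℝ (⊤ : ℕ∞) χ) (hχ' : ContDiff ℝ (⊤ : ℕ∞) χ') (c z : ℂ) :
    crOp c (fun z => χ z - χ' z) z = crOp c χ z - crOp c χ' z := by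
  have : fderiv ℝ (fun z => χ z - χ' z) z = fderiv ℝ χ z - fderiv ℝ χ' z :=
    fderiv_fun_sub (hχ.differentiable (by simp) z) (hχ'.differentiable (by simp) z)
  simp [crOp, this]; ring

/-- Cutoff functions -/
theorem exists_cutoff {K U : Set ℂ} (hK : IsCompact K) (hU : IsOpen U) (hKU : K ⊆ U) :
    ∃ χ : ℂ → ℂ, ContDiff ℝ (⊤ : ℕ∞) χ ∧ HasCompactSupport χ ∧ tsupport χ ⊆ U ∧
      ∀ z ∈ K, ∀ᶠ s in 𝓝 z, χ s = 1 := by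
  obtain ⟨L, hL, hKL, hLU⟩ := exists_compact_between hK hU hKU
  obtain ⟨f, h1, h0, -⟩ := exists_contMDiffMap_one_nhds_of_subset_interior (n := (⊤ : ℕ∞))
    (modelWithCornersSelf ℝ ℂ) hK.isClosed hKL
  have hs : tsupport (fun z => (f z : ℂ)) ⊆ L := by
    refine closure_minimal ?_ hL.isClosed
    intro z hz
    by_contra hn
    exact hz (by simp [h0 z hn])
  refine ⟨fun z => (f z : ℂ), ?_, ?_, hs.trans hLU, ?_⟩
  · exact Complex.ofRealCLM.contDiff.comp f.contMDiff.contDiff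
  · exact HasCompactSupport.of_support_subset_isCompact hL ((subset_tsupport _).trans hs)
  · intro z hz
    have := (eventually_nhdsSet_iff_forall.1 h1) z hz
    filter_upwards [this] with s hs
    simp [hs]

theorem exists_kappa : ∃ κ : ℂ, κ ≠ 0 ∧ ∀ (χ : ℂ → ℂ) (z : ℂ), ContDiff ℝ (⊤ : ℕ∞) χ →
    HasCompactSupport χ → (∀ᶠ s in 𝓝 z, χ s = 1) →
    ∫ s, (s - z)⁻¹ * crOp Complex.I χ s = κ := by
  let ρ : ℝ → ℝ := fun t => Real.smoothTransition (2 - t)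
  have hρ : ContDiff ℝ (⊤ : ℕ∞) ρ := Real.smoothTransition.contDiff.comp (contDiff_const.sub contDiff_id)
  have hρa : Antitone ρ := fun a b hab => Real.smoothTransition.monotone (by linarith)
  let χ0 : ℂ → ℂ := fun s => (ρ (‖s‖ ^ 2) : ℂ)
  have hn : ContDiff ℝ (⊤ : ℕ∞) (fun s : ℂ => ‖s‖ ^ 2) := contDiff_norm_sq ℝ
  have hχ0 : ContDiff ℝ (⊤ : ℕ∞) χ0 := Complex.ofRealCLM.contDiff.comp (hρ.comp hn)
  have hρ1 : ∀ t ≤ 1, ρ t = 1 := fun t ht => Real.smoothTransition.one_of_one_le (by linarith)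
  have hρ2 : ∀ t, 2 ≤ t → ρ t = 0 := fun t ht => Real.smoothTransition.zero_of_nonpos (by linarith)
  have hout : ∀ s : ℂ, s ∉ Metric.closedBall (0 : ℂ) 2 → 4 ≤ ‖s‖ ^ 2 := by
    intro s hs
    have : 2 < ‖s‖ := by simpa using hs
    nlinarith
  have hc0 : HasCompactSupport χ0 := by
    refine HasCompactSupport.of_support_subset_isCompact (isCompact_closedBall (0 : ℂ) 2) ?_
    intro s hs
    by_contra h
    have := hout s h
    exact hs (by simp [χ0, hρ2 _ (by linarith : 2 ≤ ‖s‖ ^ 2)])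
  have h10 : ∀ᶠ s in 𝓝 (0 : ℂ), χ0 s = 1 := by
    filter_upwards [Metric.ball_mem_nhds (0 : ℂ) one_pos] with s hs
    have hs' : ‖s‖ < 1 := by simpa using hs
    have : ‖s‖ ^ 2 ≤ 1 := by nlinarith [norm_nonneg s]
    simp [χ0, hρ1 _ this]
  have hcr : ∀ s : ℂ, crOp Complex.I χ0 s = ((2 * deriv ρ (‖s‖ ^ 2) : ℝ) : ℂ) * s := by
    intro s
    have a1 : HasFDerivAt (fun s : ℂ => ‖s‖ ^ 2) (2 • (innerSL ℝ s)) s := (hasStrictFDerivAt_norm_sq s).hasFDerivAt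
    have a2 : HasDerivAt ρ (deriv ρ (‖s‖ ^ 2)) (‖s‖ ^ 2) := (hρ.differentiable (by simp) _).hasDerivAt
    have a3 := a2.comp_hasFDerivAt s a1
    have a4 : HasFDerivAt χ0 _ s := Complex.ofRealCLM.hasFDerivAt.comp s a3
    rw [crOp, a4.fderiv]
    have e : s = (s.re : ℂ) + s.im * Complex.I := (Complex.re_add_im s).symm
    simp [Complex.inner]
    linear_combination (-(2 * ((deriv ρ (‖s‖ ^ 2) : ℝ) : ℂ))) * e
  refine ⟨∫ s, s⁻¹ * crOp Complex.I χ0 s, ?_, ?_⟩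
  · have e : ∀ s : ℂ, s⁻¹ * crOp Complex.I χ0 s = ((2 * deriv ρ (‖s‖ ^ 2) : ℝ) : ℂ) := by
      intro s
      rw [hcr]
      by_cases hs : s = 0
      · subst hs
        have : deriv ρ 0 = 0 := by
          have : ρ =ᶠ[𝓝 0] fun _ => 1 := by
            filter_upwards [Iio_mem_nhds (show (0:ℝ) < 1 by norm_num)] with t ht
            exact hρ1 t (le_of_lt ht)
          rw [this.deriv_eq]; simp
        simp [this]
      · field_simp
    simp_rw [e]
    rw [integral_complex_ofReal]
    norm_cast
    have hpos : 0 < ∫ s : ℂ, -(2 * deriv ρ (‖s‖ ^ 2)) := by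
      obtain ⟨t, ht, ht'⟩ : ∃ t ∈ Ioo (1:ℝ) 2, deriv ρ t ≠ 0 := by
        obtain ⟨t, ht, h⟩ := exists_deriv_eq_slope ρ (show (1:ℝ) < 2 by norm_num) hρ.continuous.continuousOn
          (hρ.differentiable (by simp)).differentiableOn
        refine ⟨t, ht, ?_⟩
        rw [h, hρ1 1 le_rfl, hρ2 2 le_rfl]; norm_num
      have hneg : ∀ t, deriv ρ t ≤ 0 := fun t => hρa.deriv_nonpos
      refine Continuous.integral_pos_of_hasCompactSupport_nonneg_nonzero (x := ((Real.sqrt t : ℝ) : ℂ)) ?_ ?_ ?_ ?_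
      · exact ((hρ.continuous_deriv (by simp)).comp hn.continuous).const_mul 2 |>.neg
      · refine HasCompactSupport.of_support_subset_isCompact (isCompact_closedBall (0 : ℂ) 2) ?_
        intro s hs
        by_contra h
        have h4 := hout s h
        refine hs ?_
        have : deriv ρ (‖s‖ ^ 2) = 0 := by
          have : ρ =ᶠ[𝓝 (‖s‖ ^ 2)] fun _ => 0 := by
            filter_upwards [Ioi_mem_nhds (show (2:ℝ) < ‖s‖ ^ 2 by linarith)] with t ht
            exact hρ2 t (le_of_lt ht)
          rw [this.deriv_eq]; simp
        simp [this]
      · intro s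
        have := hneg (‖s‖ ^ 2)
        simp only [Pi.zero_apply]; linarith
      · have : ‖((Real.sqrt t : ℝ) : ℂ)‖ ^ 2 = t := by
          rw [Complex.norm_real, Real.norm_eq_abs, sq_abs, Real.sq_sqrt (by linarith [ht.1])]
        rw [this]
        simpa using ht'
    rw [integral_neg] at hpos
    intro h
    rw [h] at hpos
    simp at hpos
  · intro χ z hχ hc h1
    have e1 : ∫ s, s⁻¹ * crOp Complex.I χ0 s = ∫ s, (s - z)⁻¹ * crOp Complex.I χ0 (s - z) :=
      (integral_sub_right_eq_self (fun s => s⁻¹ * crOp Complex.I χ0 s) z).symm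
    have e2 : ∀ s, crOp Complex.I χ0 (s - z) = crOp Complex.I (fun s => χ0 (s - z)) s := by
      intro s
      simp [crOp, fderiv_comp_sub]
    simp_rw [e2] at e1
    rw [e1]
    have hχz : ContDiff ℝ (⊤ : ℕ∞) (fun s => χ0 (s - z)) := hχ0.comp (contDiff_id.sub contDiff_const)
    have hcz : HasCompactSupport (fun s => χ0 (s - z)) := hc0.comp_homeomorph (Homeomorph.subRight z)
    have h1z : ∀ᶠ s in 𝓝 z, χ0 (s - z) = 1 := by
      have : Tendsto (fun s => s - z) (𝓝 z) (𝓝 0) := by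
        have : ContinuousAt (fun s => s - z) z := by fun_prop
        simpa [ContinuousAt] using this
      exact this.eventually h10
    have hi : ∀ χ : ℂ → ℂ, ContDiff ℝ (⊤ : ℕ∞) χ → HasCompactSupport χ → (∀ᶠ s in 𝓝 z, χ s = 1) →
        Integrable (fun s => (s - z)⁻¹ * crOp Complex.I χ s) := by
      intro χ hχ hc h1
      refine integrable_mul_of_tsupport (U := {z}ᶜ) isOpen_compl_singleton (crOp_contDiff _ hχ).continuous
        (hc.mono' ((subset_tsupport _).trans (crOp_tsupport _ χ))) ?_ ?_
      · intro s hs hsz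
        rw [mem_singleton_iff] at hsz
        subst hsz
        refine (notMem_tsupport_iff_eventuallyEq.2 ?_) hs
        filter_upwards [eventually_eventually_nhds.2 h1] with t ht
        exact crOp_eq_zero_of_eventually_const ht
      · exact ContinuousOn.inv₀ (by fun_prop) (fun s hs => sub_ne_zero.2 hs)
    rw [← sub_eq_zero, ← integral_sub (hi χ hχ hc h1) (hi _ hχz hcz h1z)]
    simp_rw [← mul_sub, ← crOp_sub hχ hχz]
    rw [integral_crOp (U := {z}ᶜ) isOpen_compl_singleton (hχ.sub hχz)]
    · simp
    · exact hc.sub hcz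
    · intro s hs hsz
      rw [mem_singleton_iff] at hsz
      subst hsz
      refine (notMem_tsupport_iff_eventuallyEq.2 ?_) hs
      filter_upwards [h1, h1z] with t h1 h2
      simp [h1, h2]
    · refine DifferentiableOn.inv (by fun_prop) (fun s hs => sub_ne_zero.2 hs)

/-- Cauchy-Pompeiu type formula -/
theorem cauchy_pompeiu {κ : ℂ} (hκ : ∀ (χ : ℂ → ℂ) (z : ℂ), ContDiff ℝ (⊤ : ℕ∞) χ →
    HasCompactSupport χ → (∀ᶠ s in 𝓝 z, χ s = 1) →
    ∫ s, (s - z)⁻¹ * crOp Complex.I χ s = κ) {U : Set ℂ} (hU : IsOpen U) {χ g : ℂ → ℂ}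
    (hχ : ContDiff ℝ (⊤ : ℕ∞) χ)
    (hc : HasCompactSupport χ) (hs : tsupport χ ⊆ U) (hg : DifferentiableOn ℂ g U) (z : ℂ) (hz : z ∈ U)
    (h1 : ∀ᶠ s in 𝓝 z, χ s = 1) :
    ∫ s, (s - z)⁻¹ * g s * crOp Complex.I χ s = κ * g z := by
  have hd : DifferentiableOn ℂ (dslope g z) U := (Complex.differentiableOn_dslope (hU.mem_nhds hz)).2 hg
  have e : ∀ s, (s - z)⁻¹ * g s * crOp Complex.I χ s =
      dslope g z s * crOp Complex.I χ s + g z * ((s - z)⁻¹ * crOp Complex.I χ s) := by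
    intro s
    by_cases hsz : s = z
    · subst hsz
      rw [crOp_eq_zero_of_eventually_const h1]; simp
    · rw [dslope_of_ne _ hsz, slope_def_field]
      have : s - z ≠ 0 := sub_ne_zero.2 hsz
      field_simp
      ring
  have hcc : HasCompactSupport (crOp Complex.I χ) := hc.mono' ((subset_tsupport _).trans (crOp_tsupport _ χ))
  simp_rw [e]
  rw [integral_add, integral_crOp hU hχ hc hs hd, integral_const_mul, hκ χ z hχ hc h1]
  · simp [mul_comm]
  · exact integrable_mul_of_tsupport hU (crOp_contDiff _ hχ).continuous hcc ((crOp_tsupport _ χ).trans hs) hd.continuousOn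
  · refine Integrable.const_mul ?_ _
    refine integrable_mul_of_tsupport (U := {z}ᶜ) isOpen_compl_singleton (crOp_contDiff _ hχ).continuous
      hcc ?_ ?_
    · intro s hs hsz
      rw [mem_singleton_iff] at hsz
      subst hsz
      refine (notMem_tsupport_iff_eventuallyEq.2 ?_) hs
      filter_upwards [eventually_eventually_nhds.2 h1] with t ht
      exact crOp_eq_zero_of_eventually_const ht
    · exact ContinuousOn.inv₀ (by fun_prop) (fun s hs => sub_ne_zero.2 hs)

end Dbar

section Runge
open MeasureTheory

/-- A holomorphic logarithm of `z - a`. -/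
theorem exists_log (D : Set ℂ) (hD : IsOpen D) (hDsc : SimplyConnectedSpace D) (a : ℂ) (ha : a ∉ D) :
    ∃ L : ℂ → ℂ, DifferentiableOn ℂ L D ∧ ∀ z ∈ D, deriv L z = (z - a)⁻¹ := by
  obtain ⟨L, hLc, hL⟩ := Complex.exists_continuousOn_eqOn_exp_comp (U := D) hDsc hD
    (g := fun z => z - a) (by fun_prop) (by
      rintro ⟨z, hz, h⟩
      exact ha (by rwa [← sub_eq_zero.1 h]))
  have key : ∀ z ∈ D, HasDerivAt L (z - a)⁻¹ z := by
    intro z hz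
    have e : Complex.exp (L z) = z - a := hL hz
    have h1 : HasStrictDerivAt Complex.exp (z - a) (L z) := by
      rw [← e]; exact Complex.hasStrictDerivAt_exp _
    have h2 : HasDerivAt (fun w => L (w + a)) (z - a)⁻¹ (z - a) := by
      refine HasDerivAt.of_local_left_inverse (f := Complex.exp) ?_ (by simpa using h1.hasDerivAt) ?_ ?_
      · have : ContinuousAt L z := hLc.continuousAt (hD.mem_nhds hz)
        refine ContinuousAt.comp (g := L) (f := fun w => w + a) (by simpa using this) (by fun_prop)
      · exact sub_ne_zero.2 (fun h => ha (h ▸ hz))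
      · have : Tendsto (fun w => w + a) (𝓝 (z - a)) (𝓝 z) := by
          have : ContinuousAt (fun w : ℂ => w + a) (z - a) := by fun_prop
          simpa [ContinuousAt] using this
        filter_upwards [this.eventually (hD.mem_nhds hz)] with w hw
        have := hL hw
        simpa using this
    have h3 := HasDerivAt.comp z (h := fun z => z - a) h2 ((hasDerivAt_id z).sub_const a)
    simpa [Function.comp_def] using h3
  exact ⟨L, fun z hz => (key z hz).differentiableAt.differentiableWithinAt, fun z hz => (key z hz).deriv⟩

theorem no_hole (D : Set ℂ) (hD : IsOpen D) (hDsc : SimplyConnectedSpace D) (Y : Set ℂ)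
    (hc : IsCompact Y) (hf : frontier Y ⊆ D) : Y ⊆ D := by
  by_contra hn
  obtain ⟨a, haY, haD⟩ := Set.not_subset.1 hn
  have hE : IsCompact (Y \ D) := hc.diff hD
  have hEi : Y \ D ⊆ interior Y := by
    rintro z ⟨hz, hzD⟩
    by_contra h
    exact hzD (hf ⟨subset_closure hz, h⟩)
  obtain ⟨χ, hχ, hχc, hχs, h1⟩ := exists_cutoff hE isOpen_interior hEi
  obtain ⟨κ, hκ, hκ'⟩ := exists_kappa
  have h2 := hκ' χ a hχ hχc (h1 a ⟨haY, haD⟩)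
  obtain ⟨L, hL, hL'⟩ := exists_log D hD hDsc a haD
  have hsub : ∀ c, tsupport (crOp c χ) ⊆ D := by
    intro c z hz
    by_contra hzD
    have h3 : z ∈ Y := interior_subset (hχs (crOp_tsupport c χ hz))
    refine (notMem_tsupport_iff_eventuallyEq.2 ?_) hz
    filter_upwards [eventually_eventually_nhds.2 (h1 z ⟨h3, hzD⟩)] with t ht
    exact crOp_eq_zero_of_eventually_const ht
  have hcc : ∀ c, HasCompactSupport (crOp c χ) := fun c =>
    hχc.mono' ((subset_tsupport _).trans (crOp_tsupport _ χ))
  have i1 := integral_crOp hD (crOp_contDiff Complex.I hχ) (hcc _) (hsub _) hL (-Complex.I)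
  have i2 := integral_crOp hD (crOp_contDiff (-Complex.I) hχ) (hcc _) (hsub _) hL Complex.I
  simp_rw [crOp_comm hχ (-Complex.I) Complex.I] at i1
  rw [i2] at i1
  have e : ∀ z, deriv L z * crOp Complex.I χ z = (z - a)⁻¹ * crOp Complex.I χ z := by
    intro z
    by_cases hz : z ∈ D
    · rw [hL' z hz]
    · rw [image_eq_zero_of_notMem_tsupport (fun h => hz (hsub _ h))]; simp
  simp_rw [e] at i1
  rw [h2] at i1
  have : (1 + -Complex.I * Complex.I) = 2 := by
    rw [neg_mul, Complex.I_mul_I]; norm_num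
  rw [this] at i1
  simp at i1
  exact hκ i1

theorem runge (D : Set ℂ) (hD : IsOpen D) (hDsc : SimplyConnectedSpace D) (K : Set ℂ) (hK : IsCompact K)
    (hKD : K ⊆ D) (g : ℂ → ℂ) (hg : DifferentiableOn ℂ g D) (ε : ℝ) (hε : 0 < ε) :
    ∃ P : Polynomial ℂ, ∀ z ∈ K, ‖g z - P.eval z‖ < ε := by
  have : CompactSpace K := isCompact_iff_compactSpace.1 hK
  let B : Subalgebra ℂ C(K, ℂ) := (polynomialFunctions K).topologicalClosure
  have hB : IsClosed (B : Set C(K, ℂ)) := Subalgebra.isClosed_topologicalClosure _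
  have : CompleteSpace B := hB.completeSpace_coe
  let x0 : C(K, ℂ) := Polynomial.toContinuousMapOnAlgHom K Polynomial.X
  have hx0 : ∀ z : K, x0 z = z := fun z => by simp [x0]
  let x : B := ⟨x0, Subalgebra.le_topologicalClosure _ (by
    rw [← SetLike.mem_coe, polynomialFunctions_coe]; exact ⟨_, rfl⟩)⟩
  have hfr : frontier (spectrum ℂ x) ⊆ spectrum ℂ x0 :=
    haveI : Fact (IsClosed (B : Set C(K, ℂ))) := ⟨hB⟩
    Subalgebra.frontier_spectrum B x
  have hsp : spectrum ℂ x0 ⊆ K := by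
    rw [ContinuousMap.spectrum_eq_range]
    rintro _ ⟨z, rfl⟩
    rw [hx0]; exact z.2
  have hsp2 : K ⊆ spectrum ℂ x := by
    refine Subset.trans ?_ (spectrum.subset_subalgebra x)
    intro z hz
    rw [show ((x : B) : C(K, ℂ)) = x0 from rfl, ContinuousMap.spectrum_eq_range]
    exact ⟨⟨z, hz⟩, hx0 _⟩
  have hcomp : IsCompact (spectrum ℂ x) := spectrum.isCompact x
  have hsD : spectrum ℂ x ⊆ D := no_hole D hD hDsc _ hcomp (hfr.trans (hsp.trans hKD))
  obtain ⟨χ, hχ, hχc, hχs, h1⟩ := exists_cutoff hcomp hD hsD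
  obtain ⟨κ, hκ, hκ'⟩ := exists_kappa
  have hcc : HasCompactSupport (crOp Complex.I χ) :=
    hχc.mono' ((subset_tsupport _).trans (crOp_tsupport _ χ))
  let Φ : ℂ → B := fun s => (crOp Complex.I χ s * g s) • resolvent x s
  have hΦs : tsupport Φ ⊆ tsupport (crOp Complex.I χ) := by
    refine closure_mono ?_
    intro s hs h
    exact hs (by simp [Φ, h])
  have hsup : ∀ s ∈ tsupport (crOp Complex.I χ), s ∈ D ∧ s ∈ resolventSet ℂ x := by
    intro s hs
    refine ⟨hχs (crOp_tsupport _ _ hs), ?_⟩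
    by_contra hsn
    refine (notMem_tsupport_iff_eventuallyEq.2 ?_) hs
    filter_upwards [eventually_eventually_nhds.2 (h1 s hsn)] with t ht
    exact crOp_eq_zero_of_eventually_const ht
  have hΦc : Continuous Φ := by
    refine continuous_of_tsupport fun s hs => ?_
    obtain ⟨hsD, hsr⟩ := hsup s (hΦs hs)
    refine ContinuousAt.smul (f := fun s => crOp Complex.I χ s * g s) ?_ (spectrum.hasDerivAt_resolvent_const_left hsr).continuousAt
    exact (crOp_contDiff _ hχ).continuous.continuousAt.mul (hg.continuousOn.continuousAt (hD.mem_nhds hsD))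
  have hΦi : Integrable Φ := hΦc.integrable_of_hasCompactSupport
    (hcc.mono' ((subset_tsupport _).trans hΦs))
  have hres : ∀ s ∈ resolventSet ℂ x, ∀ z : K, ((resolvent x s : B) : C(K, ℂ)) z = (s - z)⁻¹ := by
    intro s hs z
    have h2 : (algebraMap ℂ B s - x) * resolvent x s = 1 := by
      rw [resolvent]; exact Ring.mul_inverse_cancel _ hs
    have h3 := congrArg (fun b : B => (b : C(K, ℂ)) z) h2
    have h4 : (s - z) * ((resolvent x s : B) : C(K, ℂ)) z = 1 := by
      simpa [x, hx0, Algebra.algebraMap_eq_smul_one] using h3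
    exact eq_inv_of_mul_eq_one_right h4
  have heval : ∀ z : K, ((∫ s, Φ s : B) : C(K, ℂ)) z = κ * g z := by
    intro z
    let ev : B →L[ℂ] ℂ := (ContinuousMap.evalCLM ℂ z).comp (Subalgebra.toSubmodule B).subtypeL
    have e1 : ((∫ s, Φ s : B) : C(K, ℂ)) z = ev (∫ s, Φ s) := rfl
    rw [e1, ← ContinuousLinearMap.integral_comp_comm _ hΦi,
      ← cauchy_pompeiu hκ' hD hχ hχc hχs hg z (hKD z.2) (h1 z (hsp2 z.2))]
    congr 1
    ext s
    have e2 : ev (Φ s) = (crOp Complex.I χ s * g s) * ((resolvent x s : B) : C(K, ℂ)) z := by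
      rw [show ev (Φ s) = (crOp Complex.I χ s * g s) • ev (resolvent x s) from map_smul _ _ _]
      rfl
    rw [e2]
    by_cases hs : s ∈ tsupport (crOp Complex.I χ)
    · rw [hres s (hsup s hs).2 z]; ring
    · rw [image_eq_zero_of_notMem_tsupport hs]; simp
  let y : C(K, ℂ) := κ⁻¹ • ((∫ s, Φ s : B) : C(K, ℂ))
  have hy : y ∈ B := B.smul_mem (∫ s, Φ s : B).2 _
  have hyz : ∀ z : K, y z = g z := by
    intro z
    simp only [y, ContinuousMap.smul_apply, heval, smul_eq_mul]
    field_simp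
  have hy' : y ∈ closure (polynomialFunctions K : Set C(K, ℂ)) := hy
  obtain ⟨P', hP', hd⟩ := Metric.mem_closure_iff.1 hy' ε hε
  rw [polynomialFunctions_coe] at hP'
  obtain ⟨P, rfl⟩ := hP'
  refine ⟨P, fun z hz => ?_⟩
  have := (ContinuousMap.dist_apply_le_dist (f := y) (g := Polynomial.toContinuousMapOnAlgHom K P) ⟨z, hz⟩).trans_lt hd
  rw [hyz, dist_eq_norm] at this
  simpa using this

end Runge

section LinEst

variable {S : ℕ} {V : Type*} [NormedAddCommGroup V] [NormedSpace ℂ V] [FiniteDimensional ℂ V]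

/-- the polynomial `Q` -/
noncomputable def Qf {S : ℕ} (p : Fin (S + 2) → ℂ) (x : ℂ) : ℂ := ∏ j, (x - p j)

/-- the polynomial `Q / (x - p j)` -/
noncomputable def qf {S : ℕ} (p : Fin (S + 2) → ℂ) (j : Fin (S + 2)) (x : ℂ) : ℂ :=
  ∏ i ∈ Finset.univ.erase j, (x - p i)

/-- `Q A(x)` -/
noncomputable def Cf {S : ℕ} {V : Type*} [NormedAddCommGroup V] [NormedSpace ℂ V]
    (p : Fin (S + 2) → ℂ) (B : Fin (S + 2) → V →L[ℂ] V) (x : ℂ) : V →L[ℂ] V :=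
  ∑ j, qf p j x • B j

/-- nonresonance of a family -/
def NR {S : ℕ} {V : Type*} [NormedAddCommGroup V] [NormedSpace ℂ V]
    (B : Fin (S + 2) → V →L[ℂ] V) : Prop :=
  (∀ j (k : ℕ) v, B j v + (k : ℂ) • v = 0 → v = 0) ∧
  (∀ (k : ℕ) v, (∑ j, B j) v + (k : ℂ) • v = 0 → v = 0)

theorem Qf_eq (p : Fin (S + 2) → ℂ) (j : Fin (S + 2)) (x : ℂ) : Qf p x = (x - p j) * qf p j x := by
  rw [Qf, qf, Finset.mul_prod_erase _ (fun i => x - p i) (Finset.mem_univ j)]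

theorem Qf_diff (p : Fin (S + 2) → ℂ) : Differentiable ℂ (Qf p) := by
  unfold Qf; fun_prop

theorem qf_diff (p : Fin (S + 2) → ℂ) (j) : Differentiable ℂ (qf p j) := by
  unfold qf; fun_prop

theorem Cf_diff (p : Fin (S + 2) → ℂ) (B : Fin (S + 2) → V →L[ℂ] V) : Differentiable ℂ (Cf p B) := by
  unfold Cf
  have := qf_diff p
  fun_prop

theorem Qf_ne (p : Fin (S + 2) → ℂ) (x : ℂ) (h : ∀ j, x ≠ p j) : Qf p x ≠ 0 := by
  rw [Qf, Finset.prod_ne_zero_iff]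
  intro j _
  exact sub_ne_zero.2 (h j)

theorem qf_ne (p : Fin (S + 2) → ℂ) (j) (x : ℂ) (h : ∀ i, i ≠ j → x ≠ p i) : qf p j x ≠ 0 := by
  rw [qf, Finset.prod_ne_zero_iff]
  intro i hi
  exact sub_ne_zero.2 (h i (Finset.ne_of_mem_erase hi))

theorem qf_eq_zero (p : Fin (S + 2) → ℂ) (j i) (h : i ≠ j) : qf p j (p i) = 0 := by
  rw [qf, Finset.prod_eq_zero_iff]
  exact ⟨i, Finset.mem_erase.2 ⟨h, Finset.mem_univ _⟩, by simp⟩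

theorem Cf_at (p : Fin (S + 2) → ℂ) (B : Fin (S + 2) → V →L[ℂ] V) (j) : Cf p B (p j) = qf p j (p j) • B j := by
  rw [Cf, Finset.sum_eq_single j]
  · intro i _ hi
    rw [qf_eq_zero p i j hi.symm, zero_smul]
  · simp

/-- a priori estimates -/
def EstE {S : ℕ} (V : Type*) [NormedAddCommGroup V] [NormedSpace ℂ V] (p : Fin (S + 2) → ℂ) (K : Set ℂ) : Prop :=
  ∀ B : Fin (S + 2) → V →L[ℂ] V, NR B → ∃ c : ℝ, 0 ≤ c ∧ ∀ h : ℂ → V, Differentiable ℂ h → ∀ M : ℝ,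
    (∀ x ∈ K, ‖Qf p x • deriv h x + Cf p B x (h x)‖ ≤ M) → ∀ x ∈ K, ‖h x‖ ≤ c * M

/-- oscillation estimates -/
def EstO {S : ℕ} (V : Type*) [NormedAddCommGroup V] [NormedSpace ℂ V] (p : Fin (S + 2) → ℂ) (K : Set ℂ) : Prop :=
  ∃ c : ℝ, 0 ≤ c ∧ ∀ h : ℂ → V, Differentiable ℂ h → h (p 0) = 0 → ∀ M : ℝ,
    (∀ x ∈ K, ‖deriv h x‖ ≤ M) → ∀ x ∈ K, ‖h x‖ ≤ c * M

theorem bdd_below (L : V →L[ℂ] V) (h : ∀ v, L v = 0 → v = 0) : ∃ c : ℝ, 0 ≤ c ∧ ∀ v, ‖v‖ ≤ c * ‖L v‖ := by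
  have hk : L.toLinearMap.ker = ⊥ := LinearMap.ker_eq_bot'.2 h
  obtain ⟨K, _, hK⟩ := LinearMap.exists_antilipschitzWith L.toLinearMap hk
  refine ⟨K, K.2, fun v => ?_⟩
  simpa using hK.le_mul_dist v 0

theorem estO_ball (x0 y : ℂ) (r : ℝ) (hy : y ∈ Metric.closedBall x0 r) :
    ∃ c : ℝ, 0 ≤ c ∧ ∀ k : ℂ → V, Differentiable ℂ k → ∀ M : ℝ, ‖k y‖ ≤ M →
      (∀ x ∈ Metric.closedBall x0 r, ‖deriv k x‖ ≤ M) →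
      ∀ x ∈ Metric.closedBall x0 r, ‖k x‖ ≤ c * M := by
  obtain ⟨c, hc, h⟩ := reg_ball (V := V) x0 r (fun _ => 1) (fun _ => 0) continuous_const continuous_const
    (by simp) y hy
  exact ⟨c, hc, by simpa using h⟩

theorem sing_est (p : Fin (S + 2) → ℂ) (hp : Function.Injective p) (j : Fin (S + 2)) (r : ℝ) (hr : 0 < r)
    (hb : ∀ i, i ≠ j → p i ∉ Metric.closedBall (p j) r) : EstE V p (Metric.closedBall (p j) r) := by
  intro B hB
  have := FiniteDimensional.complete ℂ V
  obtain ⟨c, hc, h⟩ := sing_ball (V := V) (p j) r hr (qf p j) (Cf p B) (qf_diff p j) (Cf_diff p B)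
    (fun x hx => qf_ne p j x fun i hi hxi => hb i hi (hxi ▸ hx)) (by
      intro m
      have hne : qf p j (p j) ≠ 0 := qf_ne p j _ fun i hi h => hi (hp h.symm)
      obtain ⟨c, hc, h⟩ := bdd_below (Cf p B (p j) + ((m : ℂ) * qf p j (p j)) • ContinuousLinearMap.id ℂ V) (by
        intro v hv
        apply hB.1 j m v
        have : qf p j (p j) • (B j v + (m : ℂ) • v) = 0 := by
          rw [← hv, Cf_at]
          simp
          module
        exact (smul_eq_zero.1 this).resolve_left hne)
      exact ⟨c, hc, by simpa using h⟩)
  refine ⟨c, hc, fun k hk M hM => h k hk M fun x hx => ?_⟩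
  rw [← Qf_eq]
  exact hM x hx

theorem exists_adm (p : Fin (S + 2) → ℂ) (hp : Function.Injective p) (D : Set ℂ) (hD : IsOpen D)
    (hDc : IsPreconnected D) (hpD : ∀ j, p j ∈ D) (K : Set ℂ) (hK : IsCompact K) (hKD : K ⊆ D) :
    ∃ K', K ⊆ K' ∧ IsCompact K' ∧ K' ⊆ D ∧ p 0 ∈ K' ∧ EstE V p K' ∧ EstO V p K' := by
  have hsing : ∀ j, ∃ r > 0, Metric.closedBall (p j) r ⊆ D ∧ ∀ i, i ≠ j → p i ∉ Metric.closedBall (p j) r := by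
    intro j
    have h1 : D ∩ (p '' {i | i ≠ j})ᶜ ∈ 𝓝 (p j) := by
      refine inter_mem (hD.mem_nhds (hpD j)) (IsOpen.mem_nhds (Set.toFinite _).isClosed.isOpen_compl ?_)
      rintro ⟨i, hi, h⟩
      exact hi (hp h)
    obtain ⟨r, hr, h⟩ := Metric.nhds_basis_closedBall.mem_iff.1 h1
    exact ⟨r, hr, fun x hx => (h hx).1, fun i hi hx => (h hx).2 ⟨i, hi, rfl⟩⟩
  refine exists_compact_of_chain D hDc (p 0) (hpD 0)
    (fun K' => IsCompact K' ∧ K' ⊆ D ∧ p 0 ∈ K' ∧ EstE V p K' ∧ EstO V p K') ?_ ?_ ?_ K hK hKD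
  · rintro K K' ⟨h1, h2, h3, h4, c, hc, h5⟩ ⟨h1', h2', h3', h4', c', hc', h5'⟩
    refine ⟨h1.union h1', union_subset h2 h2', Or.inl h3, ?_, c + c', by positivity, ?_⟩
    · intro B hB
      obtain ⟨c, hc, h⟩ := h4 B hB
      obtain ⟨c', hc', h'⟩ := h4' B hB
      refine ⟨c + c', by positivity, fun k hk M hM x hx => ?_⟩
      have hM0 : 0 ≤ M := (norm_nonneg _).trans (hM _ (Or.inl h3))
      rw [add_mul]
      rcases hx with hx | hx
      · have := h k hk M (fun x hx => hM x (Or.inl hx)) x hx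
        nlinarith
      · have := h' k hk M (fun x hx => hM x (Or.inr hx)) x hx
        nlinarith
    · intro k hk hk0 M hM x hx
      have hM0 : 0 ≤ M := (norm_nonneg _).trans (hM _ (Or.inl h3))
      rw [add_mul]
      rcases hx with hx | hx
      · have := h5 k hk hk0 M (fun x hx => hM x (Or.inl hx)) x hx
        nlinarith
      · have := h5' k hk hk0 M (fun x hx => hM x (Or.inr hx)) x hx
        nlinarith
  ·
    have hO : ∀ x r K, Metric.closedBall x r ⊆ D → p 0 ∈ K → EstO V p K → (K ∩ Metric.closedBall x r).Nonempty →
        EstO V p (K ∪ Metric.closedBall x r) := by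
      rintro x r K hr h0 ⟨c, hc, h5⟩ ⟨y, hyK, hyb⟩
      obtain ⟨c', hc', h'⟩ := estO_ball (V := V) x y r hyb
      refine ⟨c + c' * (c + 1), by positivity, ?_⟩
      intro k hk hk0 M hM z hz
      have hM0 : 0 ≤ M := (norm_nonneg _).trans (hM _ (Or.inl h0))
      have hA := h5 k hk hk0 M (fun x hx => hM x (Or.inl hx))
      have : 0 ≤ c' * (c + 1) * M := by positivity
      have : 0 ≤ c * M := by positivity
      rw [add_mul]
      rcases hz with hz | hz
      · have := hA z hz
        linarith
      · have := h' k hk ((c + 1) * M) ((hA y hyK).trans (by nlinarith))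
          (fun x hx => (hM x (Or.inr hx)).trans (by nlinarith)) z hz
        nlinarith
    intro x hx
    by_cases hxp : ∃ j, x = p j
    · obtain ⟨j, rfl⟩ := hxp
      obtain ⟨r, hr, hrD, hri⟩ := hsing j
      refine ⟨r, hr, ?_⟩
      rintro K ⟨h1, h2, h3, h4, h5⟩ hne
      refine ⟨h1.union (isCompact_closedBall _ _), union_subset h2 hrD, Or.inl h3, ?_, hO _ _ _ hrD h3 h5 hne⟩
      intro B hB
      obtain ⟨c, hc, h⟩ := h4 B hB
      obtain ⟨c', hc', h'⟩ := sing_est p hp j r hr hri B hB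
      refine ⟨c + c', by positivity, fun k hk M hM x hx => ?_⟩
      have hM0 : 0 ≤ M := (norm_nonneg _).trans (hM _ (Or.inl h3))
      rw [add_mul]
      rcases hx with hx | hx
      · have := h k hk M (fun x hx => hM x (Or.inl hx)) x hx
        nlinarith
      · have := h' k hk M (fun x hx => hM x (Or.inr hx)) x hx
        nlinarith
    · push Not at hxp
      have h1 : D ∩ (range p)ᶜ ∈ 𝓝 x := by
        refine inter_mem (hD.mem_nhds hx) (IsOpen.mem_nhds (Set.finite_range p).isClosed.isOpen_compl ?_)
        rintro ⟨i, h⟩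
        exact hxp i h.symm
      obtain ⟨r, hr, hrs⟩ := Metric.nhds_basis_closedBall.mem_iff.1 h1
      refine ⟨r, hr, ?_⟩
      rintro K ⟨h1, h2, h3, h4, h5⟩ hne
      have hrD : Metric.closedBall x r ⊆ D := fun x hx => (hrs hx).1
      refine ⟨h1.union (isCompact_closedBall _ _), union_subset h2 hrD, Or.inl h3, ?_, hO _ _ _ hrD h3 h5 hne⟩
      intro B hB
      obtain ⟨y, hyK, hyb⟩ := hne
      obtain ⟨c, hc, h⟩ := h4 B hB
      obtain ⟨c', hc', h'⟩ := reg_ball (V := V) x r (Qf p) (Cf p B) (Qf_diff p).continuous (Cf_diff p B).continuous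
        (fun z hz => Qf_ne p z fun j hj => (hrs hz).2 ⟨j, hj.symm⟩) y hyb
      refine ⟨c + c' * (c + 1), by positivity, ?_⟩
      intro k hk M hM z hz
      have hM0 : 0 ≤ M := (norm_nonneg _).trans (hM _ (Or.inl h3))
      have hA := h k hk M (fun x hx => hM x (Or.inl hx))
      have : 0 ≤ c' * (c + 1) * M := by positivity
      have : 0 ≤ c * M := by positivity
      rw [add_mul]
      rcases hz with hz | hz
      · have := hA z hz
        linarith
      · have := h' k hk ((c + 1) * M) ((hA y hyK).trans (by nlinarith))
          (fun x hx => (hM x (Or.inr hx)).trans (by nlinarith)) z hz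
        nlinarith
  · obtain ⟨r, hr, hrD, hri⟩ := hsing 0
    have hm := Metric.mem_closedBall_self (x := p 0) hr.le
    refine ⟨Metric.closedBall (p 0) r, hm, isCompact_closedBall _ _, hrD, hm, sing_est p hp 0 r hr hri, ?_⟩
    obtain ⟨c', hc', h'⟩ := estO_ball (V := V) (p 0) (p 0) r hm
    refine ⟨c', hc', fun k hk hk0 M hM => h' k hk M ?_ hM⟩
    rw [hk0, norm_zero]
    exact (norm_nonneg _).trans (hM _ hm)

/-- estimates including the derivative -/
theorem exists_adm' (p : Fin (S + 2) → ℂ) (hp : Function.Injective p) (D : Set ℂ) (hD : IsOpen D)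
    (hDc : IsPreconnected D) (hpD : ∀ j, p j ∈ D) (K : Set ℂ) (hK : IsCompact K) (hKD : K ⊆ D) :
    ∃ K', K ⊆ K' ∧ IsCompact K' ∧ K' ⊆ D ∧ (∀ j, p j ∈ K') ∧ EstO V p K' ∧
      ∀ B : Fin (S + 2) → V →L[ℂ] V, NR B → ∃ c : ℝ, 0 ≤ c ∧ ∀ h : ℂ → V, Differentiable ℂ h → ∀ M : ℝ,
        (∀ x ∈ K', ‖Qf p x • deriv h x + Cf p B x (h x)‖ ≤ M) → ∀ x ∈ K', ‖h x‖ ≤ c * M ∧ ‖deriv h x‖ ≤ c * M := by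
  have hsing : ∀ j, ∃ r > 0, Metric.closedBall (p j) r ⊆ D ∧ ∀ i, i ≠ j → p i ∉ Metric.closedBall (p j) r := by
    intro j
    have h1 : D ∩ (p '' {i | i ≠ j})ᶜ ∈ 𝓝 (p j) := by
      refine inter_mem (hD.mem_nhds (hpD j)) (IsOpen.mem_nhds (Set.toFinite _).isClosed.isOpen_compl ?_)
      rintro ⟨i, hi, h⟩
      exact hi (hp h)
    obtain ⟨r, hr, h⟩ := Metric.nhds_basis_closedBall.mem_iff.1 h1
    exact ⟨r, hr, fun x hx => (h hx).1, fun i hi hx => (h hx).2 ⟨i, hi, rfl⟩⟩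
  choose r hr hrD hri using hsing
  obtain ⟨K', hKK, hK'c, hK'D, hp0, hE, hO⟩ := exists_adm (V := V) p hp D hD hDc hpD
    (K ∪ ⋃ j, Metric.closedBall (p j) (r j)) (hK.union (isCompact_iUnion fun j => isCompact_closedBall _ _))
    (union_subset hKD (iUnion_subset hrD))
  have hsub : ∀ j, Metric.closedBall (p j) (r j) ⊆ K' := fun j =>
    (subset_iUnion _ j).trans (subset_union_right.trans hKK)
  refine ⟨K', subset_union_left.trans hKK, hK'c, hK'D, fun j => hsub j (Metric.mem_closedBall_self (hr j).le), hO, ?_⟩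
  intro B hB
  obtain ⟨c, hc, h⟩ := hE B hB
  obtain ⟨a, ha⟩ := hK'c.exists_bound_of_continuousOn (Cf_diff p B).continuous.continuousOn
  have ha0 : 0 ≤ a := (norm_nonneg _).trans (ha _ hp0)
  set K2 := K' \ ⋃ j, Metric.ball (p j) (r j) with hK2
  have hK2c : IsCompact K2 := hK'c.diff (isOpen_iUnion fun j => Metric.isOpen_ball)
  obtain ⟨c0, hc0, hc0'⟩ : ∃ c0 > 0, ∀ x ∈ K2, c0 ≤ ‖Qf p x‖ := by
    by_cases hne : K2.Nonempty
    · obtain ⟨x1, hx1, hmin⟩ := hK2c.exists_isMinOn hne (f := fun x => ‖Qf p x‖) (Qf_diff p).continuous.norm.continuousOn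
      refine ⟨‖Qf p x1‖, norm_pos_iff.2 (Qf_ne p x1 ?_), fun x hx => hmin hx⟩
      intro j hj
      exact hx1.2 (mem_iUnion.2 ⟨j, by rw [hj]; exact Metric.mem_ball_self (hr j)⟩)
    · exact ⟨1, one_pos, fun x hx => (hne ⟨x, hx⟩).elim⟩
  refine ⟨c + (1 + a * c) / c0, by positivity, fun k hk M hM x hx => ?_⟩
  have hM0 : 0 ≤ M := (norm_nonneg _).trans (hM _ hp0)
  have hA := h k hk M hM
  have t1 : 0 ≤ (1 + a * c) / c0 * M := by positivity
  have t2 : 0 ≤ c * M := by positivity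
  rw [add_mul]
  refine ⟨by linarith [hA x hx], ?_⟩
  suffices hs : ‖deriv k x‖ ≤ (1 + a * c) / c0 * M by linarith
  have hout : ∀ y ∈ K2, ‖deriv k y‖ ≤ (1 + a * c) / c0 * M := by
    intro y hy
    have h1 : ‖Qf p y‖ * ‖deriv k y‖ ≤ M + a * (c * M) := by
      rw [← norm_smul]
      calc ‖Qf p y • deriv k y‖ = ‖(Qf p y • deriv k y + Cf p B y (k y)) - Cf p B y (k y)‖ := by
            congr 1; abel
        _ ≤ _ := norm_sub_le _ _
        _ ≤ _ := add_le_add (hM _ hy.1) (((Cf p B y).le_opNorm _).trans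
            (mul_le_mul (ha _ hy.1) (hA y hy.1) (norm_nonneg _) ha0))
    rw [div_mul_eq_mul_div, le_div_iff₀ hc0]
    have := mul_le_mul_of_nonneg_right (hc0' y hy) (norm_nonneg (deriv k y))
    linarith
  by_cases hx2 : x ∈ K2
  · exact hout x hx2
  · have : x ∈ ⋃ j, Metric.ball (p j) (r j) := by
      by_contra hn; exact hx2 ⟨hx, hn⟩
    have hcs : CompleteSpace V := FiniteDimensional.complete ℂ V
    have hdk : Differentiable ℂ (deriv k) := fun x => (hk.analyticAt x).deriv.differentiableAt
    have hclo : closure (⋃ j, Metric.ball (p j) (r j)) ⊆ ⋃ j, Metric.closedBall (p j) (r j) :=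
      closure_minimal (iUnion_mono fun j => Metric.ball_subset_closedBall)
        (isClosed_iUnion_of_finite fun j => Metric.isClosed_closedBall)
    refine Complex.norm_le_of_forall_mem_frontier_norm_le (U := ⋃ j, Metric.ball (p j) (r j))
      ((Bornology.isBounded_iUnion).2 fun j => Metric.isBounded_ball)
      hdk.diffContOnCl ?_ (subset_closure this)
    intro y hy
    rw [(isOpen_iUnion fun j => Metric.isOpen_ball).frontier_eq] at hy
    exact hout y ⟨iUnion_subset hsub (hclo hy.1), hy.2⟩

end LinEst

section PolyFun

variable {S : ℕ} {V : Type*} [NormedAddCommGroup V] [NormedSpace ℂ V]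

/-- `V`-valued polynomial functions of degree `< n`. -/
def PFd (V : Type*) [NormedAddCommGroup V] [NormedSpace ℂ V] (n : ℕ) : Submodule ℂ (ℂ → V) :=
  Submodule.span ℂ {f | ∃ k < n, ∃ v : V, f = fun x => x ^ k • v}

/-- `V`-valued polynomial functions. -/
def PF (V : Type*) [NormedAddCommGroup V] [NormedSpace ℂ V] : Submodule ℂ (ℂ → V) :=
  Submodule.span ℂ {f | ∃ (k : ℕ) (v : V), f = fun x => x ^ k • v}

theorem mono_mem_PF (k : ℕ) (v : V) : (fun x : ℂ => x ^ k • v) ∈ PF V :=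
  Submodule.subset_span ⟨k, v, rfl⟩

theorem mono_mem_PFd {n : ℕ} (k : ℕ) (hk : k < n) (v : V) : (fun x : ℂ => x ^ k • v) ∈ PFd V n :=
  Submodule.subset_span ⟨k, hk, v, rfl⟩

theorem PFd_mono {m n : ℕ} (h : m ≤ n) : PFd V m ≤ PFd V n :=
  Submodule.span_mono fun _ ⟨k, hk, v, hf⟩ => ⟨k, hk.trans_le h, v, hf⟩

theorem PFd_mul (a : ℂ) {n : ℕ} {f : ℂ → V} (hf : f ∈ PFd V n) : (fun x => (x - a) • f x) ∈ PFd V (n + 1) := by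
  induction hf using Submodule.span_induction with
  | mem f hf =>
    obtain ⟨k, hk, v, rfl⟩ := hf
    have e : (fun x : ℂ => (x - a) • x ^ k • v) = (fun x : ℂ => x ^ (k + 1) • v) - a • (fun x : ℂ => x ^ k • v) := by
      ext x
      simp only [Pi.sub_apply, Pi.smul_apply]
      module
    rw [e]
    exact sub_mem (mono_mem_PFd _ (by omega) v) (Submodule.smul_mem _ _ (mono_mem_PFd _ (by omega) v))
  | zero => simp only [Pi.zero_apply, smul_zero]; exact Submodule.zero_mem _
  | add f g _ _ hf hg =>
    convert add_mem hf hg using 1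
    ext x
    simp
  | smul c f _ hf =>
    convert Submodule.smul_mem _ c hf using 1
    ext x
    simp only [Pi.smul_apply]
    rw [smul_comm]

theorem prod_mono_PFd {ι : Type*} (p : ι → ℂ) (s : Finset ι) (k : ℕ) (v : V) :
    (fun x : ℂ => (∏ i ∈ s, (x - p i)) • x ^ k • v - x ^ (k + s.card) • v) ∈ PFd V (k + s.card) := by
  classical
  induction s using Finset.induction_on with
  | empty => simp only [Finset.prod_empty, one_smul, Finset.card_empty, add_zero, sub_self]; exact Submodule.zero_mem _
  | insert a s ha ih =>
    have h1 := PFd_mul (p a) ih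
    rw [Finset.card_insert_of_notMem ha]
    have e : (fun x : ℂ => (∏ i ∈ insert a s, (x - p i)) • x ^ k • v - x ^ (k + (s.card + 1)) • v)
      = (fun x : ℂ => (x - p a) • ((∏ i ∈ s, (x - p i)) • x ^ k • v - x ^ (k + s.card) • v)) -
        (p a) • (fun x : ℂ => x ^ (k + s.card) • v) := by
      ext x
      rw [Finset.prod_insert ha]
      simp only [Pi.sub_apply, Pi.smul_apply]
      module
    rw [e]
    exact sub_mem h1 (Submodule.smul_mem _ _ (mono_mem_PFd _ (by omega) v))

theorem PF_mul (a : ℂ) {f : ℂ → V} (hf : f ∈ PF V) : (fun x => (x - a) • f x) ∈ PF V := by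
  induction hf using Submodule.span_induction with
  | mem f hf =>
    obtain ⟨k, v, rfl⟩ := hf
    have e : (fun x : ℂ => (x - a) • x ^ k • v) = (fun x : ℂ => x ^ (k + 1) • v) - a • (fun x : ℂ => x ^ k • v) := by
      ext x
      simp only [Pi.sub_apply, Pi.smul_apply]
      module
    rw [e]
    exact sub_mem (mono_mem_PF _ v) (Submodule.smul_mem _ _ (mono_mem_PF _ v))
  | zero => simp only [Pi.zero_apply, smul_zero, map_zero]; exact Submodule.zero_mem _
  | add f g _ _ hf hg =>
    convert add_mem hf hg using 1
    ext x
    simp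
  | smul c f _ hf =>
    convert Submodule.smul_mem _ c hf using 1
    ext x
    simp only [Pi.smul_apply]
    rw [smul_comm]

theorem PF_prod {ι : Type*} (p : ι → ℂ) (s : Finset ι) {f : ℂ → V} (hf : f ∈ PF V) :
    (fun x => (∏ i ∈ s, (x - p i)) • f x) ∈ PF V := by
  classical
  induction s using Finset.induction_on with
  | empty => simpa using hf
  | insert a s ha ih =>
    convert PF_mul (p a) ih using 1
    ext x
    rw [Finset.prod_insert ha, mul_smul]

theorem PF_clm (L : V →L[ℂ] V) {f : ℂ → V} (hf : f ∈ PF V) : (fun x => L (f x)) ∈ PF V := by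
  induction hf using Submodule.span_induction with
  | mem f hf =>
    obtain ⟨k, v, rfl⟩ := hf
    simpa using mono_mem_PF k (L v)
  | zero => simp only [Pi.zero_apply, smul_zero, map_zero]; exact Submodule.zero_mem _
  | add f g _ _ hf hg =>
    convert add_mem hf hg using 1
    ext x
    simp
  | smul c f _ hf =>
    convert Submodule.smul_mem _ c hf using 1
    ext x
    simp

theorem PF_diff {f : ℂ → V} (hf : f ∈ PF V) : Differentiable ℂ f := by
  induction hf using Submodule.span_induction with
  | mem f hf =>
    obtain ⟨k, v, rfl⟩ := hf
    fun_prop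
  | zero => exact differentiable_const 0
  | add f g _ _ hf hg => exact hf.add hg
  | smul c f _ hf => exact hf.const_smul c

theorem deriv_mono (k : ℕ) (v : V) : deriv (fun x : ℂ => x ^ k • v) = (k : ℂ) • fun x : ℂ => x ^ (k - 1) • v := by
  ext x
  have := ((hasDerivAt_pow k x).smul_const v).deriv
  rw [this]
  simp only [Pi.smul_apply]
  module

theorem PF_deriv {f : ℂ → V} (hf : f ∈ PF V) : deriv f ∈ PF V := by
  induction hf using Submodule.span_induction with
  | mem f hf =>
    obtain ⟨k, v, rfl⟩ := hf
    rw [deriv_mono]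
    exact Submodule.smul_mem _ _ (mono_mem_PF _ v)
  | zero =>
    have : deriv (0 : ℂ → V) = 0 := by ext x; simp [Pi.zero_def]
    rw [this]; exact Submodule.zero_mem _
  | add f g hf' hg' hf hg =>
    have : deriv (f + g) = deriv f + deriv g := by
      ext x
      exact deriv_add (PF_diff hf' x) (PF_diff hg' x)
    rw [this]; exact add_mem hf hg
  | smul c f hf' hf =>
    have : deriv (c • f) = c • deriv f := by
      ext x
      exact deriv_const_smul c (PF_diff hf' x)
    rw [this]; exact Submodule.smul_mem _ _ hf

/-- the low degree correction -/
def lowPoly {S : ℕ} {V : Type*} [NormedAddCommGroup V] [NormedSpace ℂ V] (φ : Fin (S + 1) → V) (x : ℂ) : V :=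
  ∑ i : Fin (S + 1), x ^ (i : ℕ) • φ i

theorem lowPoly_mem (φ : Fin (S + 1) → V) : lowPoly φ ∈ PF V := by
  have : lowPoly φ = ∑ i : Fin (S + 1), fun x : ℂ => x ^ (i : ℕ) • φ i := by
    ext x; simp [lowPoly]
  rw [this]
  exact sum_mem fun i _ => mono_mem_PF _ _

/-- the operator -/
noncomputable def TT {S : ℕ} {V : Type*} [NormedAddCommGroup V] [NormedSpace ℂ V]
    (p : Fin (S + 2) → ℂ) (B : Fin (S + 2) → V →L[ℂ] V) (h : ℂ → V) (x : ℂ) : V :=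
  Qf p x • deriv h x + Cf p B x (h x)

theorem TT_mono_PFd (p : Fin (S + 2) → ℂ) (B : Fin (S + 2) → V →L[ℂ] V) (l : ℕ) (u : V) :
    (fun x => TT p B (fun x : ℂ => x ^ l • u) x - x ^ (l + S + 1) • ((∑ j, B j) u + (l : ℂ) • u)) ∈ PFd V (l + S + 1) := by
  have hq : ∀ j, (fun x : ℂ => qf p j x • x ^ l • B j u - x ^ (l + S + 1) • B j u) ∈ PFd V (l + S + 1) := by
    intro j
    have := prod_mono_PFd p (Finset.univ.erase j) l (B j u)
    rw [Finset.card_erase_of_mem (Finset.mem_univ j), Finset.card_univ, Fintype.card_fin] at this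
    exact this
  have hQ : (fun x : ℂ => (l : ℂ) • (Qf p x • x ^ (l - 1) • u) - (l : ℂ) • (x ^ (l + S + 1) • u)) ∈ PFd V (l + S + 1) := by
    rcases Nat.eq_zero_or_pos l with rfl | hl
    · simp only [Nat.cast_zero, zero_smul, sub_self]; exact Submodule.zero_mem _
    · have := prod_mono_PFd p Finset.univ (l - 1) u
      rw [Finset.card_univ, Fintype.card_fin, show l - 1 + (S + 2) = l + S + 1 by omega] at this
      convert Submodule.smul_mem _ (l : ℂ) this using 1
      ext x
      simp only [Pi.smul_apply, smul_sub]
      rfl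
  convert add_mem hQ (sum_mem fun j (_ : j ∈ Finset.univ) => hq j) using 1
  ext x
  simp only [Pi.add_apply, Finset.sum_apply]
  rw [TT, deriv_mono]
  simp only [Pi.smul_apply, Cf, ContinuousLinearMap.sum_apply, ContinuousLinearMap.smul_apply, map_smul,
    Finset.sum_sub_distrib, smul_add, Finset.smul_sum]
  rw [smul_comm (Qf p x), smul_comm (x ^ (l + S + 1)) (l : ℂ)]
  simp only [fun j => smul_comm (x ^ l) (qf p j x) (B j u)]
  abel

theorem TT_add (p : Fin (S + 2) → ℂ) (B : Fin (S + 2) → V →L[ℂ] V) {f g : ℂ → V} (hf : Differentiable ℂ f)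
    (hg : Differentiable ℂ g) : TT p B (f + g) = TT p B f + TT p B g := by
  ext x
  have : deriv (f + g) x = deriv f x + deriv g x := deriv_add (hf x) (hg x)
  simp only [TT, this, Pi.add_apply, map_add, smul_add]
  abel

theorem TT_smul (p : Fin (S + 2) → ℂ) (B : Fin (S + 2) → V →L[ℂ] V) {f : ℂ → V} (hf : Differentiable ℂ f)
    (c : ℂ) : TT p B (c • f) = c • TT p B f := by
  ext x
  have : deriv (c • f) x = c • deriv f x := deriv_const_smul c (hf x)
  simp only [TT, this, Pi.smul_apply, map_smul, smul_add]
  rw [smul_comm]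

theorem poly_solve [FiniteDimensional ℂ V] (p : Fin (S + 2) → ℂ) (B : Fin (S + 2) → V →L[ℂ] V) (hB : NR B)
    {g : ℂ → V} (hg : g ∈ PF V) : ∃ h ∈ PF V, ∃ φ : Fin (S + 1) → V, g = TT p B h + lowPoly φ := by
  let R : Submodule ℂ (ℂ → V) :=
    { carrier := {g | ∃ h ∈ PF V, ∃ φ : Fin (S + 1) → V, g = TT p B h + lowPoly φ}
      zero_mem' := ⟨0, Submodule.zero_mem _, 0, by ext x; simp [TT, lowPoly, Pi.zero_def]⟩
      add_mem' := by
        rintro _ _ ⟨h, hh, φ, rfl⟩ ⟨h', hh', φ', rfl⟩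
        refine ⟨h + h', add_mem hh hh', φ + φ', ?_⟩
        rw [TT_add p B (PF_diff hh) (PF_diff hh')]
        have : lowPoly (φ + φ') = lowPoly φ + lowPoly φ' := by
          ext x; simp [lowPoly, smul_add, Finset.sum_add_distrib]
        rw [this]; abel
      smul_mem' := by
        rintro c _ ⟨h, hh, φ, rfl⟩
        refine ⟨c • h, Submodule.smul_mem _ _ hh, c • φ, ?_⟩
        rw [TT_smul p B (PF_diff hh)]
        have : lowPoly (c • φ) = c • lowPoly φ := by
          ext x; simp only [lowPoly, Pi.smul_apply, Finset.smul_sum]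
          exact Finset.sum_congr rfl fun i _ => smul_comm _ _ _
        rw [this, smul_add] }
  have hlow : ∀ k < S + 1, ∀ v : V, (fun x : ℂ => x ^ k • v) ∈ R := by
    intro k hk v
    refine ⟨0, Submodule.zero_mem _, Pi.single ⟨k, hk⟩ v, ?_⟩
    ext x
    simp only [TT, lowPoly, Pi.add_apply, Pi.zero_apply, map_zero, add_zero]
    rw [Finset.sum_eq_single ⟨k, hk⟩]
    · simp [Pi.zero_def]
    · intro i _ hi; simp [Pi.single_eq_of_ne hi]
    · simp
  have key : ∀ n, PFd V n ≤ R := by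
    intro n
    induction n with
    | zero =>
      refine Submodule.span_le.2 ?_
      rintro _ ⟨k, hk, -⟩
      omega
    | succ n ih =>
      refine Submodule.span_le.2 ?_
      rintro _ ⟨k, hk, v, rfl⟩
      rcases lt_or_ge k (S + 1) with h | h
      · exact hlow k h v
      rcases Nat.lt_succ_iff_lt_or_eq.1 hk with h' | rfl
      · exact ih (mono_mem_PFd k h' v)
      obtain ⟨l, rfl⟩ := Nat.exists_eq_add_of_le h
      obtain ⟨u, hu⟩ : ∃ u, (∑ j, B j) u + (l : ℂ) • u = v := by
        let L : V →ₗ[ℂ] V := (∑ j, B j : V →L[ℂ] V).toLinearMap + (l : ℂ) • LinearMap.id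
        have hinj : Function.Injective L := by
          rw [← LinearMap.ker_eq_bot, LinearMap.ker_eq_bot']
          intro v hv
          exact hB.2 l v hv
        exact LinearMap.surjective_of_injective hinj v
      have h1 := TT_mono_PFd p B l u
      rw [hu, show l + S + 1 = S + 1 + l by ring] at h1
      have h2 := ih h1
      have h3 : TT p B (fun x : ℂ => x ^ l • u) ∈ R :=
        ⟨_, mono_mem_PF l u, 0, by ext x; simp [lowPoly]⟩
      have h4 := sub_mem h3 h2
      have e : (fun x : ℂ => x ^ (S + 1 + l) • v) = (TT p B fun x => x ^ l • u) -
          fun x => TT p B (fun x => x ^ l • u) x - x ^ (S + 1 + l) • v := by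
        ext x
        simp
      rw [SetLike.mem_coe, e]
      exact h4
  have : PF V ≤ R := by
    refine Submodule.span_le.2 ?_
    rintro _ ⟨k, v, rfl⟩
    exact key (k + 1) (mono_mem_PFd k (by omega) v)
  exact this hg

theorem TT_mem_PF (p : Fin (S + 2) → ℂ) (B : Fin (S + 2) → V →L[ℂ] V) {h : ℂ → V} (hh : h ∈ PF V) :
    TT p B h ∈ PF V := by
  have : TT p B h = (fun x => Qf p x • deriv h x) + ∑ j, fun x => qf p j x • B j (h x) := by
    ext x
    simp [TT, Cf]
  rw [this]
  exact add_mem (PF_prod p _ (PF_deriv hh)) (sum_mem fun j _ => PF_prod p _ (PF_clm (B j) hh))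

end PolyFun

/-- Abstract index argument. -/
theorem abs_index {W1 W2 F : Type*} [NormedAddCommGroup W1] [NormedSpace ℂ W1] [CompleteSpace W1]
    [NormedAddCommGroup W2] [NormedSpace ℂ W2] [CompleteSpace W2]
    [NormedAddCommGroup F] [NormedSpace ℂ F] [FiniteDimensional ℂ F]
    (X0 : Submodule ℂ W1) (Y0 : Submodule ℂ W2) (A0 A1 : W1 →L[ℂ] W2) (ι : F →L[ℂ] W2)
    (hA0 : ∀ x ∈ X0, A0 x ∈ Y0) (hA1 : ∀ x ∈ X0, A1 x ∈ Y0) (hι : ∀ φ, ι φ ∈ Y0)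
    (G : Set ℂ) (hG : IsPreconnected G)
    (hest : ∀ z ∈ G, ∃ c, 0 ≤ c ∧ ∀ x ∈ X0, ‖x‖ ≤ c * ‖A0 x + z • A1 x‖)
    (hs : ∀ z ∈ G, ∀ y ∈ Y0, ∃ x ∈ X0, ∃ φ, A0 x + z • A1 x + ι φ = y)
    (z0 : ℂ) (hz0 : z0 ∈ G)
    (h0 : ∀ x ∈ X0.topologicalClosure, ∀ φ, A0 x + z0 • A1 x + ι φ = 0 → φ = 0) :
    ∀ z ∈ G, ∃ c, 0 ≤ c ∧ ∀ x ∈ X0, ∀ φ, ‖x‖ ≤ c * ‖A0 x + z • A1 x + ι φ‖ ∧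
      ‖φ‖ ≤ c * ‖A0 x + z • A1 x + ι φ‖ := by
  have : CompleteSpace F := FiniteDimensional.complete ℂ F
  let X := X0.topologicalClosure
  let Y := Y0.topologicalClosure
  have hXc : CompleteSpace X := X0.isClosed_topologicalClosure.completeSpace_coe
  have hYc : CompleteSpace Y := Y0.isClosed_topologicalClosure.completeSpace_coe
  have hmap : ∀ A : W1 →L[ℂ] W2, (∀ x ∈ X0, A x ∈ Y0) → ∀ x : X, (A.comp X.subtypeL) x ∈ Y := by
    intro A hA x
    have hx : (x : W1) ∈ closure (X0 : Set W1) := x.2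
    have h2 : A (x : W1) ∈ closure (Y0 : Set W2) := map_mem_closure A.continuous hx (fun y hy => hA y hy)
    exact h2
  let T0 : X →L[ℂ] Y := (A0.comp X.subtypeL).codRestrict Y (hmap A0 hA0)
  let T1 : X →L[ℂ] Y := (A1.comp X.subtypeL).codRestrict Y (hmap A1 hA1)
  let J : F →L[ℂ] Y := ι.codRestrict Y (fun φ => Y0.le_topologicalClosure (hι φ))
  let T : ℂ → X →L[ℂ] Y := fun z => T0 + z • T1
  have hTc : ∀ z x, ((T z x : Y) : W2) = A0 x + z • A1 x := fun z x => rfl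
  have hJc : ∀ φ, ((J φ : Y) : W2) = ι φ := fun φ => rfl
  have hTcont : Continuous T := by fun_prop
  have hbd : ∀ z ∈ G, ∃ c, 0 ≤ c ∧ ∀ x : X, ‖x‖ ≤ c * ‖T z x‖ := by
    intro z hz
    obtain ⟨c, hc, h⟩ := hest z hz
    refine ⟨c, hc, fun x => ?_⟩
    have hx : (x : W1) ∈ closure (X0 : Set W1) := x.2
    have hcl : IsClosed {x : W1 | ‖x‖ ≤ c * ‖A0 x + z • A1 x‖} :=
      isClosed_le (by fun_prop) (by fun_prop)
    exact closure_minimal (s := (X0 : Set W1)) h hcl hx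
  have hinj : ∀ z ∈ G, ∀ x, T z x = 0 → x = 0 := by
    intro z hz x hx
    obtain ⟨c, hc, h⟩ := hbd z hz
    have := h x
    rw [hx, norm_zero, mul_zero] at this
    exact norm_le_zero_iff.1 this
  have hsurj : ∀ z ∈ G, ∀ y, ∃ x φ, T z x + J φ = y := by
    intro z hz y
    obtain ⟨c, hc, h⟩ := hbd z hz
    have hclr : IsClosed ((T z).range : Set Y) := by
      have ha : AntilipschitzWith ⟨c, hc⟩ (T z) := (T z).antilipschitz_of_bound h
      have := ha.isClosed_range (T z).uniformContinuous
      have e : ((T z).range : Set Y) = Set.range (T z) := by ext; simp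
      rw [e]
      exact this
    have hcl : IsClosed (((T z).range ⊔ J.range : Submodule ℂ Y) : Set Y) :=
      Submodule.isClosed_sup_finiteDimensional _ _ hclr
    have hmem : y ∈ (T z).range ⊔ J.range := by
      have hd : closure (Subtype.val ⁻¹' (Y0 : Set W2) : Set Y) = Set.univ := by
        rw [Set.eq_univ_iff_forall]
        intro y
        rw [closure_subtype]
        have : ((Subtype.val : Y → W2) '' (Subtype.val ⁻¹' (Y0 : Set W2))) = (Y0 : Set W2) := by
          ext w
          constructor
          · rintro ⟨y, hy, rfl⟩
            exact hy
          · intro hw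
            exact ⟨⟨w, Y0.le_topologicalClosure hw⟩, hw, rfl⟩
        rw [this]
        exact y.2
      have hsub : (Subtype.val ⁻¹' (Y0 : Set W2) : Set Y) ⊆ (((T z).range ⊔ J.range : Submodule ℂ Y) : Set Y) := by
        intro y hy
        obtain ⟨x, hx, φ, e⟩ := hs z hz y hy
        refine Submodule.mem_sup.2 ⟨T z ⟨x, X0.le_topologicalClosure hx⟩, ⟨_, rfl⟩, J φ, ⟨_, rfl⟩, ?_⟩
        exact Subtype.ext e
      have := closure_minimal hsub hcl
      rw [hd] at this
      exact this (Set.mem_univ y)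
    obtain ⟨_, ⟨x, rfl⟩, _, ⟨φ, rfl⟩, e⟩ := Submodule.mem_sup.1 hmem
    exact ⟨x, φ, e⟩
  have hidx := index_const T hTcont J G hG hinj hsurj z0 hz0 (fun x φ e => h0 x x.2 φ (congrArg Subtype.val e))
  intro z hz
  let Φ : (X × F) →L[ℂ] Y := (T z).coprod J
  have hk : Φ.ker = ⊥ := by
    rw [LinearMap.ker_eq_bot']
    rintro ⟨x, φ⟩ e
    have e' : T z x + J φ = 0 := e
    have hφ := hidx z hz x φ e'
    rw [hφ, map_zero, add_zero] at e'
    rw [hφ, hinj z hz x e']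
    rfl
  have hr : Φ.range = ⊤ := by
    rw [LinearMap.range_eq_top]
    intro y
    obtain ⟨x, φ, e⟩ := hsurj z hz y
    exact ⟨(x, φ), e⟩
  let E := ContinuousLinearEquiv.ofBijective Φ hk hr
  refine ⟨‖(E.symm : Y →L[ℂ] X × F)‖, norm_nonneg _, fun x hx φ => ?_⟩
  let x' : X := ⟨x, X0.le_topologicalClosure hx⟩
  have h1 : E.symm (Φ (x', φ)) = (x', φ) := ContinuousLinearEquiv.ofBijective_symm_apply_apply Φ hk hr _
  have h2 : ‖(x', φ)‖ ≤ ‖(E.symm : Y →L[ℂ] X × F)‖ * ‖Φ (x', φ)‖ := by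
    have := (E.symm : Y →L[ℂ] X × F).le_opNorm (Φ (x', φ))
    rwa [ContinuousLinearEquiv.coe_coe, h1] at this
  have h3 : ‖Φ (x', φ)‖ = ‖A0 x + z • A1 x + ι φ‖ := rfl
  rw [h3] at h2
  exact ⟨(norm_fst_le (x', φ)).trans h2, (norm_snd_le (x', φ)).trans h2⟩

section Banach

variable {S : ℕ} {V : Type*} [NormedAddCommGroup V] [NormedSpace ℂ V] [FiniteDimensional ℂ V]

theorem bad_finite (L : V →L[ℂ] V) (s k : ℕ) (hs : 1 ≤ s) :
    {z : ℂ | ∃ v, v ≠ 0 ∧ L v + z • ((s : ℂ) • v - L v) + (k : ℂ) • v = 0}.Finite := by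
  have hsk : (s : ℂ) + k ≠ 0 := by
    norm_cast
    omega
  have h1 : ∀ z ∈ {z : ℂ | ∃ v, v ≠ 0 ∧ L v + z • ((s : ℂ) • v - L v) + (k : ℂ) • v = 0}, z ≠ 1 := by
    rintro _ ⟨v, hv, e⟩ rfl
    apply hv
    have : ((s : ℂ) + k) • v = 0 := by
      rw [← e]; module
    exact (smul_eq_zero.1 this).resolve_left hsk
  have hfin := Module.End.finite_hasEigenvalue (L.toLinearMap : Module.End ℂ V)
  refine Set.Finite.of_injOn (f := fun z : ℂ => (z * s + k) / (z - 1)) ?_ ?_ hfin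
  · rintro z hz
    have hz1 := sub_ne_zero.2 (h1 z hz)
    obtain ⟨v, hv, e⟩ := hz
    refine Module.End.hasEigenvalue_of_hasEigenvector (x := v) ⟨?_, hv⟩
    rw [Module.End.mem_eigenspace_iff]
    have : (z - 1) • L v = (z * s + k) • v := by
      rw [← sub_eq_zero, ← neg_eq_zero, ← e]; module
    change L v = ((z * s + k) / (z - 1)) • v
    rw [div_eq_inv_mul, mul_smul, ← this, smul_smul, inv_mul_cancel₀ hz1, one_smul]
  · intro z hz z' hz' e
    have hz1 := sub_ne_zero.2 (h1 z hz)
    have hz1' := sub_ne_zero.2 (h1 z' hz')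
    simp only at e
    rw [div_eq_div_iff hz1 hz1'] at e
    have : ((s : ℂ) + k) * (z - z') = 0 := by linear_combination - e
    exact sub_eq_zero.1 ((mul_eq_zero.1 this).resolve_left hsk)

/-- the deformation -/
noncomputable def Bz (B : Fin (S + 2) → V →L[ℂ] V) (z : ℂ) (j : Fin (S + 2)) : V →L[ℂ] V :=
  B j + z • (1 - B j)

theorem sum_Bz (B : Fin (S + 2) → V →L[ℂ] V) (z : ℂ) (v : V) :
    (∑ j, Bz B z j) v = (∑ j, B j) v + z • (((S + 2 : ℕ) : ℂ) • v - (∑ j, B j) v) := by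
  simp only [Bz, ContinuousLinearMap.sum_apply, ContinuousLinearMap.add_apply, ContinuousLinearMap.smul_apply,
    ContinuousLinearMap.sub_apply, ContinuousLinearMap.one_apply, Finset.sum_add_distrib, ← Finset.smul_sum,
    Finset.sum_sub_distrib, Finset.sum_const, Finset.card_univ, Fintype.card_fin, Nat.cast_smul_eq_nsmul]

theorem good_preconn (B : Fin (S + 2) → V →L[ℂ] V) : IsPreconnected {z | NR (Bz B z)} := by
  have hc : {z | NR (Bz B z)}ᶜ.Countable := by
    have hcount : ((⋃ j, ⋃ k : ℕ, {z : ℂ | ∃ v, v ≠ 0 ∧ B j v + z • (((1 : ℕ) : ℂ) • v - B j v) + (k : ℂ) • v = 0}) ∪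
      ⋃ k : ℕ, {z : ℂ | ∃ v, v ≠ 0 ∧ (∑ j, B j) v + z • (((S + 2 : ℕ) : ℂ) • v - (∑ j, B j) v) + (k : ℂ) • v = 0}).Countable := by
      refine Set.Countable.union ?_ ?_
      · exact Set.countable_iUnion fun j => Set.countable_iUnion fun k => (bad_finite (B j) 1 k le_rfl).countable
      · exact Set.countable_iUnion fun k => (bad_finite (∑ j, B j) (S + 2) k (by omega)).countable
    refine hcount.mono ?_
    intro z hz
    by_contra hcon
    apply hz
    simp only [Set.mem_union, Set.mem_iUnion, not_or, not_exists, Set.mem_setOf_eq] at hcon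
    refine ⟨fun j k v e => ?_, fun k v e => ?_⟩
    · by_contra hv
      refine hcon.1 j k v ⟨hv, ?_⟩
      rw [← e]
      simp [Bz]
    · by_contra hv
      refine hcon.2 k v ⟨hv, ?_⟩
      rw [← e, sum_Bz]
  have := hc.isConnected_compl_of_one_lt_rank (by rw [Complex.rank_real_complex]; norm_num)
  rw [compl_compl] at this
  exact this.isPreconnected

theorem good_zero (B : Fin (S + 2) → V →L[ℂ] V) (hB : NR B) : NR (Bz B 0) := by
  have : Bz B 0 = B := by ext j; simp [Bz]
  rwa [this]

theorem good_one (B : Fin (S + 2) → V →L[ℂ] V) : NR (Bz B 1) := by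
  refine ⟨fun j k v e => ?_, fun k v e => ?_⟩
  · have e' : (((1 + k : ℕ)) : ℂ) • v = 0 := by
      rw [← e]; simp [Bz, add_smul]
    exact (smul_eq_zero.1 e').resolve_left (by norm_cast; omega)
  · have e' : (((S + 2 + k : ℕ)) : ℂ) • v = 0 := by
      rw [← e, sum_Bz]; push_cast; module
    exact (smul_eq_zero.1 e').resolve_left (by norm_cast; omega)

theorem Cf_Bz (p : Fin (S + 2) → ℂ) (B : Fin (S + 2) → V →L[ℂ] V) (z x : ℂ) :
    Cf p (Bz B z) x = Cf p B x + z • Cf p (fun j => 1 - B j) x := by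
  simp only [Cf, Bz, smul_add, Finset.sum_add_distrib, Finset.smul_sum]
  congr 1
  exact Finset.sum_congr rfl fun j _ => smul_comm _ _ _

theorem Qf_deriv (p : Fin (S + 2) → ℂ) (x : ℂ) : HasDerivAt (Qf p) (∑ j, qf p j x) x := by
  have := HasDerivAt.fun_finset_prod (u := Finset.univ) (f := fun j x => x - p j) (f' := fun _ => (1 : ℂ)) (x := x)
    (fun j _ => (hasDerivAt_id x).sub_const (p j))
  simp only [smul_eq_mul, mul_one] at this
  exact this

/-- primitive of `lowPoly` -/
noncomputable def primPoly (φ : Fin (S + 1) → V) (x : ℂ) : V :=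
  ∑ i : Fin (S + 1), x ^ ((i : ℕ) + 1) • (((i : ℕ) + 1 : ℂ)⁻¹ • φ i)

theorem primPoly_deriv (φ : Fin (S + 1) → V) (x : ℂ) : HasDerivAt (primPoly φ) (lowPoly φ x) x := by
  unfold primPoly lowPoly
  refine HasDerivAt.fun_sum fun i _ => ?_
  convert (hasDerivAt_pow ((i : ℕ) + 1) x).smul_const (((i : ℕ) + 1 : ℂ)⁻¹ • φ i) using 1
  have : ((i : ℕ) + 1 : ℂ) ≠ 0 := by exact_mod_cast Nat.succ_ne_zero (i : ℕ)
  rw [smul_smul]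
  congr 1
  push_cast
  field_simp

theorem primPoly_zero (p : Fin (S + 2) → ℂ) (hp : Function.Injective p) (φ : Fin (S + 1) → V)
    (h : ∀ j, primPoly φ (p j) = primPoly φ (p 0)) : φ = 0 := by
  ext i
  rw [Pi.zero_apply]
  rw [NormedSpace.eq_zero_iff_forall_dual_eq_zero ℂ]
  intro l
  let P : Polynomial ℂ := (∑ i : Fin (S + 1), Polynomial.monomial ((i : ℕ) + 1) (((i : ℕ) + 1 : ℂ)⁻¹ * l (φ i)))
    - Polynomial.C (l (primPoly φ (p 0)))
  have hev : ∀ x, P.eval x = l (primPoly φ x) - l (primPoly φ (p 0)) := by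
    intro x
    simp only [P, Polynomial.eval_sub, Polynomial.eval_C, Polynomial.eval_finset_sum, Polynomial.eval_monomial,
      primPoly, map_sum, map_smul, smul_eq_mul]
    congr 1
    exact Finset.sum_congr rfl fun i _ => by ring
  have hdeg : P.natDegree < Fintype.card (Fin (S + 2)) := by
    rw [Fintype.card_fin]
    refine Nat.lt_succ_of_le ((Polynomial.natDegree_sub_le _ _).trans ?_)
    rw [Polynomial.natDegree_C, Nat.max_zero]
    refine Polynomial.natDegree_sum_le_of_forall_le _ _ fun i _ => ?_
    exact (Polynomial.natDegree_monomial_le _).trans (by omega)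
  have hP : P = 0 := Polynomial.eq_zero_of_natDegree_lt_card_of_eval_eq_zero P hp
    (fun j => by rw [hev, h j, sub_self]) hdeg
  have hc : P.coeff ((i : ℕ) + 1) = ((i : ℕ) + 1 : ℂ)⁻¹ * l (φ i) := by
    simp only [P, Polynomial.coeff_sub, Polynomial.finset_sum_coeff, Polynomial.coeff_monomial,
      Polynomial.coeff_C_succ, sub_zero]
    rw [Finset.sum_eq_single i]
    · simp
    · intro j _ hj
      rw [if_neg]
      intro e
      exact hj (Fin.ext (by omega))
    · simp
  rw [hP, Polynomial.coeff_zero] at hc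
  have : ((i : ℕ) + 1 : ℂ) ≠ 0 := by exact_mod_cast Nat.succ_ne_zero (i : ℕ)
  exact (mul_eq_zero.1 hc.symm).resolve_left (inv_ne_zero this)

/-- multiplication operator on continuous functions -/
noncomputable def mop {K : Set ℂ} [CompactSpace K] (a : ℂ → V →L[ℂ] V) (ha : Continuous a) : C(K, V) →L[ℂ] C(K, V) :=
  LinearMap.mkContinuous
    { toFun := fun f => ⟨fun x => a x (f x), by fun_prop⟩
      map_add' := fun f g => by ext x; simp
      map_smul' := fun c f => by ext x; simp }
    ‖(⟨fun x => a x, by fun_prop⟩ : C(K, V →L[ℂ] V))‖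
    (fun f => by
      refine (ContinuousMap.norm_le _ (by positivity)).2 fun x => ?_
      refine ((a x).le_opNorm (f x)).trans ?_
      gcongr
      · exact ContinuousMap.norm_coe_le_norm (⟨fun x => a x, by fun_prop⟩ : C(K, V →L[ℂ] V)) x
      · exact f.norm_coe_le_norm x)

theorem mop_apply {K : Set ℂ} [CompactSpace K] (a : ℂ → V →L[ℂ] V) (ha : Continuous a) (f : C(K, V)) (x : K) :
    mop a ha f x = a x (f x) := rfl

/-- restriction of polynomial functions -/
noncomputable def resL (V : Type*) [NormedAddCommGroup V] [NormedSpace ℂ V] (K : Set ℂ) : PF V →ₗ[ℂ] C(K, V) where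
  toFun h := ⟨fun x => h.1 x, (PF_diff h.2).continuous.comp continuous_subtype_val⟩
  map_add' f g := by ext x; rfl
  map_smul' c f := by ext x; rfl

/-- restriction of polynomial functions and their derivative -/
noncomputable def jetL (V : Type*) [NormedAddCommGroup V] [NormedSpace ℂ V] (K : Set ℂ) :
    PF V →ₗ[ℂ] C(K, V) × C(K, V) where
  toFun h := (resL V K h, resL V K ⟨deriv h.1, PF_deriv h.2⟩)
  map_add' f g := by
    refine Prod.ext (map_add _ _ _) ?_
    ext x
    exact deriv_add (PF_diff f.2 x) (PF_diff g.2 x)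
  map_smul' c f := by
    refine Prod.ext (map_smul _ _ _) ?_
    ext x
    exact deriv_const_smul c (PF_diff f.2 x)

theorem poly_est (p : Fin (S + 2) → ℂ) (hp : Function.Injective p) (K : Set ℂ) (hK : IsCompact K)
    (hpK : ∀ j, p j ∈ K) (hO : EstO V p K)
    (hE : ∀ B : Fin (S + 2) → V →L[ℂ] V, NR B → ∃ c : ℝ, 0 ≤ c ∧ ∀ h : ℂ → V, Differentiable ℂ h → ∀ M : ℝ,
        (∀ x ∈ K, ‖Qf p x • deriv h x + Cf p B x (h x)‖ ≤ M) → ∀ x ∈ K, ‖h x‖ ≤ c * M ∧ ‖deriv h x‖ ≤ c * M)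
    (B : Fin (S + 2) → V →L[ℂ] V) (hB : NR B) :
    ∃ c : ℝ, 0 ≤ c ∧ ∀ h ∈ PF V, ∀ φ : Fin (S + 1) → V, ∀ M : ℝ, (∀ x ∈ K, ‖TT p B h x + lowPoly φ x‖ ≤ M) →
      (∀ x ∈ K, ‖h x‖ ≤ c * M ∧ ‖deriv h x‖ ≤ c * M) ∧ ‖φ‖ ≤ c * M := by
  have : CompactSpace K := isCompact_iff_compactSpace.1 hK
  have : CompleteSpace V := FiniteDimensional.complete ℂ V
  have hQc : Continuous (fun x => Qf p x • (1 : V →L[ℂ] V)) := (Qf_diff p).continuous.smul continuous_const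
  let C1 : Fin (S + 2) → V →L[ℂ] V := fun j => 1 - B j
  let A0 : (C(K, V) × C(K, V)) →L[ℂ] C(K, V) :=
    (mop _ hQc).comp (ContinuousLinearMap.snd ℂ _ _) + (mop _ (Cf_diff p B).continuous).comp (ContinuousLinearMap.fst ℂ _ _)
  let A1 : (C(K, V) × C(K, V)) →L[ℂ] C(K, V) := (mop _ (Cf_diff p C1).continuous).comp (ContinuousLinearMap.fst ℂ _ _)
  let ι0 : (Fin (S + 1) → V) →ₗ[ℂ] C(K, V) :=
    { toFun := fun φ => resL V K ⟨lowPoly φ, lowPoly_mem φ⟩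
      map_add' := fun φ ψ => by
        ext x
        change lowPoly (φ + ψ) (x : ℂ) = lowPoly φ (x : ℂ) + lowPoly ψ (x : ℂ)
        simp [lowPoly, smul_add, Finset.sum_add_distrib]
      map_smul' := fun c φ => by
        ext x
        change lowPoly (c • φ) (x : ℂ) = c • lowPoly φ (x : ℂ)
        simp only [lowPoly, Pi.smul_apply, Finset.smul_sum]
        exact Finset.sum_congr rfl fun i _ => smul_comm _ _ _ }
  let ι : (Fin (S + 1) → V) →L[ℂ] C(K, V) := LinearMap.toContinuousLinearMap ι0
  have hιv : ∀ φ (x : K), ι φ x = lowPoly φ x := fun φ x => rfl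
  have hA : ∀ z (h : PF V) (x : K), (A0 (jetL V K h) + z • A1 (jetL V K h)) x = TT p (Bz B z) h.1 x := by
    intro z h x
    change Qf p x • deriv h.1 x + Cf p B x (h.1 x) + z • Cf p C1 x (h.1 x) = Qf p x • deriv h.1 x + Cf p (Bz B z) x (h.1 x)
    rw [Cf_Bz]
    simp only [ContinuousLinearMap.add_apply, ContinuousLinearMap.smul_apply, C1]
    abel
  have hA0 : ∀ h : PF V, A0 (jetL V K h) = resL V K ⟨TT p B h.1, TT_mem_PF p B h.2⟩ := fun h => by ext x; rfl
  have hA1 : ∀ h : PF V, A1 (jetL V K h) ∈ (resL V K).range := by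
    intro h
    refine ⟨⟨TT p (Bz B 1) h.1 - TT p B h.1, sub_mem (TT_mem_PF p _ h.2) (TT_mem_PF p B h.2)⟩, ?_⟩
    ext x
    have := hA 1 h x
    rw [one_smul, ContinuousMap.add_apply, hA0] at this
    change TT p (Bz B 1) h.1 x - TT p B h.1 x = _
    rw [← this]
    change TT p B h.1 x + _ - TT p B h.1 x = _
    abel
  have main := abs_index (jetL V K).range (resL V K).range A0 A1 ι
    (by rintro _ ⟨h, rfl⟩; rw [hA0]; exact ⟨_, rfl⟩) (by rintro _ ⟨h, rfl⟩; exact hA1 h)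
    (fun φ => ⟨⟨lowPoly φ, lowPoly_mem φ⟩, rfl⟩) {z | NR (Bz B z)} (good_preconn B) ?_ ?_ 1 (good_one B) ?_
    0 (good_zero B hB)
  · obtain ⟨c, hc, h⟩ := main
    refine ⟨c, hc, fun k hk φ M hM => ?_⟩
    have hM0 : 0 ≤ M := (norm_nonneg _).trans (hM _ (hpK 0))
    have h1 := h (jetL V K ⟨k, hk⟩) ⟨_, rfl⟩ φ
    have h2 : ‖A0 (jetL V K ⟨k, hk⟩) + (0 : ℂ) • A1 (jetL V K ⟨k, hk⟩) + ι φ‖ ≤ M := by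
      refine (ContinuousMap.norm_le _ hM0).2 fun x => ?_
      rw [zero_smul, add_zero, hA0]
      exact hM x x.2
    have h3 := h1.1.trans (mul_le_mul_of_nonneg_left h2 hc)
    have h4 := h1.2.trans (mul_le_mul_of_nonneg_left h2 hc)
    refine ⟨fun x hx => ⟨?_, ?_⟩, h4⟩
    · have := (norm_fst_le (jetL V K ⟨k, hk⟩)).trans h3
      exact ((jetL V K ⟨k, hk⟩).1.norm_coe_le_norm ⟨x, hx⟩).trans this
    · have := (norm_snd_le (jetL V K ⟨k, hk⟩)).trans h3
      exact ((jetL V K ⟨k, hk⟩).2.norm_coe_le_norm ⟨x, hx⟩).trans this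
  · intro z hz
    obtain ⟨c, hc, h⟩ := hE (Bz B z) hz
    refine ⟨c, hc, ?_⟩
    rintro _ ⟨k, rfl⟩
    have h1 := h k.1 (PF_diff k.2) ‖A0 (jetL V K k) + z • A1 (jetL V K k)‖ (fun x hx => by
      have := (A0 (jetL V K k) + z • A1 (jetL V K k)).norm_coe_le_norm ⟨x, hx⟩
      rw [hA] at this
      exact this)
    refine max_le ?_ ?_
    · exact (ContinuousMap.norm_le _ (by positivity)).2 fun x => (h1 x x.2).1
    · exact (ContinuousMap.norm_le _ (by positivity)).2 fun x => (h1 x x.2).2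
  · rintro z hz _ ⟨y, rfl⟩
    obtain ⟨k, hk, φ, e⟩ := poly_solve p (Bz B z) hz y.2
    refine ⟨_, ⟨⟨k, hk⟩, rfl⟩, φ, ?_⟩
    ext x
    rw [ContinuousMap.add_apply, hA, hιv]
    change _ = y.1 x
    rw [e]
    rfl
  · intro x hx φ e
    obtain ⟨c, hc, h⟩ := hO
    refine primPoly_zero p hp φ fun j => ?_
    have hcl : IsClosed {x : C(K, V) × C(K, V) | ‖primPoly φ (p j) - primPoly φ (p 0)‖ ≤ c * ‖A0 x + (1 : ℂ) • A1 x + ι φ‖} :=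
      isClosed_le (by fun_prop) (by fun_prop)
    have hsub : ((jetL V K).range : Set (C(K, V) × C(K, V))) ⊆
        {x : C(K, V) × C(K, V) | ‖primPoly φ (p j) - primPoly φ (p 0)‖ ≤ c * ‖A0 x + (1 : ℂ) • A1 x + ι φ‖} := by
      rintro _ ⟨k, rfl⟩
      have hd : ∀ x, HasDerivAt (fun x => Qf p x • k.1 x + (primPoly φ x - primPoly φ (p 0)))
          (TT p (Bz B 1) k.1 x + lowPoly φ x) x := by
        intro x
        have h1 := ((Qf_deriv p x).smul (PF_diff k.2 x).hasDerivAt).add ((primPoly_deriv φ x).sub_const (primPoly φ (p 0)))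
        refine HasDerivAt.congr_deriv h1 ?_
        have : Cf p (Bz B 1) x (k.1 x) = (∑ j, qf p j x) • k.1 x := by
          simp [Cf, Bz, Finset.sum_smul]
        unfold TT
        rw [this]
      have hz : ∀ j, Qf p (p j) = 0 := fun j => by rw [Qf_eq p j, sub_self, zero_mul]
      have := h (fun x => Qf p x • k.1 x + (primPoly φ x - primPoly φ (p 0))) (fun x => (hd x).differentiableAt)
        (by simp only [hz, zero_smul, sub_self, add_zero]) ‖A0 (jetL V K k) + (1 : ℂ) • A1 (jetL V K k) + ι φ‖
        (fun x hx => by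
          rw [(hd x).deriv]
          have := (A0 (jetL V K k) + (1 : ℂ) • A1 (jetL V K k) + ι φ).norm_coe_le_norm ⟨x, hx⟩
          rw [ContinuousMap.add_apply, hA, hιv] at this
          exact this) (p j) (hpK j)
      simp only [hz, zero_smul, zero_add] at this
      exact this
    have := closure_minimal hsub hcl hx
    rw [Set.mem_setOf_eq, e, norm_zero, mul_zero] at this
    exact sub_eq_zero.1 (norm_le_zero_iff.1 this)

end Banach

section LinThm

variable {S : ℕ} {V : Type*} [NormedAddCommGroup V] [NormedSpace ℂ V] [FiniteDimensional ℂ V]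

theorem eval_smul_mem_PF (P : Polynomial ℂ) (v : V) : (fun x : ℂ => P.eval x • v) ∈ PF V := by
  have : (fun x : ℂ => P.eval x • v) = ∑ i ∈ Finset.range (P.natDegree + 1), P.coeff i • fun x : ℂ => x ^ i • v := by
    ext x
    simp only [Finset.sum_apply, Pi.smul_apply, smul_smul]
    rw [Polynomial.eval_eq_sum_range, Finset.sum_smul]
  rw [this]
  exact sum_mem fun i _ => Submodule.smul_mem _ _ (mono_mem_PF i v)

theorem rungeV (D : Set ℂ) (hD : IsOpen D) (hDsc : SimplyConnectedSpace D) (K : Set ℂ) (hK : IsCompact K) (hKD : K ⊆ D)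
    (g : ℂ → V) (hg : DifferentiableOn ℂ g D) (ε : ℝ) (hε : 0 < ε) : ∃ P ∈ PF V, ∀ z ∈ K, ‖g z - P z‖ < ε := by
  let b := Module.finBasis ℂ V
  let M := ∑ i, ‖b i‖
  have hM : 0 ≤ M := by positivity
  have hδ : 0 < ε / (M + 1) := by positivity
  have hc : ∀ i, DifferentiableOn ℂ (fun x => b.coord i (g x)) D := by
    intro i
    exact (LinearMap.toContinuousLinearMap (b.coord i)).differentiable.comp_differentiableOn hg
  choose P hP using fun i => runge D hD hDsc K hK hKD _ (hc i) _ hδ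
  refine ⟨∑ i, fun x => (P i).eval x • b i, sum_mem fun i _ => eval_smul_mem_PF _ _, fun z hz => ?_⟩
  have e : g z - (∑ i, fun x => (P i).eval x • b i) z = ∑ i, (b.coord i (g z) - (P i).eval z) • b i := by
    simp only [Finset.sum_apply, sub_smul, Finset.sum_sub_distrib]
    congr 1
    exact (b.sum_repr (g z)).symm
  rw [e]
  calc ‖∑ i, (b.coord i (g z) - (P i).eval z) • b i‖ ≤ ∑ i, ε / (M + 1) * ‖b i‖ := by
        refine (norm_sum_le _ _).trans (Finset.sum_le_sum fun i _ => ?_)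
        rw [norm_smul]
        gcongr
        exact (hP i z hz).le
    _ = ε / (M + 1) * M := by rw [← Finset.mul_sum]
    _ < ε := by
        rw [div_mul_eq_mul_div, div_lt_iff₀ (by positivity)]
        nlinarith

theorem runge_seq (D : Set ℂ) (hD : IsOpen D) (hDsc : SimplyConnectedSpace D)
    (g : ℂ → V) (hg : DifferentiableOn ℂ g D) :
    ∃ P : ℕ → ℂ → V, (∀ n, P n ∈ PF V) ∧ TendstoLocallyUniformlyOn P g atTop D := by
  have : LocallyCompactSpace D := hD.locallyCompactSpace
  let E : CompactExhaustion D := default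
  choose P hP using fun n => rungeV D hD hDsc (Subtype.val '' E n) ((E.isCompact n).image continuous_subtype_val)
    (by rintro _ ⟨x, _, rfl⟩; exact x.2) g hg (1 / ((n : ℝ) + 1)) (by positivity)
  refine ⟨P, fun n => (hP n).1, ?_⟩
  rw [tendstoLocallyUniformlyOn_iff_forall_isCompact hD]
  intro K hKD hK
  have hK' : IsCompact (Subtype.val ⁻¹' K : Set D) := by
    rw [Subtype.isCompact_iff, Subtype.image_preimage_coe, Set.inter_eq_right.2 hKD]
    exact hK
  obtain ⟨N, hN⟩ := E.exists_superset_of_isCompact hK'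
  rw [Metric.tendstoUniformlyOn_iff]
  intro ε hε
  obtain ⟨N', hN'⟩ := exists_nat_one_div_lt hε
  filter_upwards [eventually_ge_atTop N, eventually_ge_atTop N'] with n hn hn' x hx
  rw [dist_eq_norm]
  have h1 := (hP n).2 x ⟨⟨x, hKD hx⟩, E.subset hn (hN hx), rfl⟩
  refine h1.trans (lt_of_le_of_lt ?_ hN')
  gcongr

theorem exists_est (p : Fin (S + 2) → ℂ) (hp : Function.Injective p) (D : Set ℂ) (hD : IsOpen D) (hDc : IsPreconnected D)
    (hpD : ∀ j, p j ∈ D) (B : Fin (S + 2) → V →L[ℂ] V) (hB : NR B) (K : Set ℂ) (hK : IsCompact K) (hKD : K ⊆ D) :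
    ∃ K', K ⊆ K' ∧ IsCompact K' ∧ K' ⊆ D ∧ ∃ c : ℝ, 0 ≤ c ∧ ∀ h ∈ PF V, ∀ φ : Fin (S + 1) → V, ∀ M : ℝ,
      (∀ x ∈ K', ‖TT p B h x + lowPoly φ x‖ ≤ M) → (∀ x ∈ K', ‖h x‖ ≤ c * M) ∧ ‖φ‖ ≤ c * M := by
  obtain ⟨K', h1, h2, h3, h4, h5, h6⟩ := exists_adm' (V := V) p hp D hD hDc hpD K hK hKD
  obtain ⟨c, hc, h⟩ := poly_est p hp K' h2 h4 h5 h6 B hB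
  refine ⟨K', h1, h2, h3, c, hc, fun k hk φ M hM => ?_⟩
  exact ⟨fun x hx => ((h k hk φ M hM).1 x hx).1, (h k hk φ M hM).2⟩

theorem Lin_unique (p : Fin (S + 2) → ℂ) (hp : Function.Injective p) (D : Set ℂ) (hD : IsOpen D) (hDc : IsPreconnected D)
    (hDsc : SimplyConnectedSpace D)
    (hpD : ∀ j, p j ∈ D) (B : Fin (S + 2) → V →L[ℂ] V) (hB : NR B) (h : ℂ → V) (hh : DifferentiableOn ℂ h D)
    (φ : Fin (S + 1) → V) (e : ∀ x ∈ D, TT p B h x + lowPoly φ x = 0) : φ = 0 ∧ ∀ x ∈ D, h x = 0 := by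
  have : CompleteSpace V := FiniteDimensional.complete ℂ V
  obtain ⟨P, hP, hlim⟩ := runge_seq D hD hDsc h hh
  have hlim' : TendstoLocallyUniformlyOn (deriv ∘ P) (deriv h) atTop D :=
    hlim.deriv (Eventually.of_forall fun n => (PF_diff (hP n)).differentiableOn) hD
  have key : ∀ x ∈ D, h x = 0 ∧ φ = 0 := by
    intro x hx
    obtain ⟨K, hxK, hK, hKD, c, hc, hest⟩ := exists_est p hp D hD hDc hpD B hB {x} isCompact_singleton
      (Set.singleton_subset_iff.2 hx)
    have hxK' := hxK rfl
    obtain ⟨CQ, hCQ⟩ := hK.exists_bound_of_continuousOn (Qf_diff p).continuous.continuousOn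
    obtain ⟨CC, hCC⟩ := hK.exists_bound_of_continuousOn (Cf_diff p B).continuous.continuousOn
    have hCQ0 := (norm_nonneg _).trans (hCQ x hxK')
    have hCC0 := (norm_nonneg _).trans (hCC x hxK')
    have u1 := (tendstoLocallyUniformlyOn_iff_forall_isCompact hD).1 hlim K hKD hK
    have u2 := (tendstoLocallyUniformlyOn_iff_forall_isCompact hD).1 hlim' K hKD hK
    rw [Metric.tendstoUniformlyOn_iff] at u1 u2
    have hb : ∀ ε > 0, ‖h x‖ ≤ c * ((CQ + CC) * ε) + ε ∧ ‖φ‖ ≤ c * ((CQ + CC) * ε) + ε := by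
      intro ε hε
      obtain ⟨n, h1, h2⟩ := ((u1 ε hε).and (u2 ε hε)).exists
      have := hest (P n) (hP n) φ ((CQ + CC) * ε) (fun y hy => by
        have e1 : TT p B (P n) y + lowPoly φ y = Qf p y • (deriv (P n) y - deriv h y) + Cf p B y (P n y - h y) := by
          have := e y (hKD hy)
          rw [← sub_zero (TT p B (P n) y + lowPoly φ y), ← this]
          simp only [TT, map_sub, smul_sub]
          abel
        rw [e1, add_mul]
        refine (norm_add_le _ _).trans (add_le_add ?_ ?_)
        · rw [norm_smul]
          have := h2 y hy
          rw [dist_comm, dist_eq_norm] at this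
          exact mul_le_mul (hCQ y hy) this.le (norm_nonneg _) hCQ0
        · refine ((Cf p B y).le_opNorm _).trans ?_
          have := h1 y hy
          rw [dist_comm, dist_eq_norm] at this
          exact mul_le_mul (hCC y hy) this.le (norm_nonneg _) hCC0)
      constructor
      · have h3 := this.1 x hxK'
        have h4 := h1 x hxK'
        rw [dist_eq_norm] at h4
        have h5 : ‖h x‖ ≤ ‖h x - P n x‖ + ‖P n x‖ := by
          have := norm_add_le (h x - P n x) (P n x)
          rwa [sub_add_cancel] at this
        linarith
      · linarith [this.2]
    have ht : Tendsto (fun ε : ℝ => c * ((CQ + CC) * ε) + ε) (𝓝[>] 0) (𝓝 0) := by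
      have : Continuous (fun ε : ℝ => c * ((CQ + CC) * ε) + ε) := by fun_prop
      have := (this.tendsto 0).mono_left (nhdsWithin_le_nhds (s := Set.Ioi 0))
      simpa using this
    constructor
    · refine norm_le_zero_iff.1 (ge_of_tendsto ht ?_)
      filter_upwards [self_mem_nhdsWithin] with ε hε
      exact (hb ε hε).1
    · refine norm_le_zero_iff.1 (ge_of_tendsto ht ?_)
      filter_upwards [self_mem_nhdsWithin] with ε hε
      exact (hb ε hε).2
  exact ⟨(key _ (hpD 0)).2, fun x hx => (key x hx).1⟩

theorem Lin_exists (p : Fin (S + 2) → ℂ) (hp : Function.Injective p) (D : Set ℂ) (hD : IsOpen D) (hDc : IsPreconnected D)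
    (hDsc : SimplyConnectedSpace D)
    (hpD : ∀ j, p j ∈ D) (B : Fin (S + 2) → V →L[ℂ] V) (hB : NR B) (g : ℂ → V) (hg : DifferentiableOn ℂ g D) :
    ∃ (φ : Fin (S + 1) → V) (h : ℂ → V), DifferentiableOn ℂ h D ∧ ∀ x ∈ D, TT p B h x + lowPoly φ x = g x := by
  have : CompleteSpace V := FiniteDimensional.complete ℂ V
  obtain ⟨P, hP, hlim⟩ := runge_seq D hD hDsc g hg
  choose h hh φ e using fun n => poly_solve p B hB (hP n)
  have hdiff : ∀ m n x, TT p B (h m - h n) x + lowPoly (φ m - φ n) x = P m x - P n x := by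
    intro m n x
    have e1 : deriv (h m - h n) x = deriv (h m) x - deriv (h n) x := deriv_sub (PF_diff (hh m) x) (PF_diff (hh n) x)
    have e2 : lowPoly (φ m - φ n) x = lowPoly (φ m) x - lowPoly (φ n) x := by
      simp [lowPoly, smul_sub]
    rw [e2, e m, e n]
    simp only [TT, e1, Pi.sub_apply, Pi.add_apply, map_sub, smul_sub]
    abel
  have cau : ∀ K, IsCompact K → K ⊆ D → ∀ ε > 0, ∃ N, ∀ m ≥ N, ∀ n ≥ N, (∀ x ∈ K, ‖h m x - h n x‖ < ε) ∧ ‖φ m - φ n‖ < ε := by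
    intro K hK hKD ε hε
    obtain ⟨K', hKK', hK', hK'D, c, hc, hest⟩ := exists_est p hp D hD hDc hpD B hB K hK hKD
    have u1 := (tendstoLocallyUniformlyOn_iff_forall_isCompact hD).1 hlim K' hK'D hK'
    have u2 := Metric.uniformCauchySeqOn_iff.1 u1.uniformCauchySeqOn (ε / (c + 1)) (by positivity)
    obtain ⟨N, hN⟩ := u2
    refine ⟨N, fun m hm n hn => ?_⟩
    have := hest (h m - h n) (sub_mem (hh m) (hh n)) (φ m - φ n) (ε / (c + 1)) (fun x hx => by
      rw [hdiff, ← dist_eq_norm]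
      exact (hN m hm n hn x hx).le)
    have hlt : c * (ε / (c + 1)) < ε := by
      rw [mul_div_assoc', div_lt_iff₀ (by positivity)]
      nlinarith
    exact ⟨fun x hx => (this.1 x (hKK' hx)).trans_lt hlt, this.2.trans_lt hlt⟩
  have hφ : CauchySeq φ := by
    rw [Metric.cauchySeq_iff]
    intro ε hε
    obtain ⟨N, hN⟩ := cau {p 0} isCompact_singleton (Set.singleton_subset_iff.2 (hpD 0)) ε hε
    exact ⟨N, fun m hm n hn => by rw [dist_eq_norm]; exact (hN m hm n hn).2⟩
  obtain ⟨φ', hφ'⟩ := cauchySeq_tendsto_of_complete hφ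
  have hx : ∀ x ∈ D, ∃ l, Tendsto (fun n => h n x) atTop (𝓝 l) := by
    intro x hx
    refine cauchySeq_tendsto_of_complete ?_
    rw [Metric.cauchySeq_iff]
    intro ε hε
    obtain ⟨N, hN⟩ := cau {x} isCompact_singleton (Set.singleton_subset_iff.2 hx) ε hε
    exact ⟨N, fun m hm n hn => by rw [dist_eq_norm]; exact (hN m hm n hn).1 x rfl⟩
  choose! h' hh' using hx
  have hloc : TendstoLocallyUniformlyOn h h' atTop D := by
    rw [tendstoLocallyUniformlyOn_iff_forall_isCompact hD]
    intro K hKD hK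
    refine UniformCauchySeqOn.tendstoUniformlyOn_of_tendsto ?_ (fun x hx => hh' x (hKD hx))
    rw [Metric.uniformCauchySeqOn_iff]
    intro ε hε
    obtain ⟨N, hN⟩ := cau K hK hKD ε hε
    exact ⟨N, fun m hm n hn x hx => by rw [dist_eq_norm]; exact (hN m hm n hn).1 x hx⟩
  have hloc' : TendstoLocallyUniformlyOn (deriv ∘ h) (deriv h') atTop D :=
    hloc.deriv (Eventually.of_forall fun n => (PF_diff (hh n)).differentiableOn) hD
  refine ⟨φ', h', hloc.differentiableOn (Eventually.of_forall fun n => (PF_diff (hh n)).differentiableOn) hD, fun x hx => ?_⟩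
  have l1 : Tendsto (fun n => TT p B (h n) x + lowPoly (φ n) x) atTop (𝓝 (TT p B h' x + lowPoly φ' x)) := by
    refine Tendsto.add (Tendsto.add ?_ ?_) ?_
    · exact (hloc'.tendsto_at hx).const_smul _
    · exact ((Cf p B x).continuous.tendsto _).comp (hh' x hx)
    · have : Continuous (fun φ : Fin (S + 1) → V => lowPoly φ x) := by unfold lowPoly; fun_prop
      exact (this.tendsto φ').comp hφ'
  have l2 : Tendsto (fun n => TT p B (h n) x + lowPoly (φ n) x) atTop (𝓝 (g x)) := by
    have := hlim.tendsto_at hx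
    refine this.congr fun n => ?_
    rw [e n]
    rfl
  exact tendsto_nhds_unique l1 l2

end LinThm

theorem common_eig {ι W : Type*} [Fintype ι] [AddCommGroup W] [Module ℂ W] [FiniteDimensional ℂ W]
    (T : ι → Module.End ℂ W) (hT : ∀ i j v, T i (T j v) = T j (T i v)) (N : Submodule ℂ W) (hN : N ≠ ⊥)
    (hinv : ∀ i, ∀ v ∈ N, T i v ∈ N) :
    ∃ v ∈ N, v ≠ 0 ∧ ∃ μ : ι → ℂ, ∀ i, T i v = μ i • v := by
  classical
  have key : ∀ s : Finset ι, ∃ N' ≤ N, N' ≠ ⊥ ∧ (∀ i, ∀ v ∈ N', T i v ∈ N') ∧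
      ∃ μ : ι → ℂ, ∀ i ∈ s, ∀ v ∈ N', T i v = μ i • v := by
    intro s
    induction s using Finset.induction_on with
    | empty => exact ⟨N, le_rfl, hN, hinv, 0, by simp⟩
    | insert a s ha ih =>
      obtain ⟨N', hle, hne, hi, μ, hμ⟩ := ih
      have : Nontrivial N' := Submodule.nontrivial_iff_ne_bot.2 hne
      obtain ⟨c, hc⟩ := Module.End.exists_eigenvalue ((T a).restrict (hi a) : Module.End ℂ N')
      obtain ⟨v, hv⟩ := hc.exists_hasEigenvector
      have hv1 : T a v = c • (v : W) := congrArg Subtype.val hv.apply_eq_smul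
      refine ⟨N' ⊓ (T a).eigenspace c, inf_le_left.trans hle, ?_, ?_, Function.update μ a c, ?_⟩
      · intro h
        have : (v : W) ∈ N' ⊓ (T a).eigenspace c := ⟨v.2, Module.End.mem_eigenspace_iff.2 hv1⟩
        rw [h, Submodule.mem_bot] at this
        exact hv.2 (Subtype.ext this)
      · rintro i v ⟨h1, h2⟩
        refine ⟨hi i v h1, Module.End.mem_eigenspace_iff.2 ?_⟩
        rw [hT, Module.End.mem_eigenspace_iff.1 h2, map_smul]
      · rintro i hi' v ⟨h1, h2⟩
        rcases Finset.mem_insert.1 hi' with rfl | h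
        · rw [Function.update_self]
          exact Module.End.mem_eigenspace_iff.1 h2
        · rw [Function.update_of_ne (by rintro rfl; exact ha h)]
          exact hμ i h v h1
  obtain ⟨N', hle, hne, -, μ, hμ⟩ := key Finset.univ
  obtain ⟨v, hv, hv0⟩ := Submodule.exists_mem_ne_zero_of_ne_bot hne
  exact ⟨v, hle hv, hv0, μ, fun i => hμ i (Finset.mem_univ i) v hv⟩

section Mult

variable {d : ℕ}

/-- multilinear maps -/
abbrev MM (d n : ℕ) := MultilinearMap ℂ (fun _ : Fin n => (Fin d → ℂ)) (Fin d → ℂ)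

/-- slot maps -/
noncomputable def slotMap (n : ℕ) (M : Matrix (Fin d) (Fin d) ℂ) (i j : Fin n) : (Fin d → ℂ) →ₗ[ℂ] (Fin d → ℂ) :=
  if j = i then M.mulVecLin else LinearMap.id

theorem slotMap_comm (n : ℕ) (M : Matrix (Fin d) (Fin d) ℂ) (i i' j : Fin n) (v : Fin d → ℂ) :
    slotMap n M i j (slotMap n M i' j v) = slotMap n M i' j (slotMap n M i j v) := by
  unfold slotMap
  split_ifs <;> rfl

/-- the operators -/
noncomputable def Tm (n : ℕ) (M : Matrix (Fin d) (Fin d) ℂ) : Option (Fin n) → Module.End ℂ (MM d n)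
  | none =>
    { toFun := fun f => M.mulVecLin.compMultilinearMap f
      map_add' := fun f g => by ext v : 1; simp
      map_smul' := fun c f => by ext v : 1; simp }
  | some i => MultilinearMap.compLinearMapₗ (slotMap n M i)

theorem Tm_none (n : ℕ) (M : Matrix (Fin d) (Fin d) ℂ) (f : MM d n) (v) : Tm n M none f v = M *ᵥ f v := rfl

theorem Tm_some (n : ℕ) (M : Matrix (Fin d) (Fin d) ℂ) (i) (f : MM d n) (v) :
    Tm n M (some i) f v = f (fun j => slotMap n M i j (v j)) := rfl

theorem Tm_comm (n : ℕ) (M : Matrix (Fin d) (Fin d) ℂ) (i j) (f : MM d n) :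
    Tm n M i (Tm n M j f) = Tm n M j (Tm n M i f) := by
  refine MultilinearMap.ext fun v => ?_
  rcases i with - | i <;> rcases j with - | j
  · rfl
  · rfl
  · rfl
  · simp only [Tm_some]
    congr 1
    ext k : 1
    exact slotMap_comm n M _ _ _ _

/-- the multilinear homological operator -/
noncomputable def Lm (n : ℕ) (M : Matrix (Fin d) (Fin d) ℂ) : Module.End ℂ (MM d n) :=
  (∑ i, Tm n M (some i)) - Tm n M none

theorem Lm_inj (n : ℕ) (hn : 2 ≤ n) (M : Matrix (Fin d) (Fin d) ℂ) (hM : NonlinearlyNonresonant d M) (k : ℕ)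
    (f : MM d n) (hf : Lm n M f + (k : ℂ) • f = 0) : f = 0 := by
  by_contra hne
  let N : Submodule ℂ (MM d n) := LinearMap.ker (Lm n M + (k : ℂ) • LinearMap.id)
  have hmem : ∀ g, g ∈ N ↔ Lm n M g + (k : ℂ) • g = 0 := fun g => LinearMap.mem_ker
  have hN : N ≠ ⊥ := by
    intro h
    have : f ∈ N := (hmem f).2 hf
    rw [h] at this
    exact hne this
  have hLc : ∀ i g, Lm n M (Tm n M i g) = Tm n M i (Lm n M g) := by
    intro i g
    simp only [Lm, LinearMap.sub_apply, LinearMap.sum_apply, map_sub, map_sum, Tm_comm n M _ i g]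
  obtain ⟨g, hg, hg0, μ, hμ⟩ := common_eig (Tm n M) (Tm_comm n M) N hN (by
    intro i g hg
    rw [hmem] at hg ⊢
    rw [hLc, ← map_smul, ← map_add, hg, map_zero])
  rw [hmem] at hg
  have hsum : (k : ℂ) + (∑ i, μ (some i)) - μ none = 0 := by
    have : ((k : ℂ) + (∑ i, μ (some i)) - μ none) • g = 0 := by
      rw [← hg]
      simp only [Lm, LinearMap.sub_apply, LinearMap.sum_apply, hμ, ← Finset.sum_smul]
      module
    exact (smul_eq_zero.1 this).resolve_right hg0
  obtain ⟨lam, hchar, hres⟩ := hM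
  have hroot : ∀ c : ℂ, (∃ v, v ≠ 0 ∧ M *ᵥ v = c • v) → ∃ i, c = lam i := by
    rintro c ⟨v, hv, e⟩
    have hev : Module.End.HasEigenvalue (M.mulVecLin : Module.End ℂ (Fin d → ℂ)) c :=
      Module.End.hasEigenvalue_of_hasEigenvector ⟨Module.End.mem_eigenspace_iff.2 e, hv⟩
    rw [Module.End.hasEigenvalue_iff_isRoot_charpoly] at hev
    have e2 : LinearMap.charpoly (M.mulVecLin) = M.charpoly := by
      rw [← Matrix.toLin'_apply', Matrix.charpoly_toLin']
    rw [e2, hchar, Polynomial.IsRoot, Polynomial.eval_prod, Finset.prod_eq_zero_iff] at hev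
    obtain ⟨i, -, hi⟩ := hev
    refine ⟨i, ?_⟩
    simpa [sub_eq_zero] using hi
  obtain ⟨i0, hi0⟩ := hroot (μ none) (by
    have : ∃ v, g v ≠ 0 := by
      by_contra hcon
      push Not at hcon
      exact hg0 (MultilinearMap.ext hcon)
    obtain ⟨v, hv⟩ := this
    refine ⟨g v, hv, ?_⟩
    rw [← Tm_none, hμ]
    rfl)
  have hr : ∀ i : Fin n, ∃ j, μ (some i) = lam j := by
    intro i
    refine hroot _ ?_
    by_contra hcon
    push Not at hcon
    let P : (Fin d → ℂ) →ₗ[ℂ] (Fin d → ℂ) := M.mulVecLin - μ (some i) • LinearMap.id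
    have hPi : Function.Injective P := by
      rw [← LinearMap.ker_eq_bot, LinearMap.ker_eq_bot']
      intro v hv
      by_contra hv0
      exact hcon v hv0 (sub_eq_zero.1 hv)
    have hPs : Function.Surjective P := LinearMap.surjective_of_injective hPi
    apply hg0
    refine MultilinearMap.ext fun v => ?_
    obtain ⟨u, hu⟩ := hPs (v i)
    have h1 : g (Function.update v i (P u)) = 0 := by
      have e1 := congrArg (fun F : MM d n => F (Function.update v i u)) (hμ (some i))
      simp only [Tm_some] at e1
      have e2 : (fun j => slotMap n M i j (Function.update v i u j)) = Function.update v i (M *ᵥ u) := by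
        ext j : 1
        by_cases hj : j = i
        · subst hj; simp [slotMap]
        · simp [slotMap, hj]
      rw [e2] at e1
      have e3 : P u = M *ᵥ u - μ (some i) • u := rfl
      rw [e3, MultilinearMap.map_update_sub, MultilinearMap.map_update_smul, e1]
      exact sub_self _
    rw [hu, Function.update_eq_self] at h1
    exact h1
  choose r hr using hr
  have hcnt : ∑ j, (Finset.univ.filter (fun i => r i = j)).card = n := by
    have := Finset.card_eq_sum_card_fiberwise (f := r) (s := Finset.univ) (t := Finset.univ) (by simp)
    rw [← this]
    simp
  refine hres k (fun j => (Finset.univ.filter (fun i => r i = j)).card) i0 (by rw [hcnt]; exact hn) ?_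
  rw [← hsum, hi0]
  congr 2
  simp only [hr]
  rw [← Finset.sum_fiberwise Finset.univ r (fun i => lam (r i))]
  refine Finset.sum_congr rfl fun j _ => ?_
  rw [Finset.sum_congr rfl (g := fun _ => lam j) (fun i hi => by rw [(Finset.mem_filter.1 hi).2])]
  rw [Finset.sum_const, nsmul_eq_mul]

end Mult

section VV

variable {d : ℕ}

/-- multi-indices of degree `n` -/
abbrev Idx (d n : ℕ) := ↥(Finset.piAntidiag (Finset.univ : Finset (Fin d)) n)

theorem Idx_sum {n : ℕ} (m : Idx d n) : ∑ i, m.1 i = n := (Finset.mem_piAntidiag.1 m.2).1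

/-- coefficients of homogeneous polynomial maps of degree `n` -/
abbrev VV (d n : ℕ) := Idx d n → Fin d → ℂ

/-- evaluation -/
noncomputable def evn (n : ℕ) (c : VV d n) (w : Fin d → ℂ) : Fin d → ℂ :=
  ∑ m : Idx d n, (∏ i, w i ^ m.1 i) • c m

theorem evn_add (n : ℕ) (c c' : VV d n) (w) : evn n (c + c') w = evn n c w + evn n c' w := by
  simp [evn, smul_add, Finset.sum_add_distrib]

theorem evn_smul (n : ℕ) (a : ℂ) (c : VV d n) (w) : evn n (a • c) w = a • evn n c w := by
  simp only [evn, Pi.smul_apply, Finset.smul_sum]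
  exact Finset.sum_congr rfl fun i _ => smul_comm _ _ _

/-- evaluation as a linear map -/
noncomputable def evL (n : ℕ) (w : Fin d → ℂ) : VV d n →ₗ[ℂ] (Fin d → ℂ) where
  toFun c := evn n c w
  map_add' c c' := evn_add n c c' w
  map_smul' a c := evn_smul n a c w

theorem evL_apply (n : ℕ) (w : Fin d → ℂ) (c : VV d n) : evL n w c = evn n c w := rfl

theorem evn_inj (n : ℕ) (c : VV d n) (h : ∀ w, evn n c w = 0) : c = 0 := by
  ext m a
  let P : MvPolynomial (Fin d) ℂ := ∑ m : Idx d n, MvPolynomial.monomial (Finsupp.equivFunOnFinite.symm m.1) (c m a)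
  have hev : ∀ w, MvPolynomial.eval w P = evn n c w a := by
    intro w
    simp only [P, map_sum, MvPolynomial.eval_monomial, evn, Finset.sum_apply, Pi.smul_apply, smul_eq_mul]
    refine Finset.sum_congr rfl fun m _ => ?_
    rw [mul_comm, Finsupp.prod_fintype _ _ (fun i => pow_zero _)]
    rfl
  have hP : P = 0 := MvPolynomial.funext fun w => by rw [hev, h]; simp
  have hc : P.coeff (Finsupp.equivFunOnFinite.symm m.1) = c m a := by
    simp only [P, MvPolynomial.coeff_sum, MvPolynomial.coeff_monomial]
    rw [Finset.sum_eq_single m]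
    · simp
    · intro b _ hb
      rw [if_neg]
      intro e
      exact hb (Subtype.ext (Finsupp.equivFunOnFinite.symm.injective e))
    · simp
  rw [← hc, hP]
  simp

theorem evn_inj' (n : ℕ) (c c' : VV d n) (h : ∀ w, evn n c w = evn n c' w) : c = c' := by
  rw [← sub_eq_zero]
  refine evn_inj n _ fun w => ?_
  rw [← evL_apply, map_sub, evL_apply, evL_apply, h, sub_self]

theorem evn_hom (n : ℕ) (c : VV d n) (t : ℂ) (w) : evn n c (t • w) = t ^ n • evn n c w := by
  simp only [evn, Finset.smul_sum]
  refine Finset.sum_congr rfl fun m _ => ?_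
  rw [smul_smul]
  congr 1
  simp only [Pi.smul_apply, smul_eq_mul, mul_pow, Finset.prod_mul_distrib]
  rw [Finset.prod_pow_eq_pow_sum, Idx_sum]

/-- a word for a multi-index -/
theorem exists_word (n : ℕ) (m : Idx d n) : ∃ r : Fin n → Fin d, ∀ w : Fin d → ℂ, ∏ k, w (r k) = ∏ i, w i ^ m.1 i := by
  have hc : Fintype.card (Σ i : Fin d, Fin (m.1 i)) = n := by
    simp only [Fintype.card_sigma, Fintype.card_fin]
    exact Idx_sum m
  let e := Fintype.equivFinOfCardEq hc
  refine ⟨fun k => (e.symm k).1, fun w => ?_⟩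
  rw [Equiv.prod_comp e.symm (fun s : (Σ i : Fin d, Fin (m.1 i)) => w s.1), Fintype.prod_sigma]
  simp

/-- the chosen word -/
noncomputable def word {n : ℕ} (m : Idx d n) : Fin n → Fin d := (exists_word n m).choose

theorem word_spec {n : ℕ} (m : Idx d n) (w : Fin d → ℂ) : ∏ k, w (word m k) = ∏ i, w i ^ m.1 i :=
  (exists_word n m).choose_spec w

/-- continuous multilinear maps -/
abbrev CM (d n : ℕ) := ContinuousMultilinearMap ℂ (fun _ : Fin n => (Fin d → ℂ)) (Fin d → ℂ)

/-- polarisation -/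
noncomputable def tau (n : ℕ) (c : VV d n) : CM d n :=
  ∑ m : Idx d n, ((ContinuousMultilinearMap.mkPiAlgebra ℂ (Fin n) ℂ).compContinuousLinearMap
    (fun k => ContinuousLinearMap.proj (R := ℂ) (φ := fun _ : Fin d => ℂ) (word m k))).smulRight (c m)

theorem tau_apply (n : ℕ) (c : VV d n) (v) : tau n c v = ∑ m : Idx d n, (∏ k, v k (word m k)) • c m := by
  simp [tau, ContinuousMultilinearMap.sum_apply]

theorem tau_diag (n : ℕ) (c : VV d n) (w) : tau n c (fun _ => w) = evn n c w := by
  rw [tau_apply, evn]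
  exact Finset.sum_congr rfl fun m _ => by rw [word_spec]

/-- algebraic version of `tau` -/
noncomputable def tauL (n : ℕ) : VV d n →ₗ[ℂ] MM d n where
  toFun c := (tau n c).toMultilinearMap
  map_add' c c' := by
    refine MultilinearMap.ext fun v => ?_
    change tau n (c + c') v = tau n c v + tau n c' v
    simp [tau_apply, smul_add, Finset.sum_add_distrib]
  map_smul' a c := by
    refine MultilinearMap.ext fun v => ?_
    change tau n (a • c) v = a • tau n c v
    simp only [tau_apply, Pi.smul_apply, Finset.smul_sum]
    exact Finset.sum_congr rfl fun i _ => smul_comm _ _ _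

/-- multi-index of a word -/
def cnt {n : ℕ} (r : Fin n → Fin d) : Idx d n :=
  ⟨fun j => (Finset.univ.filter (fun i => r i = j)).card, by
    refine Finset.mem_piAntidiag.2 ⟨?_, by simp⟩
    have := Finset.card_eq_sum_card_fiberwise (f := r) (s := Finset.univ) (t := Finset.univ) (by simp)
    rw [← this]
    simp⟩

theorem cnt_prod {n : ℕ} (r : Fin n → Fin d) (w : Fin d → ℂ) : ∏ k, w (r k) = ∏ i, w i ^ (cnt r).1 i := by
  rw [← Finset.prod_fiberwise Finset.univ r (fun i => w (r i))]
  refine Finset.prod_congr rfl fun j _ => ?_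
  rw [Finset.prod_congr rfl (g := fun _ => w j) (fun i hi => by rw [(Finset.mem_filter.1 hi).2])]
  rw [Finset.prod_const]
  rfl

/-- basis vectors of a word -/
def eword {n : ℕ} (r : Fin n → Fin d) : Fin n → (Fin d → ℂ) := fun k => Pi.single (r k) 1

/-- coefficients of the diagonal restriction -/
noncomputable def sig (n : ℕ) : MM d n →ₗ[ℂ] VV d n where
  toFun f := ∑ r : Fin n → Fin d, Pi.single (cnt r) (f (eword r))
  map_add' f g := by
    rw [← Finset.sum_add_distrib]
    refine Finset.sum_congr rfl fun r _ => ?_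
    rw [← Pi.single_add]
    rfl
  map_smul' a f := by
    rw [Finset.smul_sum]
    refine Finset.sum_congr rfl fun r _ => ?_
    rw [← Pi.single_smul]
    rfl

theorem evn_single (n : ℕ) (m : Idx d n) (e : Fin d → ℂ) (w) : evn n (Pi.single m e) w = (∏ i, w i ^ m.1 i) • e := by
  rw [evn, Finset.sum_eq_single m]
  · simp
  · intro b _ hb; simp [Pi.single_eq_of_ne hb]
  · simp

theorem evn_sig (n : ℕ) (f : MM d n) (w) : evn n (sig n f) w = f (fun _ => w) := by
  have h1 : evn n (sig n f) w = ∑ r : Fin n → Fin d, (∏ k, w (r k)) • f (eword r) := by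
    rw [← evL_apply]
    change evL n w (∑ r : Fin n → Fin d, Pi.single (cnt r) (f (eword r))) = _
    rw [map_sum]
    refine Finset.sum_congr rfl fun r _ => ?_
    rw [evL_apply, evn_single, cnt_prod]
  rw [h1]
  have h2 : (fun _ : Fin n => w) = fun _ => ∑ j, w j • (Pi.single j 1 : Fin d → ℂ) := by
    ext k i
    simp [Finset.sum_apply, Pi.single_apply]
  rw [h2, MultilinearMap.map_sum]
  refine Finset.sum_congr rfl fun r _ => ?_
  rw [MultilinearMap.map_smul_univ f (fun k => w (r k))]
  rfl

theorem sig_tau (n : ℕ) (c : VV d n) : sig n (tauL n c) = c :=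
  evn_inj' n _ _ fun w => by rw [evn_sig]; exact tau_diag n c w

/-- homological operator on coefficient vectors -/
noncomputable def LL (n : ℕ) (M : Matrix (Fin d) (Fin d) ℂ) : VV d n →ₗ[ℂ] VV d n :=
  sig n ∘ₗ Lm n M ∘ₗ tauL n

theorem hasFDerivAt_diag (n : ℕ) (f : CM d n) (w : Fin d → ℂ) :
    HasFDerivAt (fun w => f (fun _ => w)) ((f.linearDeriv (fun _ => w)).comp
      (ContinuousLinearMap.pi fun _ => ContinuousLinearMap.id ℂ (Fin d → ℂ))) w := by
  have h1 := f.hasFDerivAt (fun _ => w)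
  have h2 : HasFDerivAt (fun w : Fin d → ℂ => (fun _ : Fin n => w))
    (ContinuousLinearMap.pi fun _ => ContinuousLinearMap.id ℂ (Fin d → ℂ)) w :=
    (ContinuousLinearMap.pi fun _ : Fin n => ContinuousLinearMap.id ℂ (Fin d → ℂ)).hasFDerivAt
  exact h1.comp w h2

theorem evn_hasFDerivAt (n : ℕ) (c : VV d n) (w : Fin d → ℂ) :
    HasFDerivAt (evn n c) (((tau n c).linearDeriv (fun _ => w)).comp
      (ContinuousLinearMap.pi fun _ => ContinuousLinearMap.id ℂ (Fin d → ℂ))) w := by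
  have := hasFDerivAt_diag n (tau n c) w
  simp only [tau_diag] at this
  exact this

theorem evn_fderiv (n : ℕ) (c : VV d n) (w y : Fin d → ℂ) :
    fderiv ℂ (evn n c) w y = ∑ i, tau n c (Function.update (fun _ => w) i y) := by
  rw [(evn_hasFDerivAt n c w).fderiv]
  simp [ContinuousMultilinearMap.linearDeriv_apply]

theorem Lm_diag (n : ℕ) (M : Matrix (Fin d) (Fin d) ℂ) (f : MM d n) (w) :
    Lm n M f (fun _ => w) = (∑ i, f (Function.update (fun _ => w) i (M *ᵥ w))) - M *ᵥ f (fun _ => w) := by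
  simp only [Lm, LinearMap.sub_apply, LinearMap.sum_apply, MultilinearMap.sub_apply, MultilinearMap.sum_apply, Tm_none, Tm_some]
  congr 1
  refine Finset.sum_congr rfl fun i _ => ?_
  congr 1
  ext j : 1
  by_cases hj : j = i
  · subst hj; simp [slotMap]
  · simp [slotMap, hj]

theorem evn_LL (n : ℕ) (M : Matrix (Fin d) (Fin d) ℂ) (c : VV d n) (w) :
    evn n (LL n M c) w = fderiv ℂ (evn n c) w (M *ᵥ w) - M *ᵥ evn n c w := by
  rw [LL, LinearMap.comp_apply, evn_sig, LinearMap.comp_apply, Lm_diag, evn_fderiv]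
  congr 2
  exact tau_diag n c w

theorem LL_inj (n : ℕ) (hn : 2 ≤ n) (M : Matrix (Fin d) (Fin d) ℂ) (hM : NonlinearlyNonresonant d M) (k : ℕ)
    (c : VV d n) (hc : LL n M c + (k : ℂ) • c = 0) : c = 0 := by
  have hint : ∀ f : MM d n, sig n (Lm n M f) = LL n M (sig n f) := by
    intro f
    refine evn_inj' n _ _ fun w => ?_
    rw [evn_sig, Lm_diag, evn_LL]
    have hexp : ∀ v : Fin n → (Fin d → ℂ), f v = ∑ r : Fin n → Fin d, (∏ k, v k (r k)) • f (eword r) := by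
      intro v
      have h2 : v = fun k => ∑ j, v k j • (Pi.single j 1 : Fin d → ℂ) := by
        ext k i
        simp [Finset.sum_apply, Pi.single_apply]
      conv_lhs => rw [h2]
      rw [MultilinearMap.map_sum]
      refine Finset.sum_congr rfl fun r _ => ?_
      rw [MultilinearMap.map_smul_univ f (fun k => v k (r k))]
      rfl
    have hcont : Continuous f := by
      have : (f : (Fin n → (Fin d → ℂ)) → (Fin d → ℂ)) = fun v => ∑ r : Fin n → Fin d, (∏ k, v k (r k)) • f (eword r) := funext hexp
      rw [this]
      fun_prop
    let F : CM d n := ⟨f, hcont⟩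
    have hF : evn n (sig n f) = fun w => F (fun _ => w) := funext fun w => evn_sig n f w
    rw [hF, (hasFDerivAt_diag n F w).fderiv]
    simp [ContinuousMultilinearMap.linearDeriv_apply]
    rfl
  have hsurjm : Function.Surjective (Lm n M + (k : ℂ) • LinearMap.id : Module.End ℂ (MM d n)) := by
    apply LinearMap.surjective_of_injective
    rw [← LinearMap.ker_eq_bot, LinearMap.ker_eq_bot']
    exact fun f hf => Lm_inj n hn M hM k f hf
  have hs : Function.Surjective (LL n M + (k : ℂ) • LinearMap.id : Module.End ℂ (VV d n)) := by
    intro y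
    obtain ⟨f, hf⟩ := hsurjm (tauL n y)
    refine ⟨sig n f, ?_⟩
    rw [← sig_tau n y, ← hf]
    simp [hint]
  have hi := LinearMap.injective_iff_surjective.2 hs
  exact hi (by rw [map_zero]; exact hc)

theorem LL_sum {ι : Type*} [Fintype ι] (n : ℕ) (a : ι → ℂ) (M : ι → Matrix (Fin d) (Fin d) ℂ) (c : VV d n) :
    LL n (∑ j, a j • M j) c = ∑ j, a j • LL n (M j) c := by
  refine evn_inj' n _ _ fun w => ?_
  rw [← evL_apply n w (∑ j, a j • LL n (M j) c), map_sum]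
  simp only [map_smul, evL_apply, evn_LL, Matrix.sum_mulVec, Matrix.smul_mulVec, map_sum, smul_sub, Finset.sum_sub_distrib]

end VV

section Formal

variable {d : ℕ}

/-- degree `k` coefficients at `x` -/
def hcf (k : ℕ) (H : (Fin d → ℕ) → ℂ → Fin d → ℂ) (x : ℂ) : VV d k := fun m => H m.1 x

theorem truncSeries_eq (n : ℕ) (H : (Fin d → ℕ) → ℂ → Fin d → ℂ) (x : ℂ) (w : Fin d → ℂ) :
    truncSeries d n H x w = ∑ k ∈ Finset.Icc 2 n, evn k (hcf k H x) w := by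
  rw [truncSeries]
  rw [← Finset.sum_fiberwise_of_maps_to (t := Finset.Icc 2 n) (g := fun m : Fin d → ℕ => ∑ i, m i)]
  · refine Finset.sum_congr rfl fun k hk => ?_
    have e : evn k (hcf k H x) w = ∑ m ∈ Finset.piAntidiag (Finset.univ : Finset (Fin d)) k, (∏ i, w i ^ m i) • H m x :=
      Finset.sum_coe_sort (Finset.piAntidiag (Finset.univ : Finset (Fin d)) k) (fun m => (∏ i, w i ^ m i) • H m x)
    rw [e]
    · refine Finset.sum_congr ?_ fun _ _ => rfl
      ext m
      simp only [Finset.mem_filter, Finset.mem_Iic, Finset.mem_piAntidiag]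
      rw [Finset.mem_Icc] at hk
      constructor
      · rintro ⟨_, h⟩
        exact ⟨h, by simp⟩
      · rintro ⟨h, _⟩
        have h : ∑ i, m i = k := h
        refine ⟨⟨fun i => ?_, ?_, ?_⟩, h⟩
        · have := Finset.single_le_sum (f := m) (fun _ _ => Nat.zero_le _) (Finset.mem_univ i)
          change m i ≤ n
          omega
        · omega
        · omega
  · intro m hm
    rw [Finset.mem_filter] at hm
    exact Finset.mem_Icc.2 hm.2

theorem truncSeries_succ (n : ℕ) (hn : 1 ≤ n) (H : (Fin d → ℕ) → ℂ → Fin d → ℂ) (x : ℂ) (w : Fin d → ℂ) :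
    truncSeries d (n + 1) H x w = truncSeries d n H x w + evn (n + 1) (hcf (n + 1) H x) w := by
  rw [truncSeries_eq, truncSeries_eq, Finset.sum_Icc_succ_top (by omega)]

theorem truncSeries_one (H : (Fin d → ℕ) → ℂ → Fin d → ℂ) (x : ℂ) (w : Fin d → ℂ) :
    truncSeries d 1 H x w = 0 := by
  rw [truncSeries_eq]; simp

/-- local Lipschitz estimate for homogeneous maps -/
theorem evn_lip (n : ℕ) (c : VV d n) : ∃ C : ℝ, ∀ a b : Fin d → ℂ,
    ‖evn n c a - evn n c b‖ ≤ C * max ‖a‖ ‖b‖ ^ (n - 1) * ‖a - b‖ := by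
  refine ⟨‖tau n c‖ * n, fun a b => ?_⟩
  rw [← tau_diag, ← tau_diag]
  refine (ContinuousMultilinearMap.norm_image_sub_le _ _ _).trans ?_
  have h1 : ∀ a : Fin d → ℂ, ‖(fun _ : Fin n => a)‖ ≤ ‖a‖ := fun a => pi_norm_const_le _
  rw [Fintype.card_fin]
  have h2 : ‖(fun _ : Fin n => a) - (fun _ : Fin n => b)‖ ≤ ‖a - b‖ := h1 (a - b)
  gcongr
  · exact h1 a
  · exact h1 b

theorem evn_bigO (n : ℕ) (c : VV d n) : (evn n c) =O[𝓝 0] fun w : Fin d → ℂ => ‖w‖ ^ n := by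
  refine IsBigO.of_bound ‖tau n c‖ (Eventually.of_forall fun w => ?_)
  rw [← tau_diag]
  refine ((tau n c).le_opNorm _).trans ?_
  simp

theorem pow_bigO {m n : ℕ} (h : m ≤ n) : (fun w : Fin d → ℂ => ‖w‖ ^ n) =O[𝓝 0] fun w : Fin d → ℂ => ‖w‖ ^ m := by
  refine IsBigO.of_bound 1 ?_
  filter_upwards [Metric.ball_mem_nhds (0 : Fin d → ℂ) one_pos] with w hw
  rw [mem_ball_zero_iff] at hw
  simp only [norm_pow, norm_norm, one_mul]
  exact pow_le_pow_of_le_one (norm_nonneg _) hw.le h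

/-- composite estimate -/
theorem lip_comp {r s : ℕ} {g a b : (Fin d → ℂ) → (Fin d → ℂ)} {C δ : ℝ} (hδ : 0 < δ)
    (hg : ∀ u v, ‖u‖ < δ → ‖v‖ < δ → ‖g u - g v‖ ≤ C * max ‖u‖ ‖v‖ ^ r * ‖u - v‖)
    (ha : a =O[𝓝 0] fun w => ‖w‖ ^ 1) (hb : b =O[𝓝 0] fun w => ‖w‖ ^ 1)
    (hab : (fun w => a w - b w) =O[𝓝 0] fun w => ‖w‖ ^ s) :
    (fun w => g (a w) - g (b w)) =O[𝓝 0] fun w => ‖w‖ ^ (r + s) := by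
  have ht : Tendsto (fun w : Fin d → ℂ => ‖w‖ ^ 1) (𝓝 0) (𝓝 0) := by
    have : Continuous (fun w : Fin d → ℂ => ‖w‖ ^ 1) := by fun_prop
    simpa using this.tendsto 0
  have ha0 : ∀ᶠ w in 𝓝 (0 : Fin d → ℂ), ‖a w‖ < δ := by
    have := (ha.trans_tendsto ht).norm
    rw [norm_zero] at this
    exact this.eventually_lt_const hδ
  have hb0 : ∀ᶠ w in 𝓝 (0 : Fin d → ℂ), ‖b w‖ < δ := by
    have := (hb.trans_tendsto ht).norm
    rw [norm_zero] at this
    exact this.eventually_lt_const hδ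
  have hm : (fun w => max ‖a w‖ ‖b w‖) =O[𝓝 0] fun w => ‖w‖ ^ 1 := by
    have : (fun w => ‖a w‖ + ‖b w‖) =O[𝓝 0] fun w => ‖w‖ ^ 1 := ha.norm_left.add hb.norm_left
    refine IsBigO.trans (IsBigO.of_bound 1 (Eventually.of_forall fun w => ?_)) this
    rw [Real.norm_of_nonneg (by positivity), Real.norm_of_nonneg (by positivity), one_mul]
    exact max_le_add_of_nonneg (norm_nonneg _) (norm_nonneg _)
  have h1 : (fun w => g (a w) - g (b w)) =O[𝓝 0] fun w => max ‖a w‖ ‖b w‖ ^ r * ‖a w - b w‖ := by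
    refine IsBigO.of_bound C ?_
    filter_upwards [ha0, hb0] with w h h'
    rw [Real.norm_of_nonneg (by positivity), ← mul_assoc]
    exact hg _ _ h h'
  refine h1.trans ?_
  have := (hm.pow r).mul hab.norm_left
  simpa only [pow_one, ← pow_add] using this

/-- Lipschitz estimate for maps vanishing at order two -/
theorem lip_of_analytic {g : (Fin d → ℂ) → (Fin d → ℂ)} (hg : AnalyticAt ℂ g 0) (h0 : fderiv ℂ g 0 = 0) :
    ∃ C δ : ℝ, 0 < δ ∧ ∀ u v, ‖u‖ < δ → ‖v‖ < δ → ‖g u - g v‖ ≤ C * max ‖u‖ ‖v‖ ^ 1 * ‖u - v‖ := by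
  have hd' : DifferentiableAt ℂ (fderiv ℂ g) 0 := hg.fderiv.differentiableAt
  have hO := hd'.isBigO_sub
  simp only [h0, sub_zero] at hO
  obtain ⟨C, hC0, hC⟩ := hO.exists_nonneg
  rw [isBigOWith_iff] at hC
  obtain ⟨δ, hδ, hδ'⟩ := Metric.eventually_nhds_iff.1 (hC.and hg.eventually_analyticAt)
  refine ⟨C, δ, hδ, fun u v hu hv => ?_⟩
  rw [pow_one]
  have hm : max ‖u‖ ‖v‖ < δ := max_lt hu hv
  refine (convex_closedBall (0 : Fin d → ℂ) (max ‖u‖ ‖v‖)).norm_image_sub_le_of_norm_fderiv_le (𝕜 := ℂ) (f := g) (x := v) (y := u) ?_ ?_ ?_ ?_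
  · intro y hy
    rw [mem_closedBall_zero_iff] at hy
    exact (hδ' (by rw [dist_zero_right]; linarith)).2.differentiableAt
  · intro y hy
    rw [mem_closedBall_zero_iff] at hy
    refine ((hδ' (by rw [dist_zero_right]; linarith)).1).trans ?_
    gcongr
  · simp
  · simp

theorem evn_zero_of_bigO (n : ℕ) (c : VV d n) (h : (evn n c) =O[𝓝 0] fun w : Fin d → ℂ => ‖w‖ ^ (n + 1)) : c = 0 := by
  refine evn_inj n c fun w => ?_
  have ht : Tendsto (fun t : ℂ => t • w) (𝓝 0) (𝓝 0) := by
    have : Continuous (fun t : ℂ => t • w) := by fun_prop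
    simpa using this.tendsto 0
  have h1 := h.comp_tendsto ht
  obtain ⟨C, hC⟩ := h1.bound
  have h2 : ∀ᶠ t : ℂ in 𝓝[≠] 0, ‖evn n c w‖ ≤ C * ‖w‖ ^ (n + 1) * ‖t‖ := by
    filter_upwards [nhdsWithin_le_nhds hC, self_mem_nhdsWithin] with t ht ht0
    simp only [Function.comp, evn_hom, norm_smul, norm_pow, norm_norm, norm_mul, mul_pow] at ht
    have hp : 0 < ‖t‖ ^ n := by
      have : 0 < ‖t‖ := norm_pos_iff.2 ht0
      positivity
    refine le_of_mul_le_mul_left ?_ hp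
    calc _ ≤ _ := ht
      _ = _ := by ring
  have h3 : Tendsto (fun t : ℂ => C * ‖w‖ ^ (n + 1) * ‖t‖) (𝓝[≠] 0) (𝓝 0) := by
    have : Continuous (fun t : ℂ => C * ‖w‖ ^ (n + 1) * ‖t‖) := by fun_prop
    have := this.tendsto 0
    rw [norm_zero, mul_zero] at this
    exact this.mono_left nhdsWithin_le_nhds
  have := ge_of_tendsto h3 h2
  exact norm_le_zero_iff.1 this

theorem hom_zero (N : ℕ) (c : ∀ k, VV d k)
    (h : (fun w => ∑ k ∈ Finset.range N, evn k (c k) w) =O[𝓝 0] fun w : Fin d → ℂ => ‖w‖ ^ N) :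
    ∀ k < N, c k = 0 := by
  induction N with
  | zero => intro k hk; omega
  | succ N ih =>
    simp only [Finset.sum_range_succ] at h
    have h1 : (fun w => ∑ k ∈ Finset.range N, evn k (c k) w) =O[𝓝 0] fun w : Fin d → ℂ => ‖w‖ ^ N := by
      have := (h.trans (pow_bigO (Nat.le_succ N))).sub (evn_bigO N (c N))
      simpa using this
    have h2 := ih h1
    intro k hk
    rcases Nat.lt_succ_iff_lt_or_eq.1 hk with hk | rfl
    · exact h2 k hk
    · refine evn_zero_of_bigO _ _ (h.congr_left fun w => ?_)
      rw [Finset.sum_eq_zero, zero_add]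
      intro j hj
      rw [h2 j (Finset.mem_range.1 hj)]
      exact (evL j w).map_zero

/-- Taylor expansion in `w`, analytic in `x` -/
theorem taylor_exists (D : Set ℂ) (hD : IsOpen D) (G : ℂ × (Fin d → ℂ) → (Fin d → ℂ))
    (hG : ∀ x ∈ D, AnalyticAt ℂ G (x, 0)) :
    ∃ c : ∀ k, ℂ → VV d k, (∀ k, DifferentiableOn ℂ (c k) D) ∧ ∀ x ∈ D, ∀ N,
      (fun w => G (x, w) - ∑ k ∈ Finset.range N, evn k (c k x) w) =O[𝓝 0] fun w : Fin d → ℂ => ‖w‖ ^ N := by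
  let ι : (Fin d → ℂ) →L[ℂ] ℂ × (Fin d → ℂ) := ContinuousLinearMap.inr ℂ ℂ (Fin d → ℂ)
  let J : ∀ k, ℂ → CM d k := fun k x => (iteratedFDeriv ℂ k G (x, 0)).compContinuousLinearMap (fun _ => ι)
  refine ⟨fun k x => ((k.factorial : ℂ)⁻¹) • sig k (J k x).toMultilinearMap, fun k x hx => ?_, fun x hx N => ?_⟩
  · apply DifferentiableAt.differentiableWithinAt
    refine DifferentiableAt.fun_const_smul ?_ _
    change DifferentiableAt ℂ (fun x => ∑ r : Fin k → Fin d, (Pi.single (cnt r) (J k x (eword r)) : VV d k)) x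
    have h1 : DifferentiableAt ℂ (fun y => iteratedFDeriv ℂ k G y) (x, 0) := ((AnalyticOnNhd.iteratedFDeriv (s := {y | AnalyticAt ℂ G y}) (fun y hy => hy) k) _ (hG x hx)).differentiableAt
    have h2 : DifferentiableAt ℂ (fun x : ℂ => iteratedFDeriv ℂ k G (x, 0)) x :=
      DifferentiableAt.comp (f := fun x : ℂ => ((x, 0) : ℂ × (Fin d → ℂ))) x h1 (by fun_prop)
    refine DifferentiableAt.fun_sum fun r _ => ?_
    have h3 : DifferentiableAt ℂ (fun x : ℂ => J k x (eword r)) x := by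
      change DifferentiableAt ℂ (fun x : ℂ => iteratedFDeriv ℂ k G (x, 0) (fun i => ι (eword r i))) x
      exact DifferentiableAt.comp (g := fun F : ContinuousMultilinearMap ℂ (fun _ : Fin k => ℂ × (Fin d → ℂ)) (Fin d → ℂ) => F (fun i => ι (eword r i))) x
        (ContinuousMultilinearMap.apply ℂ (fun _ : Fin k => ℂ × (Fin d → ℂ)) (Fin d → ℂ) (fun i => ι (eword r i))).differentiableAt h2
    exact DifferentiableAt.comp (g := fun y => (Pi.single (cnt r) y : VV d k)) x
      (LinearMap.toContinuousLinearMap (LinearMap.single ℂ (fun _ : Idx d k => Fin d → ℂ) (cnt r))).differentiableAt h3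
  · obtain ⟨P, hP⟩ := hG x hx
    have h1 := hP.isBigO_sub_partialSum_pow N
    have ht : Tendsto ι (𝓝 0) (𝓝 0) := by simpa using ι.continuous.tendsto 0
    have h2 := h1.comp_tendsto ht
    have h3 : ∀ k w, evn k (((k.factorial : ℂ)⁻¹) • sig k (J k x).toMultilinearMap) w = P k (fun _ => ι w) := by
      intro k w
      obtain ⟨r, hr⟩ := hP
      have := hr.factorial_smul (ι w) k
      rw [evn_smul, evn_sig]
      change _ • iteratedFDeriv ℂ k G (x, 0) (fun _ => ι w) = _
      rw [← this, ← Nat.cast_smul_eq_nsmul ℂ, smul_smul, inv_mul_cancel₀, one_smul]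
      exact_mod_cast k.factorial_ne_zero
    refine (h2.congr_left fun w => ?_).congr_right fun w => ?_
    · simp only [Function.comp, h3, FormalMultilinearSeries.partialSum]
      simp [ι]
    · simp [ι, Prod.norm_def]

end Formal

section Err

variable {d S : ℕ}

/-- derivative coefficients -/
noncomputable def dcf (k : ℕ) (H : (Fin d → ℕ) → ℂ → Fin d → ℂ) (x : ℂ) : VV d k := fun m => deriv (H m.1) x

/-- connection matrix -/
noncomputable def Ax (p : Fin (S + 2) → ℂ) (A : Fin (S + 2) → Matrix (Fin d) (Fin d) ℂ) (x : ℂ) :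
    Matrix (Fin d) (Fin d) ℂ := ∑ j, (x - p j)⁻¹ • A j

/-- error term -/
noncomputable def Err (p : Fin (S + 2) → ℂ) (A : Fin (S + 2) → Matrix (Fin d) (Fin d) ℂ)
    (f : ℂ → (Fin d → ℂ) → Fin d → ℂ) (n : ℕ) (H P : (Fin d → ℕ) → ℂ → Fin d → ℂ) (x : ℂ) (w : Fin d → ℂ) :
    Fin d → ℂ :=
  deriv (fun t => truncSeries d n H t w) x
                + (fderiv ℂ (fun v => truncSeries d n H x v) w)
                    ((∑ j, (x - p j)⁻¹ • A j) *ᵥ w)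
                - (∑ j, (x - p j)⁻¹ • A j) *ᵥ truncSeries d n H x w
                - (∏ j, (x - p j))⁻¹ •
                    (f x (w + truncSeries d n H x w)
                      - truncSeries d n P x
                          (w + truncSeries d n H x w))

theorem hcf_hasDerivAt (k : ℕ) (H : (Fin d → ℕ) → ℂ → Fin d → ℂ) (x : ℂ) (hH : ∀ m, DifferentiableAt ℂ (H m) x) :
    HasDerivAt (hcf k H) (dcf k H x) x :=
  hasDerivAt_pi.2 fun m => (hH m.1).hasDerivAt

theorem Err_expand (p : Fin (S + 2) → ℂ) (A : Fin (S + 2) → Matrix (Fin d) (Fin d) ℂ)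
    (f : ℂ → (Fin d → ℂ) → Fin d → ℂ) (n : ℕ) (H P : (Fin d → ℕ) → ℂ → Fin d → ℂ) (x : ℂ)
    (hH : ∀ m, DifferentiableAt ℂ (H m) x) (w : Fin d → ℂ) :
    Err p A f n H P x w = (∑ k ∈ Finset.Icc 2 n, evn k (dcf k H x + LL k (Ax p A x) (hcf k H x)) w)
      - (Qf p x)⁻¹ • (f x (w + truncSeries d n H x w)
                      - truncSeries d n P x
                          (w + truncSeries d n H x w)) := by
  have h1 : deriv (fun t => truncSeries d n H t w) x = ∑ k ∈ Finset.Icc 2 n, evn k (dcf k H x) w := by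
    simp only [truncSeries_eq]
    refine HasDerivAt.deriv ?_
    refine HasDerivAt.fun_sum fun k _ => ?_
    exact ((LinearMap.toContinuousLinearMap (evL k w)).hasFDerivAt).comp_hasDerivAt x (hcf_hasDerivAt k H x hH)
  have h2 : fderiv ℂ (fun v => truncSeries d n H x v) w = ∑ k ∈ Finset.Icc 2 n, fderiv ℂ (evn k (hcf k H x)) w := by
    simp only [truncSeries_eq]
    exact fderiv_fun_sum fun k _ => (evn_hasFDerivAt k _ w).differentiableAt
  have h3 : (∑ k ∈ Finset.Icc 2 n, evn k (dcf k H x + LL k (Ax p A x) (hcf k H x)) w)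
     = deriv (fun t => truncSeries d n H t w) x
                + (fderiv ℂ (fun v => truncSeries d n H x v) w)
                    ((∑ j, (x - p j)⁻¹ • A j) *ᵥ w)
                - (∑ j, (x - p j)⁻¹ • A j) *ᵥ truncSeries d n H x w := by
    rw [h1, h2]
    simp only [evn_add, evn_LL, Finset.sum_add_distrib, Finset.sum_sub_distrib, truncSeries_eq, Ax,
      ContinuousLinearMap.sum_apply, ← add_sub_assoc]
    congr 1
    exact (map_sum (Matrix.mulVecLin (∑ j, (x - p j)⁻¹ • A j)) _ _).symm
  rw [Err, h3]
  rfl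

theorem Err_congr (p : Fin (S + 2) → ℂ) (A : Fin (S + 2) → Matrix (Fin d) (Fin d) ℂ)
    (f : ℂ → (Fin d → ℂ) → Fin d → ℂ) (n : ℕ) (H P H' P' : (Fin d → ℕ) → ℂ → Fin d → ℂ) (D : Set ℂ) (hD : IsOpen D)
    (hH : ∀ m, 2 ≤ ∑ i, m i → ∑ i, m i ≤ n → EqOn (H m) (H' m) D)
    (hP : ∀ m, 2 ≤ ∑ i, m i → ∑ i, m i ≤ n → EqOn (P m) (P' m) D)
    (x : ℂ) (hx : x ∈ D) (w : Fin d → ℂ) : Err p A f n H P x w = Err p A f n H' P' x w := by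
  have hT : ∀ x ∈ D, truncSeries d n H x = truncSeries d n H' x := by
    intro x hx
    funext w
    refine Finset.sum_congr rfl fun m hm => ?_
    have := (Finset.mem_filter.1 hm).2
    rw [hH m this.1 this.2 hx]
  have hT' : truncSeries d n P x = truncSeries d n P' x := by
    funext w
    refine Finset.sum_congr rfl fun m hm => ?_
    have := (Finset.mem_filter.1 hm).2
    rw [hP m this.1 this.2 hx]
  have h1 : deriv (fun t => truncSeries d n H t w) x = deriv (fun t => truncSeries d n H' t w) x := by
    apply Filter.EventuallyEq.deriv_eq
    filter_upwards [hD.mem_nhds hx] with t ht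
    rw [hT t ht]
  rw [Err, Err, h1, hT x hx, hT']

theorem sum_bigO (s : Finset ℕ) (F : ℕ → (Fin d → ℂ) → (Fin d → ℂ)) (g : (Fin d → ℂ) → ℝ)
    (h : ∀ k ∈ s, F k =O[𝓝 0] g) : (fun w => ∑ k ∈ s, F k w) =O[𝓝 0] g := IsBigO.fun_sum h

theorem trunc_bigO (n : ℕ) (H : (Fin d → ℕ) → ℂ → Fin d → ℂ) (x : ℂ) :
    (fun w => truncSeries d n H x w) =O[𝓝 0] fun w : Fin d → ℂ => ‖w‖ ^ 2 := by
  simp only [truncSeries_eq]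
  refine sum_bigO _ _ _ fun k hk => ?_
  exact (evn_bigO k _).trans (pow_bigO (Finset.mem_Icc.1 hk).1)

theorem add_trunc_bigO (n : ℕ) (H : (Fin d → ℕ) → ℂ → Fin d → ℂ) (x : ℂ) :
    (fun w => w + truncSeries d n H x w) =O[𝓝 0] fun w : Fin d → ℂ => ‖w‖ ^ 1 := by
  refine IsBigO.add ?_ ((trunc_bigO n H x).trans (pow_bigO (by norm_num)))
  simp only [pow_one]
  exact (isBigO_refl _ _).norm_right

theorem Err_succ (p : Fin (S + 2) → ℂ) (A : Fin (S + 2) → Matrix (Fin d) (Fin d) ℂ)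
    (f : ℂ → (Fin d → ℂ) → Fin d → ℂ) (n : ℕ) (hn : 1 ≤ n) (H P : (Fin d → ℕ) → ℂ → Fin d → ℂ) (x : ℂ)
    (hH : ∀ m, DifferentiableAt ℂ (H m) x) (hf : AnalyticAt ℂ (f x) 0) (hf0 : fderiv ℂ (f x) 0 = 0) :
    (fun w => Err p A f (n + 1) H P x w - Err p A f n H P x w
      - evn (n + 1) (dcf (n + 1) H x + LL (n + 1) (Ax p A x) (hcf (n + 1) H x) + (Qf p x)⁻¹ • hcf (n + 1) P x) w)
     =O[𝓝 0] fun w : Fin d → ℂ => ‖w‖ ^ (n + 2) := by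
  let a : (Fin d → ℂ) → (Fin d → ℂ) := fun w => w + truncSeries d (n + 1) H x w
  let b : (Fin d → ℂ) → (Fin d → ℂ) := fun w => w + truncSeries d n H x w
  have ha : a =O[𝓝 0] fun w => ‖w‖ ^ 1 := add_trunc_bigO (n + 1) H x
  have hb : b =O[𝓝 0] fun w => ‖w‖ ^ 1 := add_trunc_bigO n H x
  have hid : (fun w : Fin d → ℂ => w) =O[𝓝 0] fun w => ‖w‖ ^ 1 := by
    simp only [pow_one]
    exact (isBigO_refl _ _).norm_right
  have hab : (fun w => a w - b w) =O[𝓝 0] fun w => ‖w‖ ^ (n + 1) := by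
    refine (evn_bigO (n + 1) (hcf (n + 1) H x)).congr_left fun w => ?_
    simp only [a, b, truncSeries_succ n hn]
    abel
  have haw : (fun w => a w - w) =O[𝓝 0] fun w => ‖w‖ ^ 2 := by
    refine (trunc_bigO (n + 1) H x).congr_left fun w => ?_
    simp only [a]
    abel
  obtain ⟨C, δ, hδ, hC⟩ := lip_of_analytic hf hf0
  have e1 : (fun w => f x (a w) - f x (b w)) =O[𝓝 0] fun w => ‖w‖ ^ (n + 2) := by
    have := lip_comp hδ hC ha hb hab
    rwa [show 1 + (n + 1) = n + 2 by omega] at this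
  have e2 : (fun w => truncSeries d n P x (a w) - truncSeries d n P x (b w)) =O[𝓝 0] fun w => ‖w‖ ^ (n + 2) := by
    simp only [truncSeries_eq, ← Finset.sum_sub_distrib]
    refine sum_bigO _ _ _ fun k hk => ?_
    obtain ⟨C, hC⟩ := evn_lip k (hcf k P x)
    have := lip_comp one_pos (fun u v _ _ => hC u v) ha hb hab
    exact this.trans (pow_bigO (by have := (Finset.mem_Icc.1 hk).1; omega))
  have e3 : (fun w => evn (n + 1) (hcf (n + 1) P x) (a w) - evn (n + 1) (hcf (n + 1) P x) w) =O[𝓝 0] fun w => ‖w‖ ^ (n + 2) := by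
    obtain ⟨C, hC⟩ := evn_lip (n + 1) (hcf (n + 1) P x)
    exact lip_comp one_pos (fun u v _ _ => hC u v) ha hid haw
  have e4 := ((e1.sub e2).sub e3).const_smul_left (-(Qf p x)⁻¹)
  refine e4.congr_left fun w => ?_
  rw [Err_expand p A f (n + 1) H P x hH, Err_expand p A f n H P x hH, Finset.sum_Icc_succ_top (by omega),
    truncSeries_succ n hn P]
  simp only [evn_add _ (_ + _), evn_smul, Pi.smul_apply]
  change _ = _ + _ - (Qf p x)⁻¹ • (f x (a w) - (truncSeries d n P x (a w) + evn (n + 1) (hcf (n + 1) P x) (a w))) -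
    (_ - (Qf p x)⁻¹ • (f x (b w) - truncSeries d n P x (b w))) - _
  module

end Err

section Uniq

variable {d S : ℕ}

/-- residue operators -/
noncomputable def BB (n : ℕ) (A : Fin (S + 2) → Matrix (Fin d) (Fin d) ℂ) (j : Fin (S + 2)) : VV d n →L[ℂ] VV d n :=
  LinearMap.toContinuousLinearMap (LL n (A j))

theorem NR_BB (n : ℕ) (hn : 2 ≤ n) (A : Fin (S + 2) → Matrix (Fin d) (Fin d) ℂ)
    (hA : ∀ j, NonlinearlyNonresonant d (A j))
    (hAinf : NonlinearlyNonresonant d (∑ j, A j)) : NR (BB n A) := by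
  refine ⟨fun j k v h => LL_inj n hn (A j) (hA j) k v h, fun k v h => LL_inj n hn _ hAinf k v ?_⟩
  have := LL_sum n (fun _ => (1 : ℂ)) A v
  simp only [one_smul] at this
  rw [this, ← h, ContinuousLinearMap.sum_apply]
  rfl

theorem TT_eq (n : ℕ) (p : Fin (S + 2) → ℂ) (A : Fin (S + 2) → Matrix (Fin d) (Fin d) ℂ) (h : ℂ → VV d n)
    (x : ℂ) (hx : x ∉ Set.range p) :
    TT p (BB n A) h x = Qf p x • (deriv h x + LL n (Ax p A x) (h x)) := by
  rw [TT, smul_add]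
  congr 1
  rw [Cf, ContinuousLinearMap.sum_apply, Ax, LL_sum, Finset.smul_sum]
  refine Finset.sum_congr rfl fun j _ => ?_
  have hj : x - p j ≠ 0 := sub_ne_zero.2 fun e => hx ⟨j, e.symm⟩
  rw [smul_smul, Qf_eq p j, mul_comm (x - p j), mul_assoc, mul_inv_cancel₀ hj, mul_one]
  rfl

/-- evaluation of the polynomial family -/
noncomputable def evP (Phi : (Fin d → ℕ) → Fin d → Polynomial ℂ) : (Fin d → ℕ) → ℂ → Fin d → ℂ :=
  fun m t i => (Phi m i).eval t

/-- coefficients of the polynomial family -/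
def coP (S n : ℕ) (Phi : (Fin d → ℕ) → Fin d → Polynomial ℂ) : Fin (S + 1) → VV d n :=
  fun k m i => (Phi m.1 i).coeff k

theorem lowPoly_coP (n : ℕ) (Phi : (Fin d → ℕ) → Fin d → Polynomial ℂ) (hdeg : ∀ m i, (Phi m i).degree ≤ (S : ℕ)) (x : ℂ) :
    lowPoly (coP S n Phi) x = hcf n (evP Phi) x := by
  funext m i
  have h1 : (Phi m.1 i).natDegree < S + 1 := Nat.lt_succ_of_le (Polynomial.natDegree_le_of_degree_le (hdeg _ _))
  simp only [lowPoly, coP, hcf, evP, Finset.sum_apply, Pi.smul_apply, smul_eq_mul]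
  rw [Polynomial.eval_eq_sum_range' h1, Finset.sum_range]
  exact Finset.sum_congr rfl fun k _ => mul_comm _ _

/-- good up to order `n` -/
def Good (p : Fin (S + 2) → ℂ) (A : Fin (S + 2) → Matrix (Fin d) (Fin d) ℂ)
    (f : ℂ → (Fin d → ℂ) → Fin d → ℂ) (D : Set ℂ) (n : ℕ) (H P : (Fin d → ℕ) → ℂ → Fin d → ℂ) : Prop :=
  ∀ x ∈ D \ Set.range p, (fun w : Fin d → ℂ => Err p A f n H P x w) =O[𝓝 0] fun w => ‖w‖ ^ (n + 1)

theorem dense_ext (D : Set ℂ) (hD : IsOpen D) (p : Fin (S + 2) → ℂ) {V : Type*} [NormedAddCommGroup V]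
    (F : ℂ → V) (hF : ContinuousOn F D)
    (h0 : ∀ x ∈ D \ Set.range p, F x = 0) : ∀ x ∈ D, F x = 0 := by
  intro x hx
  have hfin : (Set.range p \ {x}).Finite := (Set.finite_range p).subset Set.diff_subset
  have h1 : ∀ᶠ y in 𝓝[≠] x, F y = 0 := by
    have h2 : (Set.range p \ {x})ᶜ ∈ 𝓝 x := hfin.isClosed.isOpen_compl.mem_nhds (by simp)
    filter_upwards [nhdsWithin_le_nhds h2, nhdsWithin_le_nhds (hD.mem_nhds hx), self_mem_nhdsWithin] with y hy hyD hne
    exact h0 y ⟨hyD, fun hp => hy ⟨hp, hne⟩⟩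
  have h3 : Tendsto F (𝓝[≠] x) (𝓝 (F x)) := ((hF.continuousAt (hD.mem_nhds hx)).tendsto).mono_left nhdsWithin_le_nhds
  have h4 : Tendsto F (𝓝[≠] x) (𝓝 0) := tendsto_const_nhds.congr' (by filter_upwards [h1] with y hy; exact hy.symm)
  exact tendsto_nhds_unique h3 h4

theorem uniq_main (p : Fin (S + 2) → ℂ) (hp : Function.Injective p)
    (A : Fin (S + 2) → Matrix (Fin d) (Fin d) ℂ)
    (hA : ∀ j, NonlinearlyNonresonant d (A j))
    (hAinf : NonlinearlyNonresonant d (∑ j, A j))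
    (D : Set ℂ) (hD : IsOpen D) (hDc : IsPreconnected D)
    (hDsc : SimplyConnectedSpace D) (hpD : ∀ j, p j ∈ D)
    (f : ℂ → (Fin d → ℂ) → Fin d → ℂ)
    (hf : ∀ x ∈ D, AnalyticAt ℂ (f x) 0) (hf0 : ∀ x ∈ D, fderiv ℂ (f x) 0 = 0)
    (Phi Phi' : (Fin d → ℕ) → Fin d → Polynomial ℂ) (H H' : (Fin d → ℕ) → ℂ → Fin d → ℂ)
    (h1 : ∀ m, ∑ i, m i < 2 → Phi m = 0) (h1' : ∀ m, ∑ i, m i < 2 → Phi' m = 0)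
    (h2 : ∀ m i, (Phi m i).degree ≤ (S : ℕ)) (h2' : ∀ m i, (Phi' m i).degree ≤ (S : ℕ))
    (h3 : ∀ m, ∑ i, m i < 2 → H m = 0) (h3' : ∀ m, ∑ i, m i < 2 → H' m = 0)
    (h4 : ∀ m, AnalyticOnNhd ℂ (H m) D) (h4' : ∀ m, AnalyticOnNhd ℂ (H' m) D)
    (h5 : ∀ n, 2 ≤ n → Good p A f D n H (evP Phi)) (h5' : ∀ n, 2 ≤ n → Good p A f D n H' (evP Phi')) :
    ∀ n, ∀ m, ∑ i, m i ≤ n + 1 → Phi m = Phi' m ∧ EqOn (H m) (H' m) D := by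
  intro n
  induction n with
  | zero =>
    intro m hm
    rw [h1 m (by omega), h1' m (by omega), h3 m (by omega), h3' m (by omega)]
    exact ⟨rfl, fun _ _ => rfl⟩
  | succ n ih =>
    have hdH : ∀ x ∈ D, ∀ m, DifferentiableAt ℂ (H m) x := fun x hx m => (h4 m x hx).differentiableAt
    have hdH' : ∀ x ∈ D, ∀ m, DifferentiableAt ℂ (H' m) x := fun x hx m => (h4' m x hx).differentiableAt
    let h : ℂ → VV d (n + 2) := fun x => hcf (n + 2) H x - hcf (n + 2) H' x
    let φ : Fin (S + 1) → VV d (n + 2) := coP S (n + 2) Phi - coP S (n + 2) Phi'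
    have hder : ∀ x ∈ D, HasDerivAt h (dcf (n + 2) H x - dcf (n + 2) H' x) x := fun x hx =>
      (hcf_hasDerivAt (n + 2) H x (hdH x hx)).sub (hcf_hasDerivAt (n + 2) H' x (hdH' x hx))
    have hφ : ∀ x, lowPoly φ x = hcf (n + 2) (evP Phi) x - hcf (n + 2) (evP Phi') x := by
      intro x
      rw [← lowPoly_coP _ Phi h2, ← lowPoly_coP _ Phi' h2']
      simp [lowPoly, φ, smul_sub]
    have key : ∀ x ∈ D \ Set.range p, TT p (BB (n + 2) A) h x + lowPoly φ x = 0 := by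
      intro x hx
      have hQ : Qf p x ≠ 0 := Qf_ne p x fun j e => hx.2 ⟨j, e.symm⟩
      have e1 := Err_succ p A f (n + 1) (by omega) H (evP Phi) x (hdH x hx.1) (hf x hx.1) (hf0 x hx.1)
      have e1' := Err_succ p A f (n + 1) (by omega) H' (evP Phi') x (hdH' x hx.1) (hf x hx.1) (hf0 x hx.1)
      have g1 := h5 (n + 2) (by omega) x hx
      have g1' := h5' (n + 2) (by omega) x hx
      have hE : ∀ w, Err p A f (n + 1) H (evP Phi) x w = Err p A f (n + 1) H' (evP Phi') x w := by
        intro w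
        refine Err_congr p A f (n + 1) _ _ _ _ D hD (fun m _ hm => (ih m hm).2) (fun m _ hm => ?_) x hx.1 w
        intro t _
        funext i
        simp only [evP]
        rw [(ih m hm).1]
      have hz := evn_zero_of_bigO (n + 2) ((dcf (n + 2) H x + LL (n + 2) (Ax p A x) (hcf (n + 2) H x) + (Qf p x)⁻¹ • hcf (n + 2) (evP Phi) x)
        - (dcf (n + 2) H' x + LL (n + 2) (Ax p A x) (hcf (n + 2) H' x) + (Qf p x)⁻¹ • hcf (n + 2) (evP Phi') x)) (by
          refine (((g1.sub g1').sub (e1.sub e1'))).congr_left fun w => ?_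
          have es : ∀ c c' : VV d (n + 2), evn (n + 2) (c - c') w = evn (n + 2) c w - evn (n + 2) c' w :=
            fun c c' => (evL (n + 2) w).map_sub c c'
          rw [es, hE]
          abel)
      rw [TT_eq _ _ _ _ _ hx.2, (hder x hx.1).deriv, hφ]
      have : Qf p x • ((dcf (n + 2) H x + LL (n + 2) (Ax p A x) (hcf (n + 2) H x) + (Qf p x)⁻¹ • hcf (n + 2) (evP Phi) x)
        - (dcf (n + 2) H' x + LL (n + 2) (Ax p A x) (hcf (n + 2) H' x) + (Qf p x)⁻¹ • hcf (n + 2) (evP Phi') x)) = 0 := by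
        rw [hz, smul_zero]
      rw [← this]
      simp only [h, map_sub, smul_sub, smul_add, smul_smul, mul_inv_cancel₀ hQ, one_smul]
      abel
    have hhd : DifferentiableOn ℂ h D := fun x hx => (hder x hx).differentiableAt.differentiableWithinAt
    have key2 : ∀ x ∈ D, TT p (BB (n + 2) A) h x + lowPoly φ x = 0 := by
      refine dense_ext D hD p _ ?_ key
      have c1 : ContinuousOn (deriv h) D := (hhd.deriv hD).continuousOn
      have c2 : ContinuousOn h D := hhd.continuousOn
      have c3 : Continuous (Cf p (BB (n + 2) A)) := (Cf_diff p _).continuous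
      have c4 : Continuous (Qf p) := (Qf_diff p).continuous
      have c5 : Continuous (lowPoly φ) := by unfold lowPoly; fun_prop
      unfold TT
      exact ((c4.continuousOn.smul c1).add (c3.continuousOn.clm_apply c2)).add c5.continuousOn
    obtain ⟨r1, r2⟩ := Lin_unique p hp D hD hDc hDsc hpD (BB (n + 2) A) (NR_BB (n + 2) (by omega) A hA hAinf) h hhd φ key2
    intro m hm
    rcases Nat.lt_or_ge (∑ i, m i) (n + 2) with hlt | hge
    · exact ih m (by omega)
    · have hm' : ∑ i, m i = n + 2 := by omega
      let μ : Idx d (n + 2) := ⟨m, Finset.mem_piAntidiag.2 ⟨hm', by simp⟩⟩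
      constructor
      · funext i
        ext k
        rcases Nat.lt_or_ge k (S + 1) with hk | hk
        · have := congrFun (congrFun (congrFun r1 ⟨k, hk⟩) μ) i
          exact sub_eq_zero.1 this
        · rw [Polynomial.coeff_eq_zero_of_degree_lt (lt_of_le_of_lt (h2 m i) (by exact_mod_cast hk)),
            Polynomial.coeff_eq_zero_of_degree_lt (lt_of_le_of_lt (h2' m i) (by exact_mod_cast hk))]
      · intro x hx
        exact sub_eq_zero.1 (congrFun (r2 x hx) μ)

end Uniq

section Exist

variable {d S : ℕ}

/-- invariant of the construction -/
def StInv (p : Fin (S + 2) → ℂ) (A : Fin (S + 2) → Matrix (Fin d) (Fin d) ℂ)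
    (f : ℂ → (Fin d → ℂ) → Fin d → ℂ) (D : Set ℂ) (n : ℕ)
    (s : ((Fin d → ℕ) → ℂ → Fin d → ℂ) × ((Fin d → ℕ) → Fin d → Polynomial ℂ)) : Prop :=
  (∀ m, ∑ i, m i < 2 → s.1 m = 0) ∧ (∀ m, ∑ i, m i < 2 → s.2 m = 0) ∧
  (∀ m i, (s.2 m i).degree ≤ (S : ℕ)) ∧ (∀ m, AnalyticOnNhd ℂ (s.1 m) D) ∧ Good p A f D n s.1 (evP s.2)

theorem trunc_analytic (n : ℕ) (H : (Fin d → ℕ) → ℂ → Fin d → ℂ) (q : ℂ × (Fin d → ℂ))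
    (hH : ∀ m, AnalyticAt ℂ (H m) q.1) :
    AnalyticAt ℂ (fun q : ℂ × (Fin d → ℂ) => truncSeries d n H q.1 q.2) q := by
  unfold truncSeries
  refine Finset.analyticAt_fun_sum _ fun m _ => ?_
  refine AnalyticAt.fun_smul ?_ ?_
  · refine Finset.analyticAt_fun_prod _ fun i _ => ?_
    refine AnalyticAt.fun_pow ?_ _
    exact ((ContinuousLinearMap.proj (R := ℂ) (φ := fun _ : Fin d => ℂ) i).comp
      (ContinuousLinearMap.snd ℂ ℂ (Fin d → ℂ))).analyticAt q
  · exact AnalyticAt.comp (g := H m) (f := fun q : ℂ × (Fin d → ℂ) => q.1) (hH m) analyticAt_fst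

theorem evP_analytic (Phi : (Fin d → ℕ) → Fin d → Polynomial ℂ) (m) (x : ℂ) : AnalyticAt ℂ (evP Phi m) x := by
  refine Differentiable.analyticAt (differentiable_pi.2 fun i => ?_) x
  exact (Phi m i).differentiable

theorem trunc_zero (n : ℕ) (H : (Fin d → ℕ) → ℂ → Fin d → ℂ) (x : ℂ) : truncSeries d n H x 0 = 0 := by
  rw [truncSeries]
  refine Finset.sum_eq_zero fun m hm => ?_
  have h := (Finset.mem_filter.1 hm).2.1
  have : ∃ i, m i ≠ 0 := by
    by_contra hc
    push Not at hc
    simp [hc] at h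
  obtain ⟨i, hi⟩ := this
  rw [Finset.prod_eq_zero (Finset.mem_univ i), zero_smul]
  simp [hi]

theorem slice_analytic (f : ℂ → (Fin d → ℂ) → Fin d → ℂ) (x : ℂ)
    (hF : AnalyticAt ℂ (fun q : ℂ × (Fin d → ℂ) => f q.1 q.2) (x, 0)) : AnalyticAt ℂ (f x) 0 :=
  AnalyticAt.comp (g := fun q : ℂ × (Fin d → ℂ) => f q.1 q.2) (f := fun w => (x, w)) hF
    (analyticAt_const.prod analyticAt_id)

theorem Good_one (p : Fin (S + 2) → ℂ) (A : Fin (S + 2) → Matrix (Fin d) (Fin d) ℂ)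
    (f : ℂ → (Fin d → ℂ) → Fin d → ℂ) (D : Set ℂ)
    (hf : ∀ x ∈ D, AnalyticAt ℂ (f x) 0) (hf0 : ∀ x ∈ D, fderiv ℂ (f x) 0 = 0) (hfz : ∀ x ∈ D, f x 0 = 0) :
    Good p A f D 1 0 (evP 0) := by
  intro x hx
  obtain ⟨C, δ, hδ, hC⟩ := lip_of_analytic (hf x hx.1) (hf0 x hx.1)
  have hid : (fun w : Fin d → ℂ => w) =O[𝓝 0] fun w => ‖w‖ ^ 1 := by
    simp only [pow_one]
    exact (isBigO_refl _ _).norm_right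
  have := lip_comp (s := 1) (b := fun _ => 0) hδ hC hid (isBigO_zero _ _) (by simpa using hid)
  refine (this.const_smul_left (-(Qf p x)⁻¹)).congr_left fun w => ?_
  rw [Err_expand p A f 1 0 (evP 0) x (fun m => differentiableAt_const (0 : Fin d → ℂ))]
  simp [truncSeries_one, hfz x hx.1]

theorem G_analytic (f : ℂ → (Fin d → ℂ) → Fin d → ℂ) (T P : ℂ × (Fin d → ℂ) → Fin d → ℂ) (x : ℂ)
    (hF : AnalyticAt ℂ (fun q : ℂ × (Fin d → ℂ) => f q.1 q.2) (x, 0))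
    (hT : AnalyticAt ℂ T (x, 0)) (hT0 : T (x, 0) = 0) (hP : AnalyticAt ℂ P (x, 0)) :
    AnalyticAt ℂ (fun q : ℂ × (Fin d → ℂ) => f q.1 (q.2 + T q) - P (q.1, q.2 + T q)) (x, 0) := by
  have a1 : AnalyticAt ℂ (fun q : ℂ × (Fin d → ℂ) => (q.1, q.2 + T q)) (x, 0) :=
    analyticAt_fst.prod (analyticAt_snd.add hT)
  have a0 : (fun q : ℂ × (Fin d → ℂ) => (q.1, q.2 + T q)) (x, 0) = (x, 0) := by
    simp [hT0]
  exact (AnalyticAt.comp_of_eq hF a1 a0).sub (AnalyticAt.comp_of_eq hP a1 a0)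

theorem step_main (p : Fin (S + 2) → ℂ) (hp : Function.Injective p)
    (A : Fin (S + 2) → Matrix (Fin d) (Fin d) ℂ)
    (hA : ∀ j, NonlinearlyNonresonant d (A j))
    (hAinf : NonlinearlyNonresonant d (∑ j, A j))
    (D : Set ℂ) (hD : IsOpen D) (hDc : IsPreconnected D)
    (hDsc : SimplyConnectedSpace D) (hpD : ∀ j, p j ∈ D)
    (f : ℂ → (Fin d → ℂ) → Fin d → ℂ)
    (hF : ∀ x ∈ D, AnalyticAt ℂ (fun q : ℂ × (Fin d → ℂ) => f q.1 q.2) (x, 0)) (hf0 : ∀ x ∈ D, fderiv ℂ (f x) 0 = 0)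
    (n : ℕ) (hn : 1 ≤ n) (s : ((Fin d → ℕ) → ℂ → Fin d → ℂ) × ((Fin d → ℕ) → Fin d → Polynomial ℂ))
    (hs : StInv p A f D n s) :
    ∃ s', StInv p A f D (n + 1) s' ∧ ∀ m, ∑ i, m i ≤ n → s'.1 m = s.1 m ∧ s'.2 m = s.2 m := by
  obtain ⟨H, Phi⟩ := s
  obtain ⟨h1, h2, h3, h4, h5⟩ := hs
  dsimp only at h1 h2 h3 h4 h5
  have hf : ∀ x ∈ D, AnalyticAt ℂ (f x) 0 := fun x hx => slice_analytic f x (hF x hx)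
  have hdH : ∀ x ∈ D, ∀ m, DifferentiableAt ℂ (H m) x := fun x hx m => (h4 m x hx).differentiableAt
  let G : ℂ × (Fin d → ℂ) → (Fin d → ℂ) := fun q => f q.1 (q.2 + truncSeries d n H q.1 q.2)
    - truncSeries d n (evP Phi) q.1 (q.2 + truncSeries d n H q.1 q.2)
  have hG : ∀ x ∈ D, AnalyticAt ℂ G (x, 0) := fun x hx =>
    G_analytic f (fun q => truncSeries d n H q.1 q.2) (fun q => truncSeries d n (evP Phi) q.1 q.2) x (hF x hx)
      (trunc_analytic n H (x, 0) fun m => h4 m x hx) (trunc_zero n H x)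
      (trunc_analytic n _ _ fun m => evP_analytic Phi m _)
  obtain ⟨c, hc, hT⟩ := taylor_exists D hD G hG
  obtain ⟨φ, h, hh, he⟩ := Lin_exists p hp D hD hDc hDsc hpD (BB (n + 1) A) (NR_BB (n + 1) (by omega) A hA hAinf)
    (c (n + 1)) (hc (n + 1))
  let H' : (Fin d → ℕ) → ℂ → Fin d → ℂ := fun m =>
    if hm : m ∈ Finset.piAntidiag (Finset.univ : Finset (Fin d)) (n + 1) then fun x => h x ⟨m, hm⟩ else H m
  let Phi' : (Fin d → ℕ) → Fin d → Polynomial ℂ := fun m =>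
    if hm : m ∈ Finset.piAntidiag (Finset.univ : Finset (Fin d)) (n + 1) then
      fun i => ∑ k : Fin (S + 1), Polynomial.C (φ k ⟨m, hm⟩ i) * Polynomial.X ^ (k : ℕ) else Phi m
  have hmem : ∀ m : Fin d → ℕ, m ∈ Finset.piAntidiag (Finset.univ : Finset (Fin d)) (n + 1) ↔ ∑ i, m i = n + 1 := by
    intro m
    rw [Finset.mem_piAntidiag]
    exact ⟨fun e => e.1, fun e => ⟨e, by simp⟩⟩
  have hag : ∀ m, ∑ i, m i ≤ n → H' m = H m ∧ Phi' m = Phi m := by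
    intro m hm
    have : m ∉ Finset.piAntidiag (Finset.univ : Finset (Fin d)) (n + 1) := by rw [hmem]; omega
    simp only [H', Phi', dif_neg this, and_self]
  have hcH : hcf (n + 1) H' = h := by
    funext x m
    simp only [hcf, H', dif_pos m.2]
  have hcP : ∀ x, hcf (n + 1) (evP Phi') x = lowPoly φ x := by
    intro x
    funext m i
    simp only [hcf, evP, Phi', dif_pos m.2, lowPoly, Finset.sum_apply, Pi.smul_apply, smul_eq_mul,
      Polynomial.eval_finset_sum, Polynomial.eval_mul, Polynomial.eval_C, Polynomial.eval_pow, Polynomial.eval_X]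
    exact Finset.sum_congr rfl fun k _ => mul_comm _ _
  have hH'a : ∀ m, AnalyticOnNhd ℂ (H' m) D := by
    intro m
    by_cases hm : m ∈ Finset.piAntidiag (Finset.univ : Finset (Fin d)) (n + 1)
    · simp only [H', dif_pos hm]
      refine DifferentiableOn.analyticOnNhd ?_ hD
      exact fun x hx => (differentiableWithinAt_pi.1 (hh x hx)) ⟨m, hm⟩
    · simp only [H', dif_neg hm]
      exact h4 m
  have hdH' : ∀ x ∈ D, ∀ m, DifferentiableAt ℂ (H' m) x := fun x hx m => (hH'a m x hx).differentiableAt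
  refine ⟨(H', Phi'), ⟨?_, ?_, ?_, hH'a, ?_⟩, hag⟩
  · intro m hm
    rw [← h1 m hm]
    exact (hag m (by omega)).1
  · intro m hm
    rw [← h2 m hm]
    exact (hag m (by omega)).2
  · intro m i
    by_cases hm : m ∈ Finset.piAntidiag (Finset.univ : Finset (Fin d)) (n + 1)
    · simp only [Phi', dif_pos hm]
      refine (Polynomial.degree_sum_le _ _).trans (Finset.sup_le fun k _ => ?_)
      refine (Polynomial.degree_C_mul_X_pow_le _ _).trans ?_
      exact_mod_cast Nat.lt_succ_iff.1 k.2
    · simp only [Phi', dif_neg hm]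
      exact h3 m i
  · intro x hx
    have hQ : Qf p x ≠ 0 := Qf_ne p x fun j e => hx.2 ⟨j, e.symm⟩
    dsimp only
    let e : ∀ k, VV d k := fun k => (if 2 ≤ k then dcf k H x + LL k (Ax p A x) (hcf k H x) else 0) - (Qf p x)⁻¹ • c k x
    have hsum : ∀ w, ∑ k ∈ Finset.range (n + 1), evn k (e k) w =
        (∑ k ∈ Finset.Icc 2 n, evn k (dcf k H x + LL k (Ax p A x) (hcf k H x)) w)
          - (Qf p x)⁻¹ • ∑ k ∈ Finset.range (n + 1), evn k (c k x) w := by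
      intro w
      have es : ∀ k, evn k (e k) w = (if 2 ≤ k then evn k (dcf k H x + LL k (Ax p A x) (hcf k H x)) w else 0)
          - (Qf p x)⁻¹ • evn k (c k x) w := by
        intro k
        rw [← evL_apply, map_sub, map_smul, evL_apply, evL_apply]
        split_ifs
        · rfl
        · congr 1
          exact (evL k w).map_zero
      rw [Finset.sum_congr rfl fun k _ => es k, Finset.sum_sub_distrib, Finset.smul_sum]
      congr 1
      rw [← Finset.sum_filter]
      refine Finset.sum_congr ?_ fun _ _ => rfl
      ext k
      simp only [Finset.mem_filter, Finset.mem_range, Finset.mem_Icc]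
      omega
    have hEG : ∀ w, Err p A f n H (evP Phi) x w =
        (∑ k ∈ Finset.Icc 2 n, evn k (dcf k H x + LL k (Ax p A x) (hcf k H x)) w) - (Qf p x)⁻¹ • G (x, w) :=
      fun w => Err_expand p A f n H (evP Phi) x (hdH x hx.1) w
    have hlow : ∀ k < n + 1, e k = 0 := by
      refine hom_zero (n + 1) e ?_
      refine ((h5 x hx).add ((hT x hx.1 (n + 1)).const_smul_left (Qf p x)⁻¹)).congr_left fun w => ?_
      rw [hsum, hEG, Pi.smul_apply]
      module
    have hlow' : ∀ w, (∑ k ∈ Finset.Icc 2 n, evn k (dcf k H x + LL k (Ax p A x) (hcf k H x)) w)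
          - (Qf p x)⁻¹ • ∑ k ∈ Finset.range (n + 1), evn k (c k x) w = 0 := by
      intro w
      rw [← hsum]
      refine Finset.sum_eq_zero fun k hk => ?_
      rw [hlow k (Finset.mem_range.1 hk)]
      exact (evL k w).map_zero
    have hE1 : (fun w => Err p A f n H (evP Phi) x w + (Qf p x)⁻¹ • evn (n + 1) (c (n + 1) x) w) =O[𝓝 0]
        fun w : Fin d → ℂ => ‖w‖ ^ (n + 2) := by
      refine ((hT x hx.1 (n + 2)).const_smul_left (-(Qf p x)⁻¹)).congr_left fun w => ?_
      rw [hEG, Pi.smul_apply, Finset.sum_range_succ _ (n + 1), sub_eq_zero.1 (hlow' w)]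
      module
    have hE2 := Err_succ p A f n hn H' (evP Phi') x (hdH' x hx.1) (hf x hx.1) (hf0 x hx.1)
    refine (hE1.add hE2).congr_left fun w => ?_
    have hEE : Err p A f n H' (evP Phi') x w = Err p A f n H (evP Phi) x w := by
      refine Err_congr p A f n _ _ _ _ D hD (fun m _ hm => ?_) (fun m _ hm => ?_) x hx.1 w
      · rw [(hag m hm).1]
        exact fun _ _ => rfl
      · intro t _
        change (fun i => (Phi' m i).eval t) = (fun i => (Phi m i).eval t)
        rw [(hag m hm).2]
    have hcc : dcf (n + 1) H' x + LL (n + 1) (Ax p A x) (hcf (n + 1) H' x) + (Qf p x)⁻¹ • hcf (n + 1) (evP Phi') x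
        = (Qf p x)⁻¹ • c (n + 1) x := by
      have := he x hx.1
      rw [TT_eq _ _ _ _ _ hx.2] at this
      rw [← (hcf_hasDerivAt (n + 1) H' x (hdH' x hx.1)).deriv, hcH, hcP, ← this, smul_add, smul_smul,
        inv_mul_cancel₀ hQ, one_smul]
    rw [hcc, hEE, evn_smul]
    abel

theorem exist_main (p : Fin (S + 2) → ℂ) (hp : Function.Injective p)
    (A : Fin (S + 2) → Matrix (Fin d) (Fin d) ℂ)
    (hA : ∀ j, NonlinearlyNonresonant d (A j))
    (hAinf : NonlinearlyNonresonant d (∑ j, A j))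
    (D : Set ℂ) (hD : IsOpen D) (hDc : IsPreconnected D)
    (hDsc : SimplyConnectedSpace D) (hpD : ∀ j, p j ∈ D)
    (f : ℂ → (Fin d → ℂ) → Fin d → ℂ)
    (hF : ∀ x ∈ D, AnalyticAt ℂ (fun q : ℂ × (Fin d → ℂ) => f q.1 q.2) (x, 0)) (hf0 : ∀ x ∈ D, fderiv ℂ (f x) 0 = 0)
    (hfz : ∀ x ∈ D, f x 0 = 0) :
    ∃ s, ∀ n, 1 ≤ n → StInv p A f D n s := by
  have hf : ∀ x ∈ D, AnalyticAt ℂ (f x) 0 := fun x hx => slice_analytic f x (hF x hx)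
  have hstep : ∀ n : ℕ, ∀ s, StInv p A f D (n + 1) s →
      ∃ s', StInv p A f D (n + 2) s' ∧ ∀ m, ∑ i, m i ≤ n + 1 → s'.1 m = s.1 m ∧ s'.2 m = s.2 m :=
    fun n s hs => step_main p hp A hA hAinf D hD hDc hDsc hpD f hF hf0 (n + 1) (by omega) s hs
  choose! g hg1 hg2 using hstep
  let s : ℕ → ((Fin d → ℕ) → ℂ → Fin d → ℂ) × ((Fin d → ℕ) → Fin d → Polynomial ℂ) :=
    fun n => Nat.rec (0, 0) (fun n s => g n s) n
  have hinv : ∀ n, StInv p A f D (n + 1) (s n) := by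
    intro n
    induction n with
    | zero =>
      refine ⟨fun _ _ => rfl, fun _ _ => rfl, fun m i => ?_, fun m => analyticOnNhd_const, Good_one p A f D hf hf0 hfz⟩
      change (0 : Polynomial ℂ).degree ≤ _
      simp
    | succ n ih => exact hg1 n (s n) ih
  have hag : ∀ n k, ∀ m, ∑ i, m i ≤ n + 1 → (s (n + k)).1 m = (s n).1 m ∧ (s (n + k)).2 m = (s n).2 m := by
    intro n k m hm
    induction k with
    | zero => exact ⟨rfl, rfl⟩
    | succ k ih =>
      have := hg2 (n + k) (s (n + k)) (hinv _) m (by omega)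
      exact ⟨this.1.trans ih.1, this.2.trans ih.2⟩
  refine ⟨(fun m => (s (∑ i, m i)).1 m, fun m => (s (∑ i, m i)).2 m), fun n hn => ⟨?_, ?_, ?_, ?_, ?_⟩⟩
  · intro m hm
    exact (hinv _).1 m hm
  · intro m hm
    exact (hinv _).2.1 m hm
  · intro m i
    exact (hinv _).2.2.1 m i
  · intro m
    exact (hinv _).2.2.2.1 m
  · intro x hx
    have hI := hinv n
    have h0 : Good p A f D (n + 1) (s n).1 (evP (s n).2) := hI.2.2.2.2
    obtain ⟨n, rfl⟩ : ∃ k, n = k + 1 := ⟨n - 1, by omega⟩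
    have h1 := (hinv n).2.2.2.2 x hx
    refine h1.congr_left fun w => ?_
    have hh : ∀ m : Fin d → ℕ, ∑ i, m i ≤ n + 1 → (s n).1 m = (s (∑ i, m i)).1 m ∧ (s n).2 m = (s (∑ i, m i)).2 m := by
      intro m hm
      rcases Nat.le_or_ge (∑ i, m i) n with hle | hge
      · obtain ⟨k, hk⟩ := Nat.exists_eq_add_of_le hle
        have := hag (∑ i, m i) k m (by omega)
        rw [← hk] at this
        exact this
      · obtain ⟨k, hk⟩ := Nat.exists_eq_add_of_le hge
        have := hag n k m hm
        rw [← hk] at this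
        exact ⟨this.1.symm, this.2.symm⟩
    refine Err_congr p A f (n + 1) _ _ _ _ D hD (fun m _ hm => ?_) (fun m _ hm => ?_) x hx.1 w
    · intro t _
      rw [(hh m hm).1]
    · intro t _
      change (fun i => ((s n).2 m i).eval t) = (fun i => ((s (∑ i, m i)).2 m i).eval t)
      rw [(hh m hm).2]

end Exist

/-- Theorem 2 of the paper (unique correction making the system formally linearizable):
for the system `u' = A(x) u + Q(x)⁻¹ f(x,u)` with Fuchsian linear part, all residue
matrices and `A_∞` nonlinearly nonresonant, there is a unique family `(φ_m)_{|m| ≥ 2}`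
of `ℂᵈ`-valued polynomials of degree at most `S` such that the corrected system
`u' = A(x) u + Q(x)⁻¹ (f(x,u) − φ(x,u))` is formally linearizable by
`u = w + Σ_{|m| ≥ 2} h_m(x) wᵐ` with `h_m` analytic on `D`; the conjugacy identity
`∂ₓh + (d_w h)(A w) = A h + Q⁻¹ (f(x, w+h) − φ(x, w+h))` holds order by order, i.e.
for every `n ≥ 2` the identity for the degree-`n` truncations has an error which is
`O(‖w‖^{n+1})` as `w → 0`. -/
theorem stmt_1 (d S : ℕ) (hd : 1 ≤ d)
    (p : Fin (S + 2) → ℂ) (hp : Function.Injective p)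
    (A : Fin (S + 2) → Matrix (Fin d) (Fin d) ℂ)
    (hA : ∀ j, NonlinearlyNonresonant d (A j))
    (hAinf : NonlinearlyNonresonant d (∑ j, A j))
    (D : Set ℂ) (hD : IsOpen D) (hDc : IsPreconnected D)
    (hDsc : SimplyConnectedSpace D) (hpD : ∀ j, p j ∈ D)
    (R : ℝ) (hR : 0 < R)
    (f : ℂ → (Fin d → ℂ) → Fin d → ℂ)
    (hf : AnalyticOnNhd ℂ (fun q : ℂ × (Fin d → ℂ) => f q.1 q.2)
      (D ×ˢ Metric.ball 0 R))
    (hf2 : ∀ x ∈ D, f x 0 = 0 ∧ fderiv ℂ (f x) 0 = 0) :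
    ∃! Phi : (Fin d → ℕ) → Fin d → Polynomial ℂ,
      ((∀ m, ∑ i, m i < 2 → Phi m = 0) ∧
        (∀ m i, (Phi m i).degree ≤ (S : ℕ))) ∧
      ∃ H : (Fin d → ℕ) → ℂ → Fin d → ℂ,
        (∀ m, ∑ i, m i < 2 → H m = 0) ∧
        (∀ m, AnalyticOnNhd ℂ (H m) D) ∧
        ∀ n : ℕ, 2 ≤ n → ∀ x ∈ D \ Set.range p,
          (fun w : Fin d → ℂ =>
              deriv (fun t => truncSeries d n H t w) x
                + (fderiv ℂ (fun v => truncSeries d n H x v) w)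
                    ((∑ j, (x - p j)⁻¹ • A j) *ᵥ w)
                - (∑ j, (x - p j)⁻¹ • A j) *ᵥ truncSeries d n H x w
                - (∏ j, (x - p j))⁻¹ •
                    (f x (w + truncSeries d n H x w)
                      - truncSeries d n (fun m t i => (Phi m i).eval t) x
                          (w + truncSeries d n H x w)))
            =O[𝓝 (0 : Fin d → ℂ)] fun w => ‖w‖ ^ (n + 1) := by
  have hF : ∀ x ∈ D, AnalyticAt ℂ (fun q : ℂ × (Fin d → ℂ) => f q.1 q.2) (x, 0) :=
    fun x hx => hf (x, 0) ⟨hx, Metric.mem_ball_self hR⟩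
  have hf0 : ∀ x ∈ D, fderiv ℂ (f x) 0 = 0 := fun x hx => (hf2 x hx).2
  have hfz : ∀ x ∈ D, f x 0 = 0 := fun x hx => (hf2 x hx).1
  obtain ⟨⟨H, Phi⟩, hs⟩ := exist_main p hp A hA hAinf D hD hDc hDsc hpD f hF hf0 hfz
  obtain ⟨h1, h2, h3, h4, -⟩ := hs 1 le_rfl
  refine ⟨Phi, ⟨⟨h2, h3⟩, H, h1, h4, fun n hn => (hs n (by omega)).2.2.2.2⟩, ?_⟩
  rintro Phi' ⟨⟨h2', h3'⟩, H', h1', h4', h5'⟩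
  funext m
  exact (uniq_main p hp A hA hAinf D hD hDc hDsc hpD f (fun x hx => slice_analytic f x (hF x hx)) hf0
    Phi' Phi H' H h2' h2 h3' h3 h1' h1 h4' h4 h5' (fun n hn => (hs n (by omega)).2.2.2.2) (∑ i, m i) m (by omega)).1
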